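/- For system (1.3) under hypotheses (S1)-(S7) the following statements are equivalent: (a) system (1.3) admits an ORCLF V which satisfies the small-control property with β ≡ 1 and q ≡ 0 (i.e. max{a₁(‖H(t,x)‖_𝒴), a₁(μ(t)‖x‖_r)} ≤ V(t,x) ≤ a₂(‖x‖_r) and, for every (t,φ), there exists u ∈ U with |u| ≤ a(γ(t)|φ|) and Ψ(t,φ,u) ≤ 0), and moreover there exist η ∈ K⁺ and a continuous mapping K : A → U, where A = { (t,φ) ∈ [0,∞)×ℝᵖ : |φ| < 4η(t) }, locally Lipschitz with respect to φ, with K(t,0) = 0 for all t ≥ 0, such that Ψ(t, Φ(t,x), K(t, Φ(t,x))) ≤ 0 for all (t,x) ∈ [0,∞)×C⁰([−r,0];ℝⁿ) with |Φ(t,x)| ≤ 2η(t), where Φ and Ψ are the mappings involved in property (ii) of the ORCLF definition; (b) there exists a continuous mapping k : [0,∞)×C⁰([−r,0];ℝⁿ) → U, completely locally Lipschitz with respect to x, with k(t,0) = 0 for all t ≥ 0, such that the closed-loop system ẋ(t) = f(t, d(t), T_r(t)x, k(t, T_r(t)x)) with output Y(t) = H(t, T_r(t)x) is URGAOS. -/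

import Mathlib

open Filter Topology MeasureTheory Set RealInnerProductSpace

noncomputable section

/-- ℝⁿ with the Euclidean norm. -/
abbrev Euc (n : ℕ) := EuclideanSpace ℝ (Fin n)

/-- The state space C⁰([−r,0];ℝⁿ) with the sup norm. -/
abbrev Hist (n : ℕ) (r : ℝ) := C(Icc (-r) (0:ℝ), Euc n)

/-- Class K∞ functions (on [0,∞)). -/
def IsKinf (a : ℝ → ℝ) : Prop :=
  ContinuousOn a (Ici 0) ∧ StrictMonoOn a (Ici 0) ∧ a 0 = 0 ∧ Tendsto a atTop atTop

/-- Class K⁺: positive continuous functions on [0,∞). -/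
def IsKplus (b : ℝ → ℝ) : Prop := ContinuousOn b (Ici 0) ∧ ∀ t, 0 ≤ t → 0 < b t

/-- Class ℰ: continuous nonnegative integrable functions on [0,∞) tending to 0. -/
def IsClassE (q : ℝ → ℝ) : Prop :=
  ContinuousOn q (Ici 0) ∧ (∀ t, 0 ≤ t → 0 ≤ q t) ∧
    IntegrableOn q (Ici 0) ∧ Tendsto q atTop (𝓝 0)

/-- Continuous positive definite functions on [0,∞). -/
def IsPosDef (ρ : ℝ → ℝ) : Prop :=
  ContinuousOn ρ (Ici 0) ∧ ρ 0 = 0 ∧ (∀ s, 0 < s → 0 < ρ s) ∧ ∀ s, 0 ≤ s → 0 ≤ ρ s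

/-- Membership in M_D : measurable selections of values in D. -/
def InMD {l : ℕ} (D : Set (Euc l)) (d : ℝ → Euc l) : Prop :=
  Measurable d ∧ ∀ t, d t ∈ D

/-- The operator E_h(x;v) of Section 4.II: E_h(x;v)(θ) = x(0)+(θ+h)v for −h < θ ≤ 0 and
E_h(x;v)(θ) = x(θ+h) for −r ≤ θ ≤ −h. -/
def Ehist {n : ℕ} {r : ℝ} (h : ℝ) (x : Hist n r) (v : Euc n) : Hist n r :=
  if hr : -r ≤ 0 then
    { toFun := fun θ => if (θ : ℝ) ≤ -h then x (projIcc (-r) 0 hr ((θ : ℝ) + h))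
        else x (projIcc (-r) 0 hr 0) + ((θ : ℝ) + h) • v
      continuous_toFun := by
        apply Continuous.if_le
        · exact x.continuous.comp (continuous_projIcc.comp (by fun_prop))
        · exact continuous_const.add ((continuous_subtype_val.add continuous_const).smul
            continuous_const)
        · exact continuous_subtype_val
        · exact continuous_const
        · intro θ hθ
          rw [hθ]
          simp }
  else x

/-- The Dini derivative V⁰(t,x;v) of a functional V : [0,∞)×C⁰([−r,0];ℝⁿ) → ℝ:
V⁰(t,x;v) := limsup_{h→0⁺, y→0} (V(t+h, E_h(x;v)+h·y) − V(t,x))/h. -/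
def diniH {n : ℕ} {r : ℝ} (V : ℝ → Hist n r → ℝ) (t : ℝ) (x : Hist n r) (v : Euc n) :
    EReal :=
  Filter.limsup
    (fun p : ℝ × Hist n r =>
      (((V (t + p.1) (Ehist p.1 x v + p.1 • p.2) - V t x) / p.1 : ℝ) : EReal))
    ((𝓝[>] (0:ℝ)) ×ˢ 𝓝 0)

/-- The simplified Dini derivative V⁰(x;v) := limsup_{h→0⁺} (V(E_h(x;v)) − V(x))/h of a
time-independent functional. -/
def diniH0 {n : ℕ} {r : ℝ} (V : Hist n r → ℝ) (x : Hist n r) (v : Euc n) : EReal :=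
  Filter.limsup (fun h : ℝ => (((V (Ehist h x v) - V x) / h : ℝ) : EReal)) (𝓝[>] (0:ℝ))

/-- x : [t₀−r, tmax) → ℝⁿ (with history map φ) is a solution of the RFDE
ẋ(t) = F(t,d(t),T_r(t)x) with initial condition T_r(t₀)x = x₀, in integral form. -/
def IsSolutionRFDE {n l : ℕ} {r : ℝ} (F : ℝ → Euc l → Hist n r → Euc n)
    (d : ℝ → Euc l) (t₀ : ℝ) (x₀ : Hist n r) (tmax : EReal) (x : ℝ → Euc n)
    (φ : ℝ → Hist n r) : Prop :=
  (t₀ : EReal) < tmax ∧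
  φ t₀ = x₀ ∧
  (∀ t : ℝ, t₀ ≤ t → (t : EReal) < tmax → ∀ θ : Icc (-r) (0:ℝ), φ t θ = x (t + θ)) ∧
  ContinuousOn x {s : ℝ | t₀ - r ≤ s ∧ (s : EReal) < tmax} ∧
  (∀ t : ℝ, t₀ ≤ t → (t : EReal) < tmax → x t = x t₀ + ∫ s in t₀..t, F s (d s) (φ s))

/-- A functional V : [0,∞)×C⁰([−r,0];ℝⁿ) → [0,∞) which is
"almost Lipschitz on bounded sets" (Definition 4.5). -/
def AlmostLipschitzOn {n : ℕ} (r : ℝ) (V : ℝ → Hist n r → ℝ) : Prop :=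
  ContinuousOn (fun p : ℝ × Hist n r => V p.1 p.2) (Ici 0 ×ˢ univ) ∧
  ∃ LV P G : ℝ → ℝ, Monotone LV ∧ Monotone P ∧ Monotone G ∧ (∀ s, 1 ≤ G s) ∧
    (∀ R, 0 ≤ R → ∀ t ∈ Icc (0:ℝ) R, ∀ x y : Hist n r, ‖x‖ ≤ R → ‖y‖ ≤ R →
      |V t y - V t x| ≤ LV R * ‖y - x‖) ∧
    (∀ R, 0 ≤ R → ∀ M : ℝ, 0 ≤ M → ∀ x : Hist n r, ‖x‖ ≤ R →
      LipschitzWith (Real.toNNReal M) (fun θ : Icc (-r) (0:ℝ) => x θ) →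
      ∀ t ∈ Icc (0:ℝ) R, ∀ h : ℝ, 0 ≤ h → h ≤ 1 / G (R + M) →
        |V (t + h) x - V t x| ≤ h * P R * (1 + M))

/-- RGAOS (Definition 4.2) of the system ẋ(t) = F(t,d(t),T_r(t)x), Y(t) = H(t,T_r(t)x),
phrased via the existence of a family of unique maximal solutions satisfying robust
forward completeness and properties P1, P2. -/
def RGAOSrfde {n l : ℕ} {Y : Type*} [NormedAddCommGroup Y] [NormedSpace ℝ Y] (r : ℝ)
    (D : Set (Euc l)) (F : ℝ → Euc l → Hist n r → Euc n) (H : ℝ → Hist n r → Y) : Prop :=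
  ∃ (X : ℝ → Hist n r → (ℝ → Euc l) → ℝ → Euc n)
    (Φ : ℝ → Hist n r → (ℝ → Euc l) → ℝ → Hist n r)
    (tmax : ℝ → Hist n r → (ℝ → Euc l) → EReal),
    (∀ t₀ : ℝ, 0 ≤ t₀ → ∀ x₀ d, InMD D d →
      IsSolutionRFDE F d t₀ x₀ (tmax t₀ x₀ d) (X t₀ x₀ d) (Φ t₀ x₀ d) ∧
      ∀ tm y ψ, IsSolutionRFDE F d t₀ x₀ tm y ψ → tm ≤ tmax t₀ x₀ d ∧
        ∀ t : ℝ, t₀ ≤ t → (t : EReal) < tm → ψ t = Φ t₀ x₀ d t) ∧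
    -- robust forward completeness
    (∀ T, 0 ≤ T → ∀ s, 0 ≤ s → ∃ M, ∀ t₀ ∈ Icc (0:ℝ) T, ∀ ξ ∈ Icc (0:ℝ) T,
      ∀ x₀ : Hist n r, ‖x₀‖ ≤ s → ∀ d, InMD D d →
        ((t₀ + ξ : ℝ) : EReal) < tmax t₀ x₀ d ∧ ‖Φ t₀ x₀ d (t₀ + ξ)‖ ≤ M) ∧
    -- P1 (output stability)
    (∀ ε, 0 < ε → ∀ T, 0 ≤ T →
      (∃ M, ∀ t₀ ∈ Icc (0:ℝ) T, ∀ x₀ : Hist n r, ‖x₀‖ ≤ ε → ∀ d, InMD D d →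
        ∀ t : ℝ, t₀ ≤ t → (t : EReal) < tmax t₀ x₀ d → ‖H t (Φ t₀ x₀ d t)‖ ≤ M) ∧
      (∃ δ, 0 < δ ∧ ∀ t₀ ∈ Icc (0:ℝ) T, ∀ x₀ : Hist n r, ‖x₀‖ ≤ δ → ∀ d, InMD D d →
        ∀ t : ℝ, t₀ ≤ t → (t : EReal) < tmax t₀ x₀ d → ‖H t (Φ t₀ x₀ d t)‖ ≤ ε)) ∧
    -- P2 (uniform output attractivity on bounded sets of initial data)
    (∀ ε, 0 < ε → ∀ T, 0 ≤ T → ∀ R, 0 ≤ R → ∃ τ, 0 ≤ τ ∧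
      ∀ t₀ ∈ Icc (0:ℝ) T, ∀ x₀ : Hist n r, ‖x₀‖ ≤ R → ∀ d, InMD D d →
        ∀ t : ℝ, t₀ + τ ≤ t → (t : EReal) < tmax t₀ x₀ d → ‖H t (Φ t₀ x₀ d t)‖ ≤ ε)

/-- URGAOS (Definition 4.3) of the system ẋ(t) = F(t,d(t),T_r(t)x), Y(t) = H(t,T_r(t)x). -/
def URGAOSrfde {n l : ℕ} {Y : Type*} [NormedAddCommGroup Y] [NormedSpace ℝ Y] (r : ℝ)
    (D : Set (Euc l)) (F : ℝ → Euc l → Hist n r → Euc n) (H : ℝ → Hist n r → Y) : Prop :=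
  ∃ (X : ℝ → Hist n r → (ℝ → Euc l) → ℝ → Euc n)
    (Φ : ℝ → Hist n r → (ℝ → Euc l) → ℝ → Hist n r)
    (tmax : ℝ → Hist n r → (ℝ → Euc l) → EReal),
    (∀ t₀ : ℝ, 0 ≤ t₀ → ∀ x₀ d, InMD D d →
      IsSolutionRFDE F d t₀ x₀ (tmax t₀ x₀ d) (X t₀ x₀ d) (Φ t₀ x₀ d) ∧
      ∀ tm y ψ, IsSolutionRFDE F d t₀ x₀ tm y ψ → tm ≤ tmax t₀ x₀ d ∧
        ∀ t : ℝ, t₀ ≤ t → (t : EReal) < tm → ψ t = Φ t₀ x₀ d t) ∧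
    (∀ T, 0 ≤ T → ∀ s, 0 ≤ s → ∃ M, ∀ t₀ ∈ Icc (0:ℝ) T, ∀ ξ ∈ Icc (0:ℝ) T,
      ∀ x₀ : Hist n r, ‖x₀‖ ≤ s → ∀ d, InMD D d →
        ((t₀ + ξ : ℝ) : EReal) < tmax t₀ x₀ d ∧ ‖Φ t₀ x₀ d (t₀ + ξ)‖ ≤ M) ∧
    (∀ ε, 0 < ε →
      (∃ M, ∀ t₀ : ℝ, 0 ≤ t₀ → ∀ x₀ : Hist n r, ‖x₀‖ ≤ ε → ∀ d, InMD D d →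
        ∀ t : ℝ, t₀ ≤ t → (t : EReal) < tmax t₀ x₀ d → ‖H t (Φ t₀ x₀ d t)‖ ≤ M) ∧
      (∃ δ, 0 < δ ∧ ∀ t₀ : ℝ, 0 ≤ t₀ → ∀ x₀ : Hist n r, ‖x₀‖ ≤ δ → ∀ d, InMD D d →
        ∀ t : ℝ, t₀ ≤ t → (t : EReal) < tmax t₀ x₀ d → ‖H t (Φ t₀ x₀ d t)‖ ≤ ε)) ∧
    (∀ ε, 0 < ε → ∀ R, 0 ≤ R → ∃ τ, 0 ≤ τ ∧
      ∀ t₀ : ℝ, 0 ≤ t₀ → ∀ x₀ : Hist n r, ‖x₀‖ ≤ R → ∀ d, InMD D d →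
        ∀ t : ℝ, t₀ + τ ≤ t → (t : EReal) < tmax t₀ x₀ d → ‖H t (Φ t₀ x₀ d t)‖ ≤ ε)

/-- Hypotheses (S1)-(S7) for the control system (1.3). -/
def HypS {n l m : ℕ} {Y : Type*} [NormedAddCommGroup Y] [NormedSpace ℝ Y]
    (r : ℝ) (hr : 0 < r) (D : Set (Euc l)) (U : Set (Euc m))
    (f : ℝ → Euc l → Hist n r → Euc m → Euc n) (H : ℝ → Hist n r → Y) : Prop :=
  -- f(t,d,0,0) = 0, H(t,0) = 0
  (∀ t : ℝ, 0 ≤ t → ∀ d ∈ D, f t d 0 0 = 0) ∧ (∀ t : ℝ, 0 ≤ t → H t 0 = 0) ∧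
  -- (S1)
  (∀ t : ℝ, 0 ≤ t → ContinuousOn
    (fun p : Hist n r × Euc m × Euc l => f t p.2.2 p.1 p.2.1) (univ ×ˢ U ×ˢ D)) ∧
  (∃ L : ℝ → ℝ, ContinuousOn L (Ici 0) ∧ MonotoneOn L (Ici 0) ∧ (∀ s, 0 ≤ s → 0 ≤ L s) ∧
    ∀ t : ℝ, 0 ≤ t → ∀ x y : Hist n r, ∀ d ∈ D, ∀ u ∈ U,
      ⟪x ⟨0, ⟨by linarith, le_rfl⟩⟩ - y ⟨0, ⟨by linarith, le_rfl⟩⟩,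
        f t d x u - f t d y u⟫ ≤ L (t + ‖x‖ + ‖y‖ + ‖u‖) * ‖x - y‖ ^ 2) ∧
  -- (S2)
  (∀ T, 0 ≤ T → ∀ R, 0 ≤ R → ∀ Ru, 0 ≤ Ru → ∃ M, ∀ t ∈ Icc (0:ℝ) T, ∀ d ∈ D,
    ∀ x : Hist n r, ‖x‖ ≤ R → ∀ u ∈ U, ‖u‖ ≤ Ru → ‖f t d x u‖ ≤ M) ∧
  -- (S3)
  (∃ A : Set ℝ, A.Countable ∧ (∀ K : Set ℝ, IsCompact K → (A ∩ K).Finite) ∧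
    ContinuousOn (fun p : ℝ × Hist n r × Euc m × Euc l => f p.1 p.2.2.2 p.2.1 p.2.2.1)
      ((Ici 0 \ A) ×ˢ univ ×ˢ U ×ˢ D) ∧
    ∀ t₀ : ℝ, 0 ≤ t₀ → ∀ x : Hist n r, ∀ u ∈ U, ∀ d ∈ D,
      Tendsto (fun t => f t d x u) (𝓝[>] t₀) (𝓝 (f t₀ d x u))) ∧
  -- (S4)
  (∀ ε, 0 < ε → ∀ t : ℝ, 0 ≤ t → ∃ δ, 0 < δ ∧ ∀ τ : ℝ, 0 ≤ τ → ∀ d ∈ D, ∀ u ∈ U,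
    ∀ x : Hist n r, |τ - t| + ‖x‖ + ‖u‖ < δ → ‖f τ d x u‖ < ε) ∧
  -- (S5)
  (∃ LU : ℝ → ℝ, ContinuousOn LU (Ici 0) ∧ MonotoneOn LU (Ici 0) ∧
    (∀ s, 0 ≤ s → 0 ≤ LU s) ∧
    ∀ t : ℝ, 0 ≤ t → ∀ x : Hist n r, ∀ d ∈ D, ∀ u ∈ U, ∀ v ∈ U,
      ‖f t d x u - f t d x v‖ ≤ LU (t + ‖x‖ + ‖u‖ + ‖v‖) * ‖u - v‖) ∧
  -- (S6)
  IsCompact D ∧ D.Nonempty ∧ IsClosed U ∧ Convex ℝ U ∧ (0 : Euc m) ∈ U ∧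
  -- (S7)
  (∀ T, 0 ≤ T → ∀ R, 0 ≤ R → ∃ LH, 0 ≤ LH ∧ ∀ t ∈ Icc (0:ℝ) T, ∀ τ ∈ Icc (0:ℝ) T,
    ∀ x y : Hist n r, ‖x‖ ≤ R → ‖y‖ ≤ R →
      ‖H t x - H τ y‖ ≤ LH * (|t - τ| + ‖x - y‖))

/-- The conjunction of all requirements of Definition 4.7 for an ORCLF of system (1.3),
with all the data given explicitly. -/
def ORCLFrfde {n l m p : ℕ} {Y : Type*} [NormedAddCommGroup Y] [NormedSpace ℝ Y]
    (r : ℝ) (D : Set (Euc l)) (U : Set (Euc m))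
    (f : ℝ → Euc l → Hist n r → Euc m → Euc n) (H : ℝ → Hist n r → Y)
    (V : ℝ → Hist n r → ℝ) (a₁ a₂ β μ : ℝ → ℝ)
    (Ψ : ℝ → Euc p → Euc m → EReal) (Φ : ℝ → Hist n r → Euc p) (q ρ : ℝ → ℝ) : Prop :=
  AlmostLipschitzOn r V ∧ (∀ t x, 0 ≤ V t x) ∧
  -- property (i)
  IsKinf a₁ ∧ IsKinf a₂ ∧ IsKplus β ∧ IsKplus μ ∧
  (∀ t : ℝ, 0 ≤ t → ∀ x : Hist n r,
    max (a₁ ‖H t x‖) (a₁ (μ t * ‖x‖)) ≤ V t x ∧ V t x ≤ a₂ (β t * ‖x‖)) ∧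
  -- property (ii)
  IsClassE q ∧ IsPosDef ρ ∧
  (∀ t φ u, Ψ t φ u ≠ ⊥) ∧
  (∀ t : ℝ, 0 ≤ t → Ψ t 0 0 = 0) ∧
  (∀ u ∈ U, UpperSemicontinuousOn (fun pr : ℝ × Euc p => Ψ pr.1 pr.2 u)
    (Ici 0 ×ˢ univ)) ∧
  ContinuousOn (fun pr : ℝ × Hist n r => Φ pr.1 pr.2) (Ici 0 ×ˢ univ) ∧
  (∀ T, 0 ≤ T → ∀ R, 0 ≤ R → ∃ L, ∀ t ∈ Icc (0:ℝ) T, ∀ x y : Hist n r,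
    ‖x‖ ≤ R → ‖y‖ ≤ R → ‖Φ t x - Φ t y‖ ≤ L * ‖x - y‖) ∧
  (∀ t : ℝ, 0 ≤ t → Φ t 0 = 0) ∧
  (∀ t : ℝ, 0 ≤ t → ∀ φv : Euc p, (⨅ u : U, Ψ t φv u.1) ≤ ((q t : ℝ) : EReal)) ∧
  (∀ t : ℝ, 0 ≤ t → ∀ x : Hist n r, ∀ (N : ℕ) (u : Fin N → Euc m), (∀ i, u i ∈ U) →
    ∀ lam : Fin N → ℝ, (∀ i, 0 ≤ lam i) → (∑ i, lam i) = 1 → ∀ d ∈ D,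
      diniH V t x (f t d x (∑ i, lam i • u i)) ≤
        ((-ρ (V t x) : ℝ) : EReal) + ⨆ i, Ψ t (Φ t x) (u i))

/-- The "small-control" property of Definition 4.7. -/
def SmallControlRFDE {m p : ℕ} (U : Set (Euc m))
    (Ψ : ℝ → Euc p → Euc m → EReal) (q : ℝ → ℝ) (a γ : ℝ → ℝ) : Prop :=
  IsKinf a ∧ IsKplus γ ∧
  ∀ t : ℝ, 0 ≤ t → ∀ φv : Euc p, ∃ u ∈ U, ‖u‖ ≤ a (γ t * ‖φv‖) ∧
    Ψ t φv u ≤ ((q t : ℝ) : EReal)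

/-- A feedback k : [0,∞)×C⁰([−r,0];ℝⁿ) → U which is continuous, completely locally
Lipschitz with respect to x, and vanishes at 0. -/
def GoodFeedback {n m : ℕ} (r : ℝ) (U : Set (Euc m))
    (kf : ℝ → Hist n r → Euc m) : Prop :=
  (∀ t x, kf t x ∈ U) ∧
  ContinuousOn (fun pr : ℝ × Hist n r => kf pr.1 pr.2) (Ici 0 ×ˢ univ) ∧
  (∀ T, 0 ≤ T → ∀ R, 0 ≤ R → ∃ L, ∀ t ∈ Icc (0:ℝ) T, ∀ x y : Hist n r,
    ‖x‖ ≤ R → ‖y‖ ≤ R → ‖kf t x - kf t y‖ ≤ L * ‖x - y‖) ∧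
  (∀ t : ℝ, 0 ≤ t → kf t 0 = 0)

section Thm410

variable {n l m : ℕ} {Y : Type*} [NormedAddCommGroup Y] [NormedSpace ℝ Y]
  (r : ℝ) (D : Set (Euc l)) (U : Set (Euc m))
  (f : ℝ → Euc l → Hist n r → Euc m → Euc n) (H : ℝ → Hist n r → Y)

/-- Statement (a) of Theorem 4.10: existence of an ORCLF with β ≡ 1 satisfying the
small-control property with q ≡ 0, together with a locally Lipschitz partial feedback K
defined near Φ = 0 annihilating Ψ there. -/
def Thm410a : Prop :=
  ∃ (V : ℝ → Hist n r → ℝ) (a₁ a₂ μ : ℝ → ℝ) (p : ℕ)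
    (Ψ : ℝ → Euc p → Euc m → EReal) (Φ : ℝ → Hist n r → Euc p)
    (ρ : ℝ → ℝ) (a γ : ℝ → ℝ) (η : ℝ → ℝ) (K : ℝ → Euc p → Euc m),
    ORCLFrfde r D U f H V a₁ a₂ (fun _ => 1) μ Ψ Φ (fun _ => 0) ρ ∧
    SmallControlRFDE U Ψ (fun _ => 0) a γ ∧
    IsKplus η ∧
    (∀ t φv, K t φv ∈ U) ∧
    (∀ t : ℝ, 0 ≤ t → K t 0 = 0) ∧
    ContinuousOn (fun pr : ℝ × Euc p => K pr.1 pr.2)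
      {pr : ℝ × Euc p | 0 ≤ pr.1 ∧ ‖pr.2‖ < 4 * η pr.1} ∧
    -- K is locally Lipschitz with respect to φ on A
    (∀ S : Set (ℝ × Euc p), IsCompact S →
      S ⊆ {pr : ℝ × Euc p | 0 ≤ pr.1 ∧ ‖pr.2‖ < 4 * η pr.1} →
      ∃ L, ∀ t φ₁ φ₂, (t, φ₁) ∈ S → (t, φ₂) ∈ S →
        ‖K t φ₁ - K t φ₂‖ ≤ L * ‖φ₁ - φ₂‖) ∧
    -- inequality (4.12)
    (∀ t : ℝ, 0 ≤ t → ∀ x : Hist n r, ‖Φ t x‖ ≤ 2 * η t →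
      Ψ t (Φ t x) (K t (Φ t x)) ≤ (0 : EReal))

/-- Statement (b) of Theorem 4.10: existence of a continuous, completely locally
Lipschitz stabilizing feedback making the closed-loop system URGAOS. -/
def Thm410b : Prop :=
  ∃ kf : ℝ → Hist n r → Euc m, GoodFeedback r U kf ∧
    URGAOSrfde r D (fun t d x => f t d x (kf t x)) H

end Thm410


def z0 {r : ℝ} (hr : 0 < r) : Icc (-r) (0:ℝ) := ⟨0, ⟨by linarith, le_rfl⟩⟩

/-- history segment of a continuous path -/
def hst {n : ℕ} (r : ℝ) (x : C(ℝ, Euc n)) (t : ℝ) : Hist n r :=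
  ⟨fun θ => x (t + θ), by fun_prop⟩

structure GoodF {n l : ℕ} (r : ℝ) (hr : 0 < r) (D : Set (Euc l))
    (F : ℝ → Euc l → Hist n r → Euc n) : Prop where
  zero : ∀ t, 0 ≤ t → ∀ d ∈ D, F t d 0 = 0
  lip : ∀ R, 0 ≤ R → ∃ L, 0 ≤ L ∧ ∀ t ∈ Icc (0:ℝ) R, ∀ d ∈ D, ∀ x y : Hist n r,
    ‖x‖ ≤ R → ‖y‖ ≤ R → ⟪x (z0 hr) - y (z0 hr), F t d x - F t d y⟫ ≤ L * ‖x - y‖ ^ 2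
  bdd : ∀ R, 0 ≤ R → ∃ C, 0 ≤ C ∧ ∀ t ∈ Icc (0:ℝ) R, ∀ d ∈ D, ∀ x : Hist n r,
    ‖x‖ ≤ R → ‖F t d x‖ ≤ C
  meas : ∀ d, InMD D d → ∀ ψ : ℝ → Hist n r, Continuous ψ → ∀ a b : ℝ, 0 ≤ a →
    AEStronglyMeasurable (fun s => F s (d s) (ψ s)) (volume.restrict (Ioc a b))
  cont : ∀ t, 0 ≤ t → ∀ d ∈ D, Continuous (F t d)
  rcont : ∀ t, 0 ≤ t → ∀ d ∈ D, ∀ x, Tendsto (fun s => F s d x) (𝓝[>] t) (𝓝 (F t d x))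

lemma norm_z0_le {n : ℕ} {r : ℝ} (hr : 0 < r) (x : Hist n r) : ‖x (z0 hr)‖ ≤ ‖x‖ :=
  x.norm_coe_le_norm _

lemma goodF_of {n l m : ℕ} {Y : Type*} [NormedAddCommGroup Y] [NormedSpace ℝ Y]
    {r : ℝ} {hr : 0 < r} {D : Set (Euc l)} {U : Set (Euc m)}
    {f : ℝ → Euc l → Hist n r → Euc m → Euc n} {H : ℝ → Hist n r → Y}
    (hS : HypS r hr D U f H) {k : ℝ → Hist n r → Euc m} (hk : GoodFeedback r U k) :
    GoodF r hr D (fun t d x => f t d x (k t x)) := by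
  obtain ⟨f0, H0, f1, ⟨L, Lc, Lm, Lp, hL⟩, f2, ⟨A, Ac, Af, fA, fr⟩, f4, ⟨M, Mc, Mm, Mp, hM⟩,
    Dc, Dn, Uc, Uv, U0, H7⟩ := hS
  obtain ⟨kU, kc, kl, k0⟩ := hk
  have kbd : ∀ R, 0 ≤ R → ∃ C, 0 ≤ C ∧ (∀ t ∈ Icc (0:ℝ) R, ∀ x y : Hist n r, ‖x‖ ≤ R → ‖y‖ ≤ R →
      ‖k t x - k t y‖ ≤ C * ‖x - y‖) ∧ ∀ t ∈ Icc (0:ℝ) R, ∀ x : Hist n r, ‖x‖ ≤ R →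
      ‖k t x‖ ≤ C * R := by
    intro R hR
    obtain ⟨C, hC⟩ := kl R hR R hR
    have h1 : ∀ t ∈ Icc (0:ℝ) R, ∀ x y : Hist n r, ‖x‖ ≤ R → ‖y‖ ≤ R →
      ‖k t x - k t y‖ ≤ |C| * ‖x - y‖ := fun t ht x y hx hy =>
        (hC t ht x y hx hy).trans (by gcongr; exact le_abs_self C)
    refine ⟨|C|, abs_nonneg _, h1, fun t ht x hx => ?_⟩
    have := h1 t ht x 0 hx (by simpa using hR)
    rw [k0 t ht.1, sub_zero, sub_zero] at this
    exact this.trans (by gcongr)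
  have kcx : ∀ t, 0 ≤ t → Continuous (k t) := by
    intro t ht
    have : ContinuousOn (fun x : Hist n r => k t x) univ :=
      kc.comp (f := fun x : Hist n r => (t, x)) (by fun_prop) (fun x _ => ⟨ht, mem_univ _⟩)
    exact continuousOn_univ.1 this
  classical
  refine ⟨?_, ?_, ?_, ?_, ?_, ?_⟩
  · intro t ht d hd
    simp [k0 t ht, f0 t ht d hd]
  · intro R hR
    obtain ⟨C, C0, hC, hCb⟩ := kbd R hR
    refine ⟨L (3 * R + C * R) + M (2 * R + 2 * (C * R)) * C, ?_, ?_⟩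
    · have := Lp (3 * R + C * R) (by positivity)
      have := Mp (2 * R + 2 * (C * R)) (by positivity)
      positivity
    · intro t ht d hd x y hx hy
      have e : f t d x (k t x) - f t d y (k t y) = (f t d x (k t x) - f t d y (k t x)) +
        (f t d y (k t x) - f t d y (k t y)) := by abel
      rw [e, inner_add_right, add_mul]
      have b1 := hCb t ht x hx
      have b2 := hCb t ht y hy
      gcongr
      · refine (hL t ht.1 x y d hd _ (kU t x)).trans ?_
        gcongr
        refine Lm (by have := ht.1; simp only [mem_Ici]; positivity) (by simp only [mem_Ici]; positivity) ?_
        linarith [ht.2]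
      · refine (real_inner_le_norm _ _).trans ?_
        have h1 : ‖x (z0 hr) - y (z0 hr)‖ ≤ ‖x - y‖ := norm_z0_le hr (x - y)
        have h2 : ‖f t d y (k t x) - f t d y (k t y)‖ ≤ M (2 * R + 2 * (C * R)) * (C * ‖x - y‖) := by
          refine (hM t ht.1 y d hd _ (kU t x) _ (kU t y)).trans ?_
          have m0 := Mp (2 * R + 2 * (C * R)) (by positivity)
          refine mul_le_mul ?_ (hC t ht x y hx hy) (norm_nonneg _) m0
          refine Mm (by have := ht.1; simp only [mem_Ici]; positivity) (by simp only [mem_Ici]; positivity) ?_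
          linarith [ht.2]
        calc _ ≤ ‖x - y‖ * (M (2 * R + 2 * (C * R)) * (C * ‖x - y‖)) := by gcongr
          _ = _ := by ring
  · intro R hR
    obtain ⟨C, C0, hC, hCb⟩ := kbd R hR
    obtain ⟨B, hB⟩ := f2 R hR R hR (C * R) (by positivity)
    refine ⟨|B|, abs_nonneg _, fun t ht d hd x hx => ?_⟩
    exact (hB t ht d hd x hx _ (kU t x) (hCb t ht x hx)).trans (le_abs_self B)
  · intro d hd ψ hψ a b ha
    have hDm : MeasurableSet D := Dc.isClosed.measurableSet
    set S : Set (ℝ × Euc l) := (Ioc a b \ A) ×ˢ D with hSd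
    have hSm : MeasurableSet S := (measurableSet_Ioc.diff Ac.measurableSet).prod hDm
    set g : ℝ × Euc l → Euc n := fun p => f p.1 p.2 (ψ p.1) (k p.1 (ψ p.1)) with hg
    have hgc : ContinuousOn g S := by
      have hk1 : ContinuousOn (fun p : ℝ × Euc l => k p.1 (ψ p.1)) S :=
        kc.comp (f := fun p : ℝ × Euc l => (p.1, ψ p.1)) (by fun_prop)
          (fun p hp => ⟨ha.trans hp.1.1.1.le, mem_univ _⟩)
      refine fA.comp (f := fun p : ℝ × Euc l => (p.1, ψ p.1, k p.1 (ψ p.1), p.2)) ?_ ?_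
      · exact continuousOn_fst.prodMk ((hψ.comp continuous_fst).continuousOn.prodMk
          (hk1.prodMk continuousOn_snd))
      · intro p hp
        exact ⟨⟨ha.trans hp.1.1.1.le, hp.1.2⟩, mem_univ _, kU _ _, hp.2⟩
    have hgm : Measurable (S.piecewise g 0) :=
      hgc.measurable_piecewise continuousOn_const hSm
    have hm : Measurable (fun s => S.piecewise g 0 (s, d s)) :=
      hgm.comp (measurable_id.prodMk hd.1)
    refine AEStronglyMeasurable.congr hm.aestronglyMeasurable ?_
    have hA0 : ∀ᵐ s ∂(volume.restrict (Ioc a b)), s ∉ A :=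
      ae_restrict_of_ae (measure_eq_zero_iff_ae_notMem.1 (Ac.measure_zero volume))
    filter_upwards [hA0, ae_restrict_mem measurableSet_Ioc] with s h1 h2
    rw [piecewise_eq_of_mem _ _ _ (show (s, d s) ∈ S from ⟨⟨h2, h1⟩, hd.2 s⟩)]
  · intro t ht d hd
    have : ContinuousOn (fun x : Hist n r => f t d x (k t x)) univ := by
      refine (f1 t ht).comp (f := fun x : Hist n r => (x, k t x, d)) ?_ ?_
      · have := kcx t ht
        fun_prop
      · intro x _
        exact ⟨mem_univ _, kU t x, hd⟩
    exact continuousOn_univ.1 this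
  · intro t ht d hd x
    have h1 := fr t ht x _ (kU t x) d hd
    have hkt : Tendsto (fun s => k s x) (𝓝[>] t) (𝓝 (k t x)) := by
      have h : ContinuousOn (fun s => k s x) (Ici 0) :=
        kc.comp (f := fun s => (s, x)) (by fun_prop) (fun s hs => ⟨hs, mem_univ _⟩)
      exact (h t ht).mono_left (nhdsWithin_mono _ (fun s hs => ht.trans (le_of_lt hs)))
    have h2 : Tendsto (fun s => f s d x (k s x) - f s d x (k t x)) (𝓝[>] t) (𝓝 0) := by
      have hb : ∀ᶠ s in 𝓝[>] t, ‖f s d x (k s x) - f s d x (k t x)‖ ≤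
          M (t + 1 + ‖x‖ + (‖k t x‖ + 1) + ‖k t x‖) * ‖k s x - k t x‖ := by
        have e1 : ∀ᶠ s in 𝓝[>] t, ‖k s x‖ < ‖k t x‖ + 1 :=
          (hkt.norm).eventually_lt_const (by linarith)
        have e2 : ∀ᶠ s in 𝓝[>] t, s ∈ Ioo t (t+1) := Ioo_mem_nhdsGT (by linarith)
        filter_upwards [e1, e2] with s h1 h2
        have s0 : 0 ≤ s := ht.trans h2.1.le
        refine (hM s s0 x d hd _ (kU s x) _ (kU t x)).trans ?_
        gcongr
        refine Mm (by simp only [mem_Ici]; positivity) (by simp only [mem_Ici]; positivity) ?_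
        linarith [h2.2]
      refine squeeze_zero_norm' hb ?_
      have := ((hkt.sub_const (k t x)).norm).const_mul (M (t + 1 + ‖x‖ + (‖k t x‖ + 1) + ‖k t x‖))
      simpa using this
    simpa using h2.add h1


section basics
variable {n : ℕ} {r : ℝ}

@[simp] lemma hst_apply (x : C(ℝ, Euc n)) (t : ℝ) (θ : Icc (-r) (0:ℝ)) :
    hst r x t θ = x (t + θ) := rfl

lemma hst_cont (x : C(ℝ, Euc n)) : Continuous (hst r x) := by
  have : hst r x = fun t => (ContinuousMap.curry
      (⟨fun p : ℝ × Icc (-r) (0:ℝ) => x (p.1 + p.2), by fun_prop⟩ : C(ℝ × Icc (-r) (0:ℝ), Euc n))) t := by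
    funext t; ext1 θ; rfl
  rw [this]; exact (ContinuousMap.curry _).continuous

lemma hst_sub (x y : C(ℝ, Euc n)) (t : ℝ) : hst r (x - y) t = hst r x t - hst r y t := rfl

lemma hst_z0 (hr : 0 < r) (x : C(ℝ, Euc n)) (t : ℝ) : hst r x t (z0 hr) = x t := by
  simp [z0]

lemma norm_hst_le {x : C(ℝ, Euc n)} {t B : ℝ} (hB : 0 ≤ B)
    (h : ∀ s ∈ Icc (t - r) t, ‖x s‖ ≤ B) : ‖hst r x t‖ ≤ B := by
  rw [ContinuousMap.norm_le _ hB]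
  intro θ
  exact h _ ⟨by linarith [θ.2.1], by linarith [θ.2.2]⟩

lemma norm_le_hst (x : C(ℝ, Euc n)) {t s : ℝ} (h : s ∈ Icc (t - r) t) : ‖x s‖ ≤ ‖hst r x t‖ := by
  have := (hst r x t).norm_coe_le_norm ⟨s - t, by linarith [h.1], by linarith [h.2]⟩
  simpa using this

end basics

lemma quad_const {P : ℝ → ℝ} {a b K : ℝ}
    (h : ∀ s ∈ Icc a b, ∀ t ∈ Icc a b, s ≤ t → |P t - P s| ≤ K * (t - s) ^ 2) :
    ∀ t ∈ Icc a b, P t = P a := by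
  have h' : ∀ s ∈ Icc a b, ∀ t ∈ Icc a b, |P t - P s| ≤ K * (t - s) ^ 2 := by
    intro s hs t ht
    rcases le_total s t with hst | hst
    · exact h s hs t ht hst
    · rw [abs_sub_comm]; have := h t ht s hs hst; nlinarith
  have hd : ∀ x ∈ Icc a b, HasDerivWithinAt P 0 (Icc a b) x := by
    intro x hx
    rw [hasDerivWithinAt_iff_isLittleO]
    have : (fun y => P y - P x - (y - x) • (0:ℝ)) =O[𝓝[Icc a b] x] fun y => (y - x) ^ 2 := by
      refine Asymptotics.IsBigO.of_bound K ?_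
      filter_upwards [self_mem_nhdsWithin] with y hy
      simpa using h' x hx y hy
    refine this.trans_isLittleO ?_
    have h3 : (fun y : ℝ => (y - x) * (y - x)) =o[𝓝[Icc a b] x] fun y => (y - x) * 1 := by
      refine (Asymptotics.isBigO_refl _ _).mul_isLittleO ?_
      rw [Asymptotics.isLittleO_one_iff]
      have : Tendsto (fun y : ℝ => y - x) (𝓝 x) (𝓝 (x - x)) := (continuous_id.sub continuous_const).tendsto x
      simpa using this.mono_left nhdsWithin_le_nhds
    simpa [sq] using h3
  intro t ht
  refine constant_of_derivWithin_zero (fun x hx => (hd x hx).differentiableWithinAt) ?_ t ht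
  intro x hx
  have hx' : x ∈ Icc a b := ⟨hx.1, hx.2.le⟩
  exact (hd x hx').derivWithin (uniqueDiffOn_Icc (hx.1.trans_lt hx.2) x hx')

lemma energy {n : ℕ} {z : C(ℝ, Euc n)} {g : ℝ → Euc n} {a b C : ℝ} (hab : a ≤ b) (hC0 : 0 ≤ C)
    (hg : IntervalIntegrable g volume a b) (hC : ∀ s ∈ Icc a b, ‖g s‖ ≤ C)
    (hz : ∀ t ∈ Icc a b, z t = z a + ∫ s in a..t, g s) :
    ∀ t ∈ Icc a b, ‖z t‖ ^ 2 = ‖z a‖ ^ 2 + 2 * ∫ s in a..t, ⟪z s, g s⟫ := by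
  have hi : ∀ s ∈ Icc a b, ∀ t ∈ Icc a b, s ≤ t → IntervalIntegrable g volume s t := by
    intro s hs t ht hst
    refine hg.mono_set ?_
    rw [uIcc_of_le hab, uIcc_of_le hst]; exact Icc_subset_Icc hs.1 ht.2
  have hii : ∀ w : ℝ → Euc n, Continuous w → ∀ s ∈ Icc a b, ∀ t ∈ Icc a b, s ≤ t →
      IntervalIntegrable (fun σ => ⟪w σ, g σ⟫) volume s t := by
    intro w hw s hs t ht hst
    have h1 := hi s hs t ht hst
    obtain ⟨B, hB⟩ := (isCompact_uIcc (a := s) (b := t)).exists_bound_of_continuousOn hw.continuousOn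
    rw [intervalIntegrable_iff] at h1 ⊢
    refine Integrable.mono' (h1.norm.const_mul B) ?_ ?_
    · exact (hw.aestronglyMeasurable).inner h1.aestronglyMeasurable
    · filter_upwards [ae_restrict_mem measurableSet_uIoc] with σ hσ
      refine (norm_inner_le_norm _ _).trans ?_
      gcongr
      exact hB σ (uIoc_subset_uIcc hσ)
  have hinc : ∀ s ∈ Icc a b, ∀ t ∈ Icc a b, s ≤ t → z t - z s = ∫ σ in s..t, g σ := by
    intro s hs t ht hst
    rw [hz t ht, hz s hs, ← intervalIntegral.integral_add_adjacent_intervals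
      (hi a ⟨le_rfl, hab⟩ s hs hs.1) (hi s hs t ht hst)]
    abel
  have hlip : ∀ s ∈ Icc a b, ∀ t ∈ Icc a b, s ≤ t → ‖z t - z s‖ ≤ C * (t - s) := by
    intro s hs t ht hst
    rw [hinc s hs t ht hst]
    have := intervalIntegral.norm_integral_le_of_norm_le_const (a := s) (b := t) (f := g) (C := C)
      (fun σ hσ => by
        rw [uIoc_of_le hst] at hσ
        exact hC σ ⟨hs.1.trans hσ.1.le, hσ.2.trans ht.2⟩)
    rwa [abs_of_nonneg (by linarith)] at this
  have key := quad_const (P := fun t => ‖z t‖ ^ 2 - 2 * ∫ s in a..t, ⟪z s, g s⟫) (a := a) (b := b)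
    (K := 2 * C * C) ?_
  · intro t ht
    have := key t ht
    simp only [intervalIntegral.integral_same] at this
    linarith
  · intro s hs t ht hst
    have e1 : (∫ σ in a..t, ⟪z σ, g σ⟫) = (∫ σ in a..s, ⟪z σ, g σ⟫) + ∫ σ in s..t, ⟪z σ, g σ⟫ :=
      (intervalIntegral.integral_add_adjacent_intervals
        (hii z z.continuous a ⟨le_rfl, hab⟩ s hs hs.1) (hii z z.continuous s hs t ht hst)).symm
    have e2 : ‖z t‖ ^ 2 - ‖z s‖ ^ 2 = ∫ σ in s..t, ⟪z t + z s, g σ⟫ := by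
      have : ‖z t‖ ^ 2 - ‖z s‖ ^ 2 = ⟪z t + z s, z t - z s⟫ := by
        rw [inner_add_left, inner_sub_right, inner_sub_right, real_inner_self_eq_norm_sq,
          real_inner_self_eq_norm_sq, real_inner_comm (z t) (z s)]; ring
      rw [this, hinc s hs t ht hst, intervalIntegral.integral_of_le hst,
        intervalIntegral.integral_of_le hst, integral_inner]
      exact (intervalIntegrable_iff_integrableOn_Ioc_of_le hst).1 (hi s hs t ht hst)
    have e3 : ‖z t‖ ^ 2 - 2 * (∫ σ in a..t, ⟪z σ, g σ⟫) - (‖z s‖ ^ 2 - 2 * ∫ σ in a..s, ⟪z σ, g σ⟫)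
        = ∫ σ in s..t, (⟪z t + z s, g σ⟫ - 2 * ⟪z σ, g σ⟫) := by
      rw [intervalIntegral.integral_sub (hii (fun _ => z t + z s) continuous_const s hs t ht hst)
        ((hii z z.continuous s hs t ht hst).const_mul 2), intervalIntegral.integral_const_mul, ← e2, e1]
      ring
    rw [e3]
    have := intervalIntegral.norm_integral_le_of_norm_le_const (a := s) (b := t)
      (f := fun σ => ⟪z t + z s, g σ⟫ - 2 * ⟪z σ, g σ⟫) (C := 2 * C * C * (t - s)) ?_
    · rw [abs_of_nonneg (by linarith : 0 ≤ t - s), Real.norm_eq_abs] at this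
      refine this.trans (le_of_eq (by ring))
    · intro σ hσ
      rw [uIoc_of_le hst] at hσ
      have hσ' : σ ∈ Icc a b := ⟨hs.1.trans hσ.1.le, hσ.2.trans ht.2⟩
      have e4 : ⟪z t + z s, g σ⟫ - 2 * ⟪z σ, g σ⟫ = ⟪(z t - z σ) - (z σ - z s), g σ⟫ := by
        rw [inner_sub_left, inner_sub_left, inner_sub_left, inner_add_left]; ring
      rw [e4]
      refine (norm_inner_le_norm _ _).trans ?_
      have h1 := hlip σ hσ' t ht hσ.2
      have h2 := hlip s hs σ hσ' hσ.1.le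
      have h3 : ‖(z t - z σ) - (z σ - z s)‖ ≤ C * (t - s) := by
        refine (norm_sub_le _ _).trans ?_
        nlinarith
      calc _ ≤ (C * (t - s)) * C := mul_le_mul h3 (hC σ hσ') (norm_nonneg _) (by
              have : 0 ≤ t - s := by linarith
              positivity)
        _ ≤ _ := by
          have : 0 ≤ C * C * (t - s) := by
              have : 0 ≤ t - s := by linarith
              positivity
          nlinarith

lemma scalar_gron {m : ℝ → ℝ} (hm : Continuous m) (m0 : ∀ t, 0 ≤ m t) {a b A K : ℝ} (hK : 0 < K)
    (h : ∀ t ∈ Icc a b, m t ≤ A + K * ∫ s in a..t, m s) :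
    ∀ t ∈ Icc a b, m t ≤ A * Real.exp (K * (t - a)) := by
  intro t ht
  have hy : ∀ t, HasDerivAt (fun t => ∫ s in a..t, m s) (m t) t := fun t =>
    intervalIntegral.integral_hasDerivAt_right (hm.intervalIntegrable _ _)
      (hm.stronglyMeasurableAtFilter _ _) hm.continuousAt
  have y0 : ∀ t ∈ Icc a b, 0 ≤ ∫ s in a..t, m s := fun t ht =>
    intervalIntegral.integral_nonneg ht.1 (fun s _ => m0 s)
  have := norm_le_gronwallBound_of_norm_deriv_right_le (f := fun t => ∫ s in a..t, m s) (f' := m)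
    (δ := 0) (K := K) (ε := A) (a := a) (b := b)
    (fun t _ => (hy t).continuousAt.continuousWithinAt) (fun t _ => (hy t).hasDerivWithinAt)
    (by simp) (fun t ht => by
      have ht' : t ∈ Icc a b := ⟨ht.1, ht.2.le⟩
      rw [Real.norm_of_nonneg (m0 t), Real.norm_of_nonneg (y0 t ht')]
      linarith [h t ht']) t ht
  rw [Real.norm_of_nonneg (y0 t ht), gronwallBound_of_K_ne_0 hK.ne'] at this
  have h2 := h t ht
  have h3 : K * ∫ s in a..t, m s ≤ K * (0 * Real.exp (K * (t - a)) + A / K * (Real.exp (K * (t - a)) - 1)) := by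
    gcongr
  have h4 : K * (0 * Real.exp (K * (t - a)) + A / K * (Real.exp (K * (t - a)) - 1)) =
    A * Real.exp (K * (t - a)) - A := by field_simp; ring
  linarith

lemma gron {n : ℕ} {r : ℝ} (hr : 0 < r) {x y : C(ℝ, Euc n)} {g h : ℝ → Euc n} {a b C L e : ℝ}
    (hab : a ≤ b) (hC0 : 0 ≤ C) (hL0 : 0 ≤ L) (he : 0 ≤ e)
    (hg : IntervalIntegrable g volume a b) (hh : IntervalIntegrable h volume a b)
    (hgC : ∀ s ∈ Icc a b, ‖g s‖ ≤ C) (hhC : ∀ s ∈ Icc a b, ‖h s‖ ≤ C)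
    (hx : ∀ t ∈ Icc a b, x t = x a + ∫ s in a..t, g s)
    (hy : ∀ t ∈ Icc a b, y t = y a + ∫ s in a..t, h s)
    (hL : ∀ s ∈ Icc a b, ⟪x s - y s, g s - h s⟫ ≤ L * ‖hst r x s - hst r y s‖ ^ 2 + e) :
    ∀ t ∈ Icc a b, ‖hst r x t - hst r y t‖ ^ 2 ≤
      (‖hst r x a - hst r y a‖ ^ 2 + 2 * e * (b - a)) * Real.exp ((2 * L + 1) * (b - a)) := by
  have hgh := hg.sub hh
  have hsub : ∀ t ∈ Icc a b, ∀ w : ℝ → Euc n, IntervalIntegrable w volume a b →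
      IntervalIntegrable w volume a t := by
    intro t ht w hw
    refine hw.mono_set ?_
    rw [uIcc_of_le hab, uIcc_of_le ht.1]; exact Icc_subset_Icc le_rfl ht.2
  have en := energy (z := x - y) (g := fun s => g s - h s) (C := 2 * C) hab (by positivity) hgh
    (fun s hs => (norm_sub_le _ _).trans (by linarith [hgC s hs, hhC s hs]))
    (fun t ht => by
      rw [intervalIntegral.integral_sub (hsub t ht g hg) (hsub t ht h hh)]
      simp only [ContinuousMap.sub_apply]
      rw [hx t ht, hy t ht]; abel)
  set m : ℝ → ℝ := fun t => ‖hst r (x - y) t‖ ^ 2 with hm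
  have hmc : Continuous m := ((hst_cont (x - y)).norm).pow 2
  have m0 : ∀ t, 0 ≤ m t := fun t => by positivity
  have hme : ∀ t, m t = ‖hst r x t - hst r y t‖ ^ 2 := fun t => by rw [hm]; simp only [hst_sub]
  have hba : 0 ≤ b - a := by linarith
  have key1 : ∀ t ∈ Icc a b, ‖(x - y) t‖ ^ 2 ≤ m a + 2 * e * (b - a) + (2 * L + 1) * ∫ s in a..t, m s := by
    intro t ht
    rw [en t ht]
    have h1 : ‖(x - y) a‖ ^ 2 ≤ m a := by
      have := norm_le_hst (r := r) (x - y) (t := a) (s := a) ⟨by linarith, le_rfl⟩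
      simp only [hm]; gcongr
    have hint : (∫ s in a..t, ⟪(x - y) s, g s - h s⟫) ≤ ∫ s in a..t, (L * m s + e) := by
      by_cases hI : IntervalIntegrable (fun s => ⟪(x - y) s, g s - h s⟫) volume a t
      · refine intervalIntegral.integral_mono_on ht.1 hI
          (((hmc.const_mul L).add continuous_const).intervalIntegrable _ _) ?_
        intro s hs
        have := hL s ⟨hs.1, hs.2.trans ht.2⟩
        rw [hme]; exact this
      · rw [intervalIntegral.integral_undef hI]
        exact intervalIntegral.integral_nonneg ht.1 (fun s _ => by have := m0 s; positivity)
    have e1 : (∫ s in a..t, (L * m s + e)) = L * (∫ s in a..t, m s) + e * (t - a) := by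
      rw [intervalIntegral.integral_add ((hmc.const_mul L).intervalIntegrable _ _)
        (continuous_const.intervalIntegrable _ _), intervalIntegral.integral_const_mul,
        intervalIntegral.integral_const]
      simp; ring
    have h2 : 0 ≤ ∫ s in a..t, m s := intervalIntegral.integral_nonneg ht.1 (fun s _ => m0 s)
    have h3 : e * (t - a) ≤ e * (b - a) := by have := ht.2; gcongr
    rw [e1] at hint
    linarith
  have key2 : ∀ t ∈ Icc a b, m t ≤ (m a + 2 * e * (b - a)) + (2 * L + 1) * ∫ s in a..t, m s := by
    intro t ht
    have hB : 0 ≤ (m a + 2 * e * (b - a)) + (2 * L + 1) * ∫ s in a..t, m s := by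
      have h2 : 0 ≤ ∫ s in a..t, m s := intervalIntegral.integral_nonneg ht.1 (fun s _ => m0 s)
      have := m0 a
      positivity
    have : ‖hst r (x - y) t‖ ≤ √((m a + 2 * e * (b - a)) + (2 * L + 1) * ∫ s in a..t, m s) := by
      refine norm_hst_le (Real.sqrt_nonneg _) ?_
      intro s hs
      refine Real.le_sqrt_of_sq_le ?_
      rcases le_total s a with hsa | hsa
      · have h1 := norm_le_hst (r := r) (x - y) (t := a) (s := s) ⟨by linarith [hs.1, ht.1], hsa⟩
        have h2 : 0 ≤ ∫ s in a..t, m s := intervalIntegral.integral_nonneg ht.1 (fun s _ => m0 s)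
        have h3 : ‖(x - y) s‖ ^ 2 ≤ m a := by simp only [hm]; gcongr
        have h4 : 0 ≤ 2 * e * (b - a) := by positivity
        have h5 : 0 ≤ (2 * L + 1) * ∫ s in a..t, m s := by positivity
        linarith
      · refine (key1 s ⟨hsa, hs.2.trans ht.2⟩).trans ?_
        have : (∫ u in a..s, m u) ≤ ∫ u in a..t, m u := by
          refine intervalIntegral.integral_mono_interval le_rfl hsa hs.2 ?_ (hmc.intervalIntegrable _ _)
          exact Eventually.of_forall m0
        gcongr
    calc m t = ‖hst r (x - y) t‖ ^ 2 := rfl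
      _ ≤ √((m a + 2 * e * (b - a)) + (2 * L + 1) * ∫ s in a..t, m s) ^ 2 := by gcongr
      _ = _ := Real.sq_sqrt hB
  intro t ht
  rw [← hme, ← hme]
  refine (scalar_gron hmc m0 (by linarith) key2 t ht).trans ?_
  have := m0 a
  have := ht.2
  have : 0 ≤ m a + 2 * e * (b - a) := by positivity
  gcongr


def Sol {n l : ℕ} {r : ℝ} (F : ℝ → Euc l → Hist n r → Euc n) (d : ℝ → Euc l) (a b : ℝ)
    (x : C(ℝ, Euc n)) : Prop :=
  ∀ t ∈ Icc a b, x t = x a + ∫ s in a..t, F s (d s) (hst r x s)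

def HLip {n : ℕ} {r : ℝ} (x : Hist n r) (M : ℝ) : Prop :=
  ∀ θ θ' : Icc (-r) (0:ℝ), ‖x θ - x θ'‖ ≤ M * |(θ:ℝ) - θ'|

section sol
variable {n l : ℕ} {r : ℝ} {hr : 0 < r} {D : Set (Euc l)} {F : ℝ → Euc l → Hist n r → Euc n}

lemma path_bdd {ψ : ℝ → Hist n r} (hψ : Continuous ψ) (a b : ℝ) :
    ∃ R, 0 ≤ R ∧ b ≤ R ∧ ∀ s ∈ Icc a b, ‖ψ s‖ ≤ R := by
  obtain ⟨B, hB⟩ := (isCompact_Icc (a := a) (b := b)).exists_bound_of_continuousOn hψ.continuousOn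
  refine ⟨max (max B b) 0, le_max_right _ _, (le_max_right _ _).trans (le_max_left _ _), fun s hs =>
    (hB s hs).trans ((le_max_left _ _).trans (le_max_left _ _))⟩

lemma GoodF.intg (hF : GoodF r hr D F) {d : ℝ → Euc l} (hd : InMD D d) {ψ : ℝ → Hist n r}
    (hψ : Continuous ψ) {a b : ℝ} (ha : 0 ≤ a) (hab : a ≤ b) :
    IntervalIntegrable (fun s => F s (d s) (ψ s)) volume a b := by
  obtain ⟨R, R0, hbR, hR⟩ := path_bdd hψ a b
  obtain ⟨C, C0, hC⟩ := hF.bdd R R0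
  rw [intervalIntegrable_iff_integrableOn_Ioc_of_le hab]
  refine Integrable.mono' (g := fun _ => C) (by simp) (hF.meas d hd ψ hψ a b ha) ?_
  filter_upwards [ae_restrict_mem measurableSet_Ioc] with s hs
  exact hC s ⟨ha.trans hs.1.le, hs.2.trans hbR⟩ _ (hd.2 s) _ (hR s ⟨hs.1.le, hs.2⟩)

lemma GoodF.dep (hF : GoodF r hr D F) (R : ℝ) (hR : 0 ≤ R) : ∃ K, 0 ≤ K ∧ ∀ a b : ℝ, 0 ≤ a → a ≤ b →
    b ≤ R → ∀ d, InMD D d → ∀ x y, Sol F d a b x → Sol F d a b y →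
    (∀ s ∈ Icc a b, ‖hst r x s‖ ≤ R) → (∀ s ∈ Icc a b, ‖hst r y s‖ ≤ R) →
    ∀ t ∈ Icc a b, ‖hst r x t - hst r y t‖ ≤ K * ‖hst r x a - hst r y a‖ := by
  obtain ⟨C, C0, hC⟩ := hF.bdd R hR
  obtain ⟨L, L0, hL⟩ := hF.lip R hR
  refine ⟨Real.exp ((2 * L + 1) * R), by positivity, ?_⟩
  intro a b ha hab hbR d hd x y hx hy bx bY t ht
  have := gron (r := r) hr (e := 0) (L := L) (C := C) hab C0 L0 le_rfl (hF.intg hd (hst_cont x) ha hab)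
    (hF.intg hd (hst_cont y) ha hab)
    (fun s hs => hC s ⟨ha.trans hs.1, hs.2.trans hbR⟩ _ (hd.2 s) _ (bx s hs))
    (fun s hs => hC s ⟨ha.trans hs.1, hs.2.trans hbR⟩ _ (hd.2 s) _ (bY s hs)) hx hy
    (fun s hs => by
      have := hL s ⟨ha.trans hs.1, hs.2.trans hbR⟩ _ (hd.2 s) _ _ (bx s hs) (bY s hs)
      rw [hst_z0, hst_z0] at this
      linarith) t ht
  have e1 : Real.exp ((2 * L + 1) * (b - a)) ≤ Real.exp ((2 * L + 1) * R) := by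
    gcongr; linarith
  have e2 : 1 ≤ Real.exp ((2 * L + 1) * R) := Real.one_le_exp (by positivity)
  refine le_of_sq_le_sq ?_ (by positivity)
  calc _ ≤ _ := this
    _ = ‖hst r x a - hst r y a‖ ^ 2 * Real.exp ((2 * L + 1) * (b - a)) := by ring
    _ ≤ ‖hst r x a - hst r y a‖ ^ 2 * Real.exp ((2 * L + 1) * R) := by gcongr
    _ ≤ ‖hst r x a - hst r y a‖ ^ 2 * (Real.exp ((2 * L + 1) * R) * Real.exp ((2 * L + 1) * R)) := by
      gcongr; nlinarith
    _ = _ := by ring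

lemma GoodF.uniq (hF : GoodF r hr D F) {a b : ℝ} (ha : 0 ≤ a) {d} (hd : InMD D d) {x y}
    (hx : Sol F d a b x) (hy : Sol F d a b y) (h0 : hst r x a = hst r y a) :
    ∀ t ∈ Icc a b, hst r x t = hst r y t := by
  intro t ht
  obtain ⟨R1, R10, hbR1, hR1⟩ := path_bdd (hst_cont (r := r) x) a b
  obtain ⟨R2, R20, hbR2, hR2⟩ := path_bdd (hst_cont (r := r) y) a b
  obtain ⟨K, K0, hK⟩ := hF.dep (max R1 R2) (R10.trans (le_max_left _ _))
  have := hK a b ha (ht.1.trans ht.2) (hbR1.trans (le_max_left _ _)) d hd x y hx hy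
    (fun s hs => (hR1 s hs).trans (le_max_left _ _)) (fun s hs => (hR2 s hs).trans (le_max_right _ _)) t ht
  rw [h0, sub_self, norm_zero, mul_zero] at this
  exact sub_eq_zero.1 (norm_le_zero_iff.1 this)

lemma Sol.mono {d : ℝ → Euc l} {a b c : ℝ} {x} (h : Sol F d a c x) (hbc : b ≤ c) : Sol F d a b x :=
  fun t ht => h t ⟨ht.1, ht.2.trans hbc⟩

lemma GoodF.sol_inc (hF : GoodF r hr D F) {d} (hd : InMD D d) {a c : ℝ} {x} (ha : 0 ≤ a)
    (h : Sol F d a c x) {s t : ℝ} (hs : a ≤ s) (hst' : s ≤ t) (ht : t ≤ c) :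
    x t = x s + ∫ σ in s..t, F σ (d σ) (hst r x σ) := by
  rw [h t ⟨hs.trans hst', ht⟩, h s ⟨hs, hst'.trans ht⟩, add_assoc,
    intervalIntegral.integral_add_adjacent_intervals (hF.intg hd (hst_cont x) ha hs)
    (hF.intg hd (hst_cont x) (ha.trans hs) hst')]

lemma GoodF.sol_right (hF : GoodF r hr D F) {d} (hd : InMD D d) {a b c : ℝ} {x} (ha : 0 ≤ a)
    (hab : a ≤ b) (h : Sol F d a c x) : Sol F d b c x :=
  fun _ ht => hF.sol_inc hd ha h hab ht.1 ht.2

lemma Sol.congr_d {d d' : ℝ → Euc l} {a b : ℝ} {x} (h : Sol F d a b x)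
    (hdd : ∀ s ∈ Ico a b, d s = d' s) : Sol F d' a b x := by
  intro t ht
  rw [h t ht]
  congr 1
  refine intervalIntegral.integral_congr_ae ?_
  filter_upwards [measure_eq_zero_iff_ae_notMem.1 (measure_singleton (μ := (volume : Measure ℝ)) b)] with s hs hs'
  rw [uIoc_of_le ht.1] at hs'
  rw [hdd s ⟨hs'.1.le, lt_of_le_of_ne (hs'.2.trans ht.2) (by simpa using hs)⟩]

lemma GoodF.sol_C (hF : GoodF r hr D F) {d} (hd : InMD D d) {a b : ℝ} {x} (ha : 0 ≤ a)
    (h : Sol F d a b x) {C : ℝ} (hC : ∀ s ∈ Icc a b, ‖F s (d s) (hst r x s)‖ ≤ C)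
    {s t : ℝ} (hs : a ≤ s) (hst' : s ≤ t) (ht : t ≤ b) : ‖x t - x s‖ ≤ C * (t - s) := by
  rw [hF.sol_inc hd ha h hs hst' ht, add_sub_cancel_left]
  have := intervalIntegral.norm_integral_le_of_norm_le_const (a := s) (b := t)
    (f := fun σ => F σ (d σ) (hst r x σ)) (C := C) (fun σ hσ => by
      rw [uIoc_of_le hst'] at hσ
      exact hC σ ⟨hs.trans hσ.1.le, hσ.2.trans ht⟩)
  rwa [abs_of_nonneg (by linarith)] at this

/-- Lipschitz estimate along a solution with Lipschitz initial history -/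
lemma GoodF.sol_lip (hF : GoodF r hr D F) {d} (hd : InMD D d) {a b : ℝ} {x} (ha : 0 ≤ a)
    (h : Sol F d a b x) {C M : ℝ} (hC0 : 0 ≤ C) (hM0 : 0 ≤ M)
    (hC : ∀ s ∈ Icc a b, ‖F s (d s) (hst r x s)‖ ≤ C)
    (hM : HLip (hst r x a) M) :
    ∀ s t : ℝ, a - r ≤ s → s ≤ t → t ≤ b → ‖x t - x s‖ ≤ (M + C) * (t - s) := by
  have h1 : ∀ s t : ℝ, a - r ≤ s → s ≤ t → t ≤ a → ‖x t - x s‖ ≤ M * (t - s) := by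
    intro s t hs hst' ht
    have := hM ⟨t - a, by linarith, by linarith⟩ ⟨s - a, by linarith, by linarith⟩
    simp only [hst_apply, add_sub_cancel] at this
    rwa [show t - a - (s - a) = t - s by ring, abs_of_nonneg (by linarith)] at this
  intro s t hs hst' ht
  rcases le_total t a with hta | hta
  · refine (h1 s t hs hst' hta).trans ?_
    have : 0 ≤ t - s := by linarith
    gcongr; linarith
  · rcases le_total s a with hsa | hsa
    · have e1 := h1 s a hs hsa le_rfl
      have e2 := hF.sol_C hd ha h hC le_rfl hta ht
      have : x t - x s = (x t - x a) + (x a - x s) := by abel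
      rw [this]
      refine (norm_add_le _ _).trans ?_
      nlinarith
    · refine (hF.sol_C hd ha h hC hsa hst' ht).trans ?_
      have : 0 ≤ t - s := by linarith
      gcongr; linarith

lemma glue {x y : C(ℝ, Euc n)} {b : ℝ} (hr : 0 < r) (h : hst r x b = hst r y b) :
    ∃ w : C(ℝ, Euc n), (∀ t ≤ b, hst r w t = hst r x t) ∧ (∀ t, b ≤ t → hst r w t = hst r y t) := by
  have hxy : ∀ s, b - r ≤ s → s ≤ b → x s = y s := by
    intro s h1 h2
    have := DFunLike.congr_fun h ⟨s - b, by linarith, by linarith⟩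
    simpa using this
  refine ⟨⟨fun s => if s ≤ b then x s else y s, ?_⟩, ?_, ?_⟩
  · refine Continuous.if_le x.continuous y.continuous continuous_id continuous_const ?_
    intro s hs
    exact hxy s (by have : s = b := hs; linarith) (by have : s = b := hs; linarith)
  · intro t ht; ext1 θ
    simp only [hst_apply, ContinuousMap.coe_mk]
    rw [if_pos (by linarith [θ.2.2])]
  · intro t ht; ext1 θ
    simp only [hst_apply, ContinuousMap.coe_mk]
    split_ifs with h1
    · exact hxy _ (by linarith [θ.2.1]) h1
    · rfl

lemma GoodF.sol_glue (hF : GoodF r hr D F) {d} (hd : InMD D d) {a b c : ℝ} (ha : 0 ≤ a)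
    (hab : a ≤ b) (_hbc : b ≤ c) {x y w}
    (hx : Sol F d a b x) (hy : Sol F d b c y)
    (h1 : ∀ t ≤ b, hst r w t = hst r x t) (h2 : ∀ t, b ≤ t → hst r w t = hst r y t) :
    Sol F d a c w := by
  have e1 : ∀ t ≤ b, w t = x t := fun t ht => by
    rw [← hst_z0 hr w t, ← hst_z0 hr x t, h1 t ht]
  have e2 : ∀ t, b ≤ t → w t = y t := fun t ht => by
    rw [← hst_z0 hr w t, ← hst_z0 hr y t, h2 t ht]
  have hL : ∀ t ∈ Icc a b, w t = w a + ∫ s in a..t, F s (d s) (hst r w s) := by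
    intro t ht
    rw [e1 t ht.2, e1 a hab, hx t ht]
    congr 1
    refine intervalIntegral.integral_congr (fun s hs => ?_)
    rw [uIcc_of_le ht.1] at hs
    simp only [h1 s (hs.2.trans ht.2)]
  intro t ht
  rcases le_total t b with htb | htb
  · exact hL t ⟨ht.1, htb⟩
  · rw [← intervalIntegral.integral_add_adjacent_intervals (hF.intg hd (hst_cont w) ha hab)
      (hF.intg hd (hst_cont w) (ha.trans hab) htb), ← add_assoc, ← hL b ⟨hab, le_rfl⟩, e2 t htb,
      e2 b le_rfl, hy t ⟨htb, ht.2⟩]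
    congr 1
    refine intervalIntegral.integral_congr (fun s hs => ?_)
    rw [uIcc_of_le htb] at hs
    simp only [h2 s hs.1]

end sol


section ex
variable {n l : ℕ} {r : ℝ} {hr : 0 < r} {D : Set (Euc l)} {F : ℝ → Euc l → Hist n r → Euc n}

lemma GoodF.approx (hF : GoodF r hr D F) {a b R : ℝ} (ha : 0 ≤ a) (hab : a ≤ b) (hbR : b ≤ R)
    {d} (hd : InMD D d) {x : ℕ → C(ℝ, Euc n)} {ψ : ℕ → ℝ → Hist n r} {ε : ℕ → ℝ} {x0 : Hist n r}
    (hψ : ∀ k, Continuous (ψ k)) (hψR : ∀ k, ∀ s ∈ Icc a b, ‖ψ k s‖ ≤ R)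
    (hx : ∀ k, ∀ t ∈ Icc a b, x k t = x k a + ∫ s in a..t, F s (d s) (ψ k s))
    (hε : ∀ k, ∀ s ∈ Icc a b, ‖ψ k s - hst r (x k) s‖ ≤ ε k) (hε0 : Tendsto ε atTop (𝓝 0))
    (hx0 : Tendsto (fun k => hst r (x k) a) atTop (𝓝 x0)) :
    ∃ y : C(ℝ, Euc n), hst r y a = x0 ∧ Sol F d a b y ∧
      ∀ t ∈ Icc a b, Tendsto (fun k => hst r (x k) t) atTop (𝓝 (hst r y t)) := by
  have R0 : 0 ≤ R := by linarith
  obtain ⟨C, C0, hC⟩ := hF.bdd R R0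
  obtain ⟨L, L0, hL⟩ := hF.lip R R0
  have εp : ∀ k, 0 ≤ ε k := fun k => (norm_nonneg _).trans (hε k a ⟨le_rfl, hab⟩)
  set e : ℕ → ℕ → ℝ := fun k j => 2 * L * (ε k + ε j) ^ 2 + 2 * C * (ε k + ε j) with he
  set E : ℕ × ℕ → ℝ := fun p => Real.sqrt ((‖hst r (x p.1) a - hst r (x p.2) a‖ ^ 2 +
    2 * e p.1 p.2 * (b - a)) * Real.exp ((2 * (2 * L) + 1) * (b - a))) with hE
  have key : ∀ k j, ∀ t ∈ Icc a b, ‖hst r (x k) t - hst r (x j) t‖ ≤ E (k, j) := by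
    intro k j t ht
    refine Real.le_sqrt_of_sq_le ?_
    have ep : 0 ≤ ε k + ε j := add_nonneg (εp k) (εp j)
    refine gron hr (L := 2 * L) (C := C) (e := e k j) hab C0 (by positivity) (by positivity)
      (hF.intg hd (hψ k) ha hab) (hF.intg hd (hψ j) ha hab)
      (fun s hs => hC s ⟨ha.trans hs.1, hs.2.trans hbR⟩ _ (hd.2 s) _ (hψR k s hs))
      (fun s hs => hC s ⟨ha.trans hs.1, hs.2.trans hbR⟩ _ (hd.2 s) _ (hψR j s hs))
      (hx k) (hx j) (fun s hs => ?_) t ht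
    have c1 := hC s ⟨ha.trans hs.1, hs.2.trans hbR⟩ _ (hd.2 s) _ (hψR k s hs)
    have c2 := hC s ⟨ha.trans hs.1, hs.2.trans hbR⟩ _ (hd.2 s) _ (hψR j s hs)
    have l1 := hL s ⟨ha.trans hs.1, hs.2.trans hbR⟩ _ (hd.2 s) _ _ (hψR k s hs) (hψR j s hs)
    set G := F s (d s) (ψ k s) - F s (d s) (ψ j s) with hG
    have c3 : ‖G‖ ≤ 2 * C := (norm_sub_le _ _).trans (by linarith)
    set A := (ψ k s - hst r (x k) s) - (ψ j s - hst r (x j) s) with hA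
    have hA1 : ‖A‖ ≤ ε k + ε j := (norm_sub_le _ _).trans (add_le_add (hε k s hs) (hε j s hs))
    have e1 : x k s - x j s = (ψ k s (z0 hr) - ψ j s (z0 hr)) - A (z0 hr) := by
      rw [← hst_z0 hr (x k) s, ← hst_z0 hr (x j) s]
      simp [hA]
      abel
    have e2 : ψ k s - ψ j s = (hst r (x k) s - hst r (x j) s) + A := by rw [hA]; abel
    have e3 : ‖ψ k s - ψ j s‖ ≤ ‖hst r (x k) s - hst r (x j) s‖ + (ε k + ε j) := by
      rw [e2]; exact (norm_add_le _ _).trans (by linarith)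
    have e4 : ‖ψ k s - ψ j s‖ ^ 2 ≤ 2 * ‖hst r (x k) s - hst r (x j) s‖ ^ 2 + 2 * (ε k + ε j) ^ 2 := by
      have : ‖ψ k s - ψ j s‖ ^ 2 ≤ (‖hst r (x k) s - hst r (x j) s‖ + (ε k + ε j)) ^ 2 := by gcongr
      nlinarith [sq_nonneg (‖hst r (x k) s - hst r (x j) s‖ - (ε k + ε j))]
    have e5 : -⟪A (z0 hr), G⟫ ≤ (ε k + ε j) * (2 * C) := by
      refine (neg_le_abs _).trans ((abs_real_inner_le_norm _ _).trans ?_)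
      exact mul_le_mul ((norm_z0_le hr A).trans hA1) c3 (norm_nonneg _) ep
    rw [e1, inner_sub_left]
    have e6 : L * ‖ψ k s - ψ j s‖ ^ 2 ≤ L * (2 * ‖hst r (x k) s - hst r (x j) s‖ ^ 2 + 2 * (ε k + ε j) ^ 2) := by
      gcongr
    simp only [he]
    linarith
  have hE0 : Tendsto E atTop (𝓝 0) := by
    rw [← prod_atTop_atTop_eq]
    have f1 : Tendsto (fun p : ℕ × ℕ => ε p.1) (atTop ×ˢ atTop) (𝓝 0) := hε0.comp tendsto_fst
    have f2 : Tendsto (fun p : ℕ × ℕ => ε p.2) (atTop ×ˢ atTop) (𝓝 0) := hε0.comp tendsto_snd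
    have f3 : Tendsto (fun p : ℕ × ℕ => hst r (x p.1) a) (atTop ×ˢ atTop) (𝓝 x0) := hx0.comp tendsto_fst
    have f4 : Tendsto (fun p : ℕ × ℕ => hst r (x p.2) a) (atTop ×ˢ atTop) (𝓝 x0) := hx0.comp tendsto_snd
    have g := ((((((f3.sub f4).norm).pow 2).add (((((f1.add f2).pow 2).const_mul (2 * L)).add
      ((f1.add f2).const_mul (2 * C))).const_mul 2 |>.mul_const (b - a))).mul_const
      (Real.exp ((2 * (2 * L) + 1) * (b - a))))).sqrt
    simpa using g
  have hab' : a - r ≤ b := by linarith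
  let Yk : ℕ → C(Icc (a - r) b, Euc n) := fun k => (x k).comp ⟨Subtype.val, continuous_subtype_val⟩
  have hcs : CauchySeq Yk := by
    rw [cauchySeq_iff_tendsto_dist_atTop_0]
    refine squeeze_zero (fun _ => dist_nonneg) (fun p => ?_) hE0
    rw [ContinuousMap.dist_le (Real.sqrt_nonneg _)]
    intro s
    rw [dist_eq_norm]
    have : ‖(x p.1 - x p.2) s‖ ≤ ‖hst r (x p.1 - x p.2) (max (s:ℝ) a)‖ := by
      apply norm_le_hst
      refine ⟨?_, le_max_left _ _⟩
      rcases le_total (s:ℝ) a with h | h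
      · rw [max_eq_right h]; linarith [s.2.1]
      · rw [max_eq_left h]; linarith
    refine le_trans this ?_
    rw [hst_sub]
    exact key p.1 p.2 _ ⟨le_max_right _ _, max_le s.2.2 hab⟩
  obtain ⟨W, hW⟩ := cauchySeq_tendsto_of_complete hcs
  let y : C(ℝ, Euc n) := W.comp ⟨projIcc (a - r) b hab', continuous_projIcc⟩
  have hy : ∀ t ∈ Icc a b, Tendsto (fun k => hst r (x k) t) atTop (𝓝 (hst r y t)) := by
    intro t ht
    rw [tendsto_iff_norm_sub_tendsto_zero]
    refine squeeze_zero (fun _ => norm_nonneg _) (fun k => ?_) (tendsto_iff_norm_sub_tendsto_zero.1 hW)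
    rw [← hst_sub]
    refine norm_hst_le (norm_nonneg _) (fun s hs => ?_)
    have hs' : s ∈ Icc (a - r) b := ⟨by linarith [hs.1, ht.1], hs.2.trans ht.2⟩
    have := (Yk k - W).norm_coe_le_norm ⟨s, hs'⟩
    simpa [y, Yk, projIcc_of_mem hab' hs'] using this
  refine ⟨y, tendsto_nhds_unique (hy a ⟨le_rfl, hab⟩) hx0, ?_, hy⟩
  have hyp : ∀ t ∈ Icc a b, Tendsto (fun k => x k t) atTop (𝓝 (y t)) := by
    intro t ht
    have := ((continuous_eval_const (z0 hr)).tendsto _).comp (hy t ht)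
    simp only [Function.comp_def] at this
    rw [hst_z0] at this
    refine this.congr (fun k => hst_z0 hr (x k) t)
  intro t ht
  refine tendsto_nhds_unique (hyp t ht) ?_
  have hint : Tendsto (fun k => ∫ s in a..t, F s (d s) (ψ k s)) atTop (𝓝 (∫ s in a..t, F s (d s) (hst r y s))) := by
    refine intervalIntegral.tendsto_integral_filter_of_dominated_convergence (fun _ => C) ?_ ?_ ?_ ?_
    · refine Eventually.of_forall (fun k => ?_)
      rw [uIoc_of_le ht.1]
      exact hF.meas d hd _ (hψ k) a t ha
    · refine Eventually.of_forall (fun k => Eventually.of_forall (fun s hs => ?_))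
      rw [uIoc_of_le ht.1] at hs
      exact hC s ⟨ha.trans hs.1.le, (hs.2.trans ht.2).trans hbR⟩ _ (hd.2 s) _ (hψR k s ⟨hs.1.le, hs.2.trans ht.2⟩)
    · exact intervalIntegrable_const
    · refine Eventually.of_forall (fun s hs => ?_)
      rw [uIoc_of_le ht.1] at hs
      have hs' : s ∈ Icc a b := ⟨hs.1.le, hs.2.trans ht.2⟩
      refine ((hF.cont s (ha.trans hs.1.le) _ (hd.2 s)).tendsto _).comp ?_
      have h1 : Tendsto (fun k => ψ k s - hst r (x k) s) atTop (𝓝 0) :=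
        squeeze_zero_norm (fun k => hε k s hs') hε0
      have := h1.add (hy s hs')
      simpa using this
  refine ((hyp a ⟨le_rfl, hab⟩).add hint).congr (fun k => (hx k t ht).symm)

end ex


section ex
variable {n l : ℕ} {r : ℝ} {hr : 0 < r} {D : Set (Euc l)} {F : ℝ → Euc l → Hist n r → Euc n}

lemma int_clamp_lip {E : Type*} [NormedAddCommGroup E] [NormedSpace ℝ E]
    {g : ℝ → E} {a b C : ℝ} (hab : a ≤ b) (hg : IntervalIntegrable g volume a b)
    (hC : ∀ s ∈ Icc a b, ‖g s‖ ≤ C) (s t : ℝ) :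
    ‖(∫ σ in a..(projIcc a b hab t : ℝ), g σ) - ∫ σ in a..(projIcc a b hab s : ℝ), g σ‖ ≤ C * |t - s| := by
  have C0 : 0 ≤ C := (norm_nonneg _).trans (hC a ⟨le_rfl, hab⟩)
  have hi : ∀ t : ℝ, IntervalIntegrable g volume a (projIcc a b hab t : ℝ) := fun t => by
    refine hg.mono_set ?_
    rw [uIcc_of_le hab, uIcc_of_le (projIcc a b hab t).2.1]; exact Icc_subset_Icc le_rfl (projIcc a b hab t).2.2
  rw [intervalIntegral.integral_interval_sub_left (hi t) (hi s)]
  refine (intervalIntegral.norm_integral_le_of_norm_le_const (C := C) (fun σ hσ => hC σ ?_)).trans ?_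
  · have := uIoc_subset_uIcc hσ
    exact (ordConnected_Icc.uIcc_subset (projIcc a b hab s).2 (projIcc a b hab t).2) this
  · exact mul_le_mul_of_nonneg_left (abs_projIcc_sub_projIcc hab) C0

lemma GoodF.loc (hF : GoodF r hr D F) (R : ℝ) (hR : 0 ≤ R) : ∃ h > 0, h ≤ 1 ∧ ∀ a ∈ Icc 0 R,
    ∀ x0 : Hist n r, ‖x0‖ ≤ R → ∀ M, HLip x0 M → ∀ d, InMD D d →
    ∃ x, hst r x a = x0 ∧ Sol F d a (a + h) x := by
  obtain ⟨C, C0, hC⟩ := hF.bdd (R + 1) (by linarith)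
  have hh : 0 < 1 / (C + 1) := by positivity
  have hh1 : 1 / (C + 1) ≤ 1 := by rw [div_le_one (by positivity)]; linarith
  have hCh : C * (1 / (C + 1)) ≤ 1 := by rw [mul_one_div, div_le_one (by positivity)]; linarith
  set h := 1 / (C + 1)
  refine ⟨h, hh, hh1, ?_⟩
  intro a ha x0 hx0 M' hM' d hd
  obtain ⟨M, M0, hM⟩ : ∃ M, 0 ≤ M ∧ HLip x0 M :=
    ⟨|M'|, abs_nonneg _, fun θ θ' => (hM' θ θ').trans (by gcongr; exact le_abs_self _)⟩
  have hr' : -r ≤ 0 := by linarith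
  have hab : a ≤ a + h := by linarith
  let base : C(ℝ, Euc n) := x0.comp ⟨fun s => projIcc (-r) 0 hr' (s - a), continuous_projIcc.comp (by fun_prop)⟩
  have hbase : ∀ t, base t = x0 (projIcc (-r) 0 hr' (t - a)) := fun t => rfl
  have hbl : ∀ s t, ‖base t - base s‖ ≤ M * |t - s| := fun s t => by
    rw [hbase, hbase]
    refine (hM _ _).trans ?_
    refine mul_le_mul_of_nonneg_left ?_ M0
    refine (abs_projIcc_sub_projIcc hr').trans (le_of_eq ?_)
    congr 1; ring
  have hbb : ∀ t, ‖base t‖ ≤ R := fun t => (x0.norm_coe_le_norm _).trans hx0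
  let Inv : C(ℝ, Euc n) → Prop := fun x => (∀ t, ‖x t‖ ≤ R + 1) ∧
    (∀ s t, ‖x t - x s‖ ≤ (M + C) * |t - s|) ∧ ∀ t ≤ a, x t = base t
  have hhst : ∀ x : C(ℝ, Euc n), (∀ t, ‖x t‖ ≤ R + 1) → ∀ t, ‖hst r x t‖ ≤ R + 1 :=
    fun x hx t => norm_hst_le (by linarith) (fun s _ => hx s)
  have step : ∀ lam : ℝ, ∀ x : C(ℝ, Euc n), Inv x → ∃ y : C(ℝ, Euc n), Inv y ∧
      ∀ t, y t = base t + ∫ s in a..(projIcc a (a + h) hab t : ℝ), F s (d s) (hst r x (s - lam)) := by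
    intro lam x hx
    have hi : IntervalIntegrable (fun s => F s (d s) (hst r x (s - lam))) volume a (a + h) :=
      hF.intg hd ((hst_cont x).comp (by fun_prop)) ha.1 hab
    have hCs : ∀ s ∈ Icc a (a + h), ‖F s (d s) (hst r x (s - lam))‖ ≤ C := fun s hs =>
      hC s ⟨ha.1.trans hs.1, by linarith [hs.2, ha.2]⟩ _ (hd.2 s) _ (hhst x hx.1 _)
    have hlip : ∀ s t, ‖(base t + ∫ s in a..(projIcc a (a + h) hab t : ℝ), F s (d s) (hst r x (s - lam))) -
      (base s + ∫ s in a..(projIcc a (a + h) hab s : ℝ), F s (d s) (hst r x (s - lam)))‖ ≤ (M + C) * |t - s| := by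
      intro s t
      have := int_clamp_lip hab hi hCs s t
      rw [add_sub_add_comm, add_mul]
      exact (norm_add_le _ _).trans (add_le_add (hbl s t) this)
    refine ⟨⟨fun t => base t + ∫ s in a..(projIcc a (a + h) hab t : ℝ), F s (d s) (hst r x (s - lam)), ?_⟩, ⟨?_, hlip, ?_⟩, fun t => rfl⟩
    · refine (LipschitzWith.of_dist_le_mul (K := (M + C).toNNReal) (fun s t => ?_)).continuous
      rw [dist_eq_norm, Real.coe_toNNReal _ (by positivity), Real.dist_eq]
      exact hlip t s
    · intro t
      refine (norm_add_le _ _).trans (add_le_add (hbb t) ?_)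
      have p := (projIcc a (a + h) hab t).2
      refine (intervalIntegral.norm_integral_le_of_norm_le_const (C := C) (fun σ hσ => hCs σ ?_)).trans ?_
      · rw [uIoc_of_le p.1] at hσ; exact ⟨hσ.1.le, hσ.2.trans p.2⟩
      · rw [abs_of_nonneg (by linarith [p.1])]
        refine le_trans ?_ hCh
        gcongr; linarith [p.2]
    · intro t ht
      simp only [ContinuousMap.coe_mk]
      rw [projIcc_of_le_left hab ht]
      simp
  have iter : ∀ lam : ℝ, 0 < lam → ∀ j : ℕ, ∃ x y : C(ℝ, Euc n), Inv x ∧ Inv y ∧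
      (∀ t, y t = base t + ∫ s in a..(projIcc a (a + h) hab t : ℝ), F s (d s) (hst r x (s - lam))) ∧
      ∀ t ≤ a + j * lam, x t = y t := by
    intro lam hlam j
    induction j with
    | zero =>
      have hb : Inv base := by
        refine ⟨fun t => (hbb t).trans (by linarith), fun s t => (hbl s t).trans ?_, fun t _ => rfl⟩
        gcongr; linarith
      obtain ⟨y, hy, hy'⟩ := step lam base hb
      refine ⟨base, y, hb, hy, hy', fun t ht => ?_⟩
      rw [hy.2.2 t (by simpa using ht)]
    | succ j ih =>
      obtain ⟨x, y, hx, hy, hxy, he⟩ := ih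
      obtain ⟨w, hw, hw'⟩ := step lam y hy
      refine ⟨y, w, hy, hw, hw', fun t ht => ?_⟩
      rw [hxy, hw']
      congr 1
      have p := (projIcc a (a + h) hab t).2
      by_cases hta : t ≤ a
      · rw [projIcc_of_le_left hab hta]; simp
      push Not at hta
      have pt : (projIcc a (a + h) hab t : ℝ) ≤ t := by
        rw [coe_projIcc]
        exact max_le hta.le (min_le_right _ _)
      refine intervalIntegral.integral_congr (fun s hs => ?_)
      rw [uIcc_of_le p.1] at hs
      have : hst r x (s - lam) = hst r y (s - lam) := by
        ext1 θ
        simp only [hst_apply]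
        apply he
        push_cast at ht
        linarith [hs.2, θ.2.2]
      simp only [this]
  have ton : ∀ k : ℕ, ∃ x : C(ℝ, Euc n), Inv x ∧ ∀ t ∈ Icc a (a + h),
      x t = base t + ∫ s in a..t, F s (d s) (hst r x (s - 1 / ((k:ℝ) + 1))) := by
    intro k
    obtain ⟨x, y, hx, hy, hxy, he⟩ := iter (1 / ((k:ℝ) + 1)) (by positivity) (k + 1)
    refine ⟨x, hx, fun t ht => ?_⟩
    have e1 : ((k + 1 : ℕ) : ℝ) * (1 / ((k:ℝ) + 1)) = 1 := by push_cast; field_simp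
    rw [he t (by rw [e1]; linarith [ht.2]), hxy, projIcc_of_mem hab ht]
  choose x hx hxe using ton
  have hba : ∀ t ∈ Icc a (a + h), base t = base a := fun t ht => by
    rw [hbase, hbase, projIcc_of_right_le hr' (by linarith [ht.1]), projIcc_of_right_le hr' (by linarith)]
  have hxa : ∀ k, x k a = base a := fun k => (hx k).2.2 a le_rfl
  have hh0 : ∀ k, hst r (x k) a = x0 := fun k => by
    ext1 θ
    rw [hst_apply, (hx k).2.2 _ (by linarith [θ.2.2]), hbase]
    congr 1
    rw [add_sub_cancel_left]
    exact projIcc_val hr' θ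
  obtain ⟨y, hy0, hy, -⟩ := hF.approx (R := R + 1) ha.1 hab (by linarith [ha.2]) hd (x := x)
    (ψ := fun k s => hst r (x k) (s - 1 / ((k:ℝ) + 1))) (ε := fun k => (M + C) * (1 / ((k:ℝ) + 1))) (x0 := x0)
    (fun k => (hst_cont _).comp (by fun_prop)) (fun k s _ => hhst _ (hx k).1 _)
    (fun k t ht => by rw [hxe k t ht, hba t ht, hxa k])
    (fun k s hs => by
      rw [ContinuousMap.norm_le _ (by positivity)]
      intro θ
      refine ((hx k).2.1 _ _).trans ?_
      gcongr
      rw [show s - 1 / ((k:ℝ) + 1) + θ - (s + θ) = -(1 / ((k:ℝ) + 1)) by ring, abs_neg,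
        abs_of_pos (by positivity)])
    (by simpa using (tendsto_one_div_add_atTop_nhds_zero_nat (𝕜 := ℝ)).const_mul (M + C))
    (by simp only [hh0]; exact tendsto_const_nhds)
  exact ⟨y, hy0, hy⟩

lemma hlip_of {x : C(ℝ, Euc n)} {a b M : ℝ} (_hab : a ≤ b) (h : ∀ s t : ℝ, a - r ≤ s → s ≤ t → t ≤ b → ‖x t - x s‖ ≤ M * (t - s))
    {t : ℝ} (ht : t ∈ Icc a b) : HLip (hst r x t) M := by
  have : ∀ θ θ' : Icc (-r) (0:ℝ), (θ:ℝ) ≤ θ' → ‖hst r x t θ - hst r x t θ'‖ ≤ M * |(θ:ℝ) - θ'| := by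
    intro θ θ' hle
    rw [norm_sub_rev, hst_apply, hst_apply, abs_sub_comm, abs_of_nonneg (by linarith)]
    have := h (t + θ) (t + θ') (by linarith [θ.2.1, ht.1]) (by linarith) (by linarith [θ'.2.2, ht.2])
    rwa [add_sub_add_left_eq_sub] at this
  intro θ θ'
  rcases le_total (θ:ℝ) θ' with h1 | h1
  · exact this θ θ' h1
  · rw [norm_sub_rev, abs_sub_comm]; exact this θ' θ h1

lemma GoodF.glob (hF : GoodF r hr D F) {a b R : ℝ} (ha : 0 ≤ a) (hab : a ≤ b) {x0 : Hist n r} {M : ℝ}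
    (hM : HLip x0 M) {d} (hd : InMD D d)
    (hap : ∀ c ∈ Icc a b, ∀ x, hst r x a = x0 → Sol F d a c x → ∀ t ∈ Icc a c, ‖hst r x t‖ ≤ R) :
    ∃ x, hst r x a = x0 ∧ Sol F d a b x := by
  set R' := max R b with hR'
  have R0 : 0 ≤ R' := (ha.trans hab).trans (le_max_right _ _)
  obtain ⟨h, h0, h1, hloc⟩ := hF.loc R' R0
  obtain ⟨C, C0, hC⟩ := hF.bdd R' R0
  obtain ⟨K, K0, hK⟩ : ∃ K, 0 ≤ K ∧ HLip x0 K :=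
    ⟨|M|, abs_nonneg _, fun θ θ' => (hM θ θ').trans (by gcongr; exact le_abs_self _)⟩
  have hr' : -r ≤ 0 := by linarith
  have main : ∀ j : ℕ, ∃ x, hst r x a = x0 ∧ Sol F d a (min b (a + j * h)) x := by
    intro j
    induction j with
    | zero =>
      refine ⟨x0.comp ⟨fun s => projIcc (-r) 0 hr' (s - a), continuous_projIcc.comp (by fun_prop)⟩, ?_, ?_⟩
      · ext1 θ
        simp [hst_apply]
      · intro t ht
        have : t = a := le_antisymm (by have := ht.2.trans (min_le_right _ _); simpa using this) ht.1
        subst this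
        simp
    | succ j ih =>
      obtain ⟨x, hx0, hx⟩ := ih
      set c := min b (a + j * h) with hc
      have hjh : 0 ≤ j * h := by positivity
      have hac : a ≤ c := le_min hab (by linarith)
      have hcb : c ≤ b := min_le_left _ _
      have hb := hap c ⟨hac, hcb⟩ x hx0 hx
      have hcR : ∀ s ∈ Icc a c, ‖F s (d s) (hst r x s)‖ ≤ C := fun s hs =>
        hC s ⟨ha.trans hs.1, (hs.2.trans hcb).trans (le_max_right _ _)⟩ _ (hd.2 s) _ ((hb s hs).trans (le_max_left _ _))
      have hl := hF.sol_lip hd ha hx C0 K0 hcR (by rw [hx0]; exact hK)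
      obtain ⟨y, hy0, hy⟩ := hloc c ⟨ha.trans hac, hcb.trans (le_max_right _ _)⟩ (hst r x c)
        ((hb c ⟨hac, le_rfl⟩).trans (le_max_left _ _)) _ (hlip_of hac hl ⟨hac, le_rfl⟩) d hd
      obtain ⟨w, hw1, hw2⟩ := glue hr hy0.symm
      refine ⟨w, by rw [hw1 a hac, hx0], ?_⟩
      refine (hF.sol_glue hd ha hac (by linarith) hx hy hw1 hw2).mono ?_
      push_cast
      rcases le_total b (a + j * h) with h2 | h2
      · rw [hc, min_eq_left h2]; exact (min_le_left _ _).trans (by linarith)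
      · rw [hc, min_eq_right h2]; exact (min_le_right _ _).trans (by linarith)
  obtain ⟨j, hj⟩ := exists_nat_ge ((b - a) / h)
  obtain ⟨x, hx0, hx⟩ := main j
  refine ⟨x, hx0, hx.mono (le_min le_rfl ?_)⟩
  rw [div_le_iff₀ h0] at hj
  linarith

end ex


lemma lip_dense {n : ℕ} {r : ℝ} (hr : 0 < r) (x : Hist n r) {ε : ℝ} (hε : 0 < ε) :
    ∃ y : Hist n r, ∃ M, 0 ≤ M ∧ HLip y M ∧ ‖y - x‖ ≤ ε := by
  have hr' : -r ≤ 0 := by linarith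
  obtain ⟨δ, δ0, hδ⟩ := Metric.uniformContinuous_iff.1
    (CompactSpace.uniformContinuous_of_continuous x.continuous) ε hε
  set w : ℝ → Euc n := fun s => x (projIcc (-r) 0 hr' s) with hw
  have wc : Continuous w := x.continuous.comp continuous_projIcc
  have wi : ∀ a b, IntervalIntegrable w volume a b := fun a b => wc.intervalIntegrable a b
  have wb : ∀ s, ‖w s‖ ≤ ‖x‖ := fun s => x.norm_coe_le_norm _
  set η := δ / 2 with hη
  have η0 : 0 < η := by positivity
  have wη : ∀ s t, |s - t| ≤ η → ‖w s - w t‖ ≤ ε := by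
    intro s t h
    rw [← dist_eq_norm]
    refine (hδ ?_).le
    rw [Subtype.dist_eq, Real.dist_eq]
    refine ((abs_projIcc_sub_projIcc hr').trans h).trans_lt (by rw [hη]; linarith)
  have lipI : ∀ s t, ‖(∫ u in s..(s + η), w u) - ∫ u in t..(t + η), w u‖ ≤ 2 * ‖x‖ * |s - t| := by
    intro s t
    rw [intervalIntegral.integral_interval_sub_interval_comm (wi _ _) (wi _ _) (wi _ _)]
    have e1 := intervalIntegral.norm_integral_le_of_norm_le_const (a := s) (b := t) (f := w) (C := ‖x‖) (fun σ _ => wb σ)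
    have e2 := intervalIntegral.norm_integral_le_of_norm_le_const (a := s + η) (b := t + η) (f := w) (C := ‖x‖) (fun σ _ => wb σ)
    refine (norm_sub_le _ _).trans ?_
    rw [add_sub_add_right_eq_sub] at e2
    rw [abs_sub_comm s t]
    linarith
  have lipJ : ∀ s t, ‖(η⁻¹ • ∫ u in s..(s + η), w u) - η⁻¹ • ∫ u in t..(t + η), w u‖ ≤ η⁻¹ * (2 * ‖x‖) * |s - t| := by
    intro s t
    rw [← smul_sub, norm_smul, Real.norm_of_nonneg (by positivity), mul_assoc]
    gcongr
    exact lipI s t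
  refine ⟨⟨fun θ => η⁻¹ • ∫ u in (θ:ℝ)..(θ + η), w u, ?_⟩, η⁻¹ * (2 * ‖x‖), by positivity, fun θ θ' => lipJ θ θ', ?_⟩
  · refine (LipschitzWith.of_dist_le_mul (K := (η⁻¹ * (2 * ‖x‖)).toNNReal) (fun s t => ?_)).continuous
    rw [dist_eq_norm, Real.coe_toNNReal _ (by positivity), Subtype.dist_eq, Real.dist_eq]
    exact lipJ s t
  · rw [ContinuousMap.norm_le _ hε.le]
    intro θ
    simp only [ContinuousMap.sub_apply, ContinuousMap.coe_mk]
    have e0 : x θ = η⁻¹ • ∫ u in (θ:ℝ)..(θ + η), w θ := by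
      rw [intervalIntegral.integral_const, add_sub_cancel_left, smul_smul, inv_mul_cancel₀ η0.ne', one_smul, hw]
      simp
    rw [e0, ← smul_sub, ← intervalIntegral.integral_sub (wi _ _) (by simp), norm_smul, Real.norm_of_nonneg (by positivity)]
    have := intervalIntegral.norm_integral_le_of_norm_le_const (a := (θ:ℝ)) (b := θ + η) (f := fun u => w u - w θ) (C := ε)
      (fun σ hσ => wη _ _ (by
        rw [uIoc_of_le (by linarith)] at hσ
        rw [abs_of_nonneg (by linarith [hσ.1])]; linarith [hσ.2]))
    rw [add_sub_cancel_left, abs_of_pos η0] at this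
    calc _ ≤ η⁻¹ * (ε * η) := by gcongr
      _ = ε := by field_simp

lemma minorant (b : ℕ → ℝ) (hb : ∀ k, 0 < b k) : ∃ μ : ℝ → ℝ, (∀ s t, |μ s - μ t| ≤ |s - t|) ∧
    Continuous μ ∧ (∀ t, 0 < μ t) ∧ ∀ t, 0 ≤ t → μ t ≤ b ⌊t⌋₊ := by
  set μ : ℝ → ℝ := fun t => ⨅ k : ℕ, (b k + max 0 ((k:ℝ) - t)) with hμ
  have bd : ∀ t, BddBelow (range fun k : ℕ => b k + max 0 ((k:ℝ) - t)) := fun t =>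
    ⟨0, by rintro _ ⟨k, rfl⟩; have := hb k; have := le_max_left 0 ((k:ℝ) - t); simp only; linarith⟩
  have h1 : ∀ s t, μ s - μ t ≤ |s - t| := by
    intro s t
    have : μ s - |s - t| ≤ μ t := by
      refine le_ciInf (fun k => ?_)
      have := ciInf_le (bd s) k
      have e : max 0 ((k:ℝ) - s) ≤ max 0 ((k:ℝ) - t) + |s - t| := by
        refine max_le (by positivity) ?_
        linarith [neg_abs_le (s - t), le_max_right 0 ((k:ℝ) - t)]
      simp only [hμ]; linarith
    linarith
  have h2 : ∀ s t, |μ s - μ t| ≤ |s - t| := fun s t => abs_le.2 ⟨by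
    have := h1 t s; rw [abs_sub_comm] at this; linarith, h1 s t⟩
  refine ⟨μ, h2, ?_, ?_, ?_⟩
  · refine (LipschitzWith.of_dist_le_mul (K := 1) (fun s t => ?_)).continuous
    rw [Real.dist_eq, Real.dist_eq]; simpa using h2 s t
  · intro t
    obtain ⟨N, hN⟩ := exists_nat_ge (t + 1)
    obtain ⟨k0, hk0, hmin⟩ := (Finset.range (N + 1)).exists_min_image b ⟨0, by simp⟩
    have : min (b k0) 1 ≤ μ t := by
      refine le_ciInf (fun k => ?_)
      by_cases hk : k ∈ Finset.range (N + 1)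
      · have := hmin k hk
        have := le_max_left 0 ((k:ℝ) - t)
        have := min_le_left (b k0) 1
        linarith
      · have hk' : N + 1 ≤ k := by simpa using hk
        have : (N:ℝ) + 1 ≤ k := by exact_mod_cast hk'
        have := le_max_right 0 ((k:ℝ) - t)
        have := min_le_right (b k0) 1
        linarith [hb k]
    exact (lt_min (hb k0) one_pos).trans_le this
  · intro t ht
    refine (ciInf_le (bd t) ⌊t⌋₊).trans ?_
    rw [max_eq_left (by linarith [Nat.floor_le ht]), add_zero]

lemma kinf_major (B : ℝ → ℝ) (hm : MonotoneOn B (Ici 0)) (h0 : ∀ s, 0 ≤ s → 0 ≤ B s)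
    (hz : ∀ ε, 0 < ε → ∃ δ, 0 < δ ∧ B δ ≤ ε) : ∃ a, IsKinf a ∧ ∀ s, 0 ≤ s → B s ≤ a s := by
  set A : ℝ → ℝ := fun s => B (max s 0) with hA
  have Am : Monotone A := fun s t h => hm (mem_Ici.2 (le_max_right s 0)) (mem_Ici.2 (le_max_right t 0)) (max_le_max h le_rfl)
  have A0 : ∀ s, 0 ≤ A s := fun s => h0 _ (le_max_right _ _)
  have AB : ∀ s, 0 ≤ s → A s = B s := fun s hs => by simp [hA, hs]
  have Ai : ∀ a b, IntervalIntegrable A volume a b := fun a b => Am.intervalIntegrable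
  have Ai' : ∀ s, 0 ≤ s → IntervalIntegrable (fun u => A (s * u)) volume 1 2 := fun s hs =>
    (Am.comp (fun u v h => mul_le_mul_of_nonneg_left h hs)).intervalIntegrable
  set g : ℝ → ℝ := fun s => ∫ u in (1:ℝ)..2, A (s * u) with hg
  have glow : ∀ s, 0 ≤ s → A s ≤ g s := by
    intro s hs
    have : ∫ u in (1:ℝ)..2, A s ≤ g s := by
      refine intervalIntegral.integral_mono_on (by norm_num) (by simp) (Ai' s hs) (fun u hu => Am ?_)
      nlinarith [hu.1]
    simp at this
    linarith
  have gup : ∀ s, 0 ≤ s → g s ≤ A (2 * s) := by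
    intro s hs
    have : g s ≤ ∫ u in (1:ℝ)..2, A (2 * s) := by
      refine intervalIntegral.integral_mono_on (by norm_num) (Ai' s hs) (by simp) (fun u hu => Am ?_)
      nlinarith [hu.2]
    simp at this
    linarith
  have A00 : A 0 = 0 := by
    refine le_antisymm (le_of_forall_pos_le_add (fun ε hε => ?_)) (A0 0)
    obtain ⟨δ, hδ, h⟩ := hz ε hε
    rw [← AB δ hδ.le] at h
    linarith [Am hδ.le]
  have g0 : g 0 = 0 := le_antisymm (by have := gup 0 le_rfl; rwa [mul_zero, A00] at this)
    (by have := glow 0 le_rfl; rwa [A00] at this)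
  have gm : MonotoneOn g (Ici 0) := by
    intro s hs t ht hst
    refine intervalIntegral.integral_mono_on (by norm_num) (Ai' s hs) (Ai' t ht) (fun u hu => Am ?_)
    have := hu.1
    gcongr
  refine ⟨fun s => s + g s, ⟨?_, ?_, by simp [g0], ?_⟩, fun s hs => ?_⟩
  · refine continuousOn_id.add ?_
    intro s hs
    rcases eq_or_lt_of_le (show (0:ℝ) ≤ s from hs) with h | h
    · subst h
      rw [Metric.continuousWithinAt_iff]
      intro ε hε
      obtain ⟨δ, hδ, h⟩ := hz (ε / 2) (by positivity)
      refine ⟨δ / 2, by positivity, fun {t} ht htd => ?_⟩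
      rw [g0, Real.dist_eq, sub_zero, abs_of_nonneg (by linarith [glow t ht, A0 t])]
      rw [Real.dist_eq, sub_zero, abs_of_nonneg ht] at htd
      have := gup t ht
      have := Am (show 2 * t ≤ δ by linarith)
      rw [AB δ hδ.le] at this
      linarith
    · refine ContinuousAt.continuousWithinAt ?_
      have e : ∀ᶠ t in 𝓝 s, t⁻¹ * ((∫ u in (0:ℝ)..(t * 2), A u) - ∫ u in (0:ℝ)..(t * 1), A u) = g t := by
        filter_upwards [lt_mem_nhds h] with t ht
        rw [intervalIntegral.integral_interval_sub_left (Ai _ _) (Ai _ _), hg]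
        simp only
        rw [intervalIntegral.integral_comp_mul_left (fun u => A u) ht.ne', smul_eq_mul]
      refine ContinuousAt.congr ?_ e
      have pc := intervalIntegral.continuous_primitive (fun a b => Ai a b) 0
      refine (continuousAt_inv₀ h.ne').mul (ContinuousAt.sub ?_ ?_)
      · exact (pc.comp (continuous_mul_const 2)).continuousAt
      · exact (pc.comp (continuous_mul_const 1)).continuousAt
  · intro s hs t ht hst
    have := gm hs ht hst.le
    simp only; linarith
  · refine tendsto_atTop_mono' _ ?_ tendsto_id
    filter_upwards [eventually_ge_atTop 0] with s hs
    have := glow s hs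
    have := A0 s
    simp only [id]; linarith
  · have := glow s hs
    rw [AB s hs] at this
    linarith


section lyap
variable {n l : ℕ} {r : ℝ} {hr : 0 < r} {D : Set (Euc l)} {F : ℝ → Euc l → Hist n r → Euc n}

lemma ehist_expand (hr : 0 < r) {x : C(ℝ, Euc n)} {t : ℝ} {v : Euc n}
    (hv : HasDerivWithinAt x v (Ici t) t) :
    Tendsto (fun h : ℝ => h⁻¹ • (hst r x (t + h) - Ehist h (hst r x t) v)) (𝓝[>] 0) (𝓝 0) := by
  rw [Metric.tendsto_nhds]
  intro ε hε
  rw [hasDerivWithinAt_iff_isLittleO, Asymptotics.isLittleO_iff] at hv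
  have h1 := hv (show (0:ℝ) < ε / 2 by positivity)
  rw [eventually_nhdsWithin_iff, Metric.eventually_nhds_iff] at h1
  obtain ⟨δ, hδ, h1⟩ := h1
  have : Ioo (0:ℝ) δ ∈ 𝓝[>] (0:ℝ) := Ioo_mem_nhdsGT hδ
  filter_upwards [this] with h hh
  have hr' : -r ≤ 0 := by linarith
  rw [dist_zero_right]
  have : ‖hst r x (t + h) - Ehist h (hst r x t) v‖ ≤ ε / 2 * h := by
    rw [ContinuousMap.norm_le _ (by have := hh.1; positivity)]
    intro θ
    rw [ContinuousMap.sub_apply, hst_apply, Ehist, dif_pos hr']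
    change ‖x (t + h + θ) - (if (θ:ℝ) ≤ -h then hst r x t (projIcc (-r) 0 hr' (θ + h))
      else hst r x t (projIcc (-r) 0 hr' 0) + ((θ:ℝ) + h) • v)‖ ≤ ε / 2 * h
    split_ifs with hθ
    · rw [hst_apply, projIcc_of_mem hr' ⟨by linarith [θ.2.1, hh.1], by linarith⟩]
      simp only
      rw [show t + h + (θ:ℝ) = t + (θ + h) by ring, sub_self, norm_zero]
      have := hh.1; positivity
    · push Not at hθ
      have e : hst r x t (projIcc (-r) 0 hr' 0) = x t := by
        rw [hst_apply, projIcc_right]; simp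
      rw [e, show t + h + (θ:ℝ) = t + (θ + h) by ring]
      have hs : 0 < (θ:ℝ) + h := by linarith
      have hs2 : (θ:ℝ) + h ≤ h := by linarith [θ.2.2]
      have := @h1 (t + (θ + h)) (by rw [Real.dist_eq, add_sub_cancel_left, abs_of_pos hs]; linarith [hh.2])
        (mem_Ici.2 (by linarith))
      rw [add_sub_cancel_left, Real.norm_eq_abs, abs_of_pos hs] at this
      rw [← sub_sub]
      exact this.trans (by gcongr)
  rw [norm_smul, norm_inv, Real.norm_of_nonneg hh.1.le]
  calc h⁻¹ * _ ≤ h⁻¹ * (ε / 2 * h) := by have := hh.1; gcongr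
    _ = ε / 2 := by have := hh.1.ne'; field_simp
    _ < ε := by linarith

lemma dini_deriv (hr : 0 < r) {V : ℝ → Hist n r → ℝ} {x : C(ℝ, Euc n)} {t : ℝ} {v : Euc n}
    (hv : HasDerivWithinAt x v (Ici t) t) {w c : ℝ}
    (hw : HasDerivAt (fun s => V s (hst r x s)) w t) (hc : diniH V t (hst r x t) v ≤ (c : EReal)) : w ≤ c := by
  have h1 : Tendsto (fun h : ℝ => (h, h⁻¹ • (hst r x (t + h) - Ehist h (hst r x t) v))) (𝓝[>] 0)
      ((𝓝[>] (0:ℝ)) ×ˢ 𝓝 0) := tendsto_id.prodMk (ehist_expand hr hv)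
  have h2 : Tendsto (fun h : ℝ => ((V (t + h) (hst r x (t + h)) - V t (hst r x t)) / h : ℝ)) (𝓝[>] 0) (𝓝 w) := by
    have := hw.tendsto_slope_zero_right
    refine this.congr (fun h => ?_)
    rw [smul_eq_mul, div_eq_inv_mul]
  have h3 : Tendsto (fun h : ℝ => (((V (t + h) (hst r x (t + h)) - V t (hst r x t)) / h : ℝ) : EReal)) (𝓝[>] 0) (𝓝 (w : EReal)) :=
    (continuous_coe_real_ereal.tendsto _).comp h2
  rw [← EReal.coe_le_coe_iff, ← h3.limsup_eq]
  refine le_trans ?_ hc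
  unfold diniH
  refine le_trans (le_of_eq ?_) (limsup_le_limsup_of_le (f := map (fun h : ℝ => (h, h⁻¹ • (hst r x (t + h) - Ehist h (hst r x t) v))) (𝓝[>] 0)) h1)
  rw [← Filter.limsup_comp]
  refine limsup_congr ?_
  filter_upwards [self_mem_nhdsWithin] with h hh
  have hh : h ≠ 0 := (show (0:ℝ) < h from hh).ne'
  simp only [Function.comp]
  rw [smul_inv_smul₀ hh, add_sub_cancel]

lemma VW_lip {V : ℝ → Hist n r → ℝ} (hV : AlmostLipschitzOn r V) {a b M : ℝ} (ha : 0 ≤ a) (hab : a ≤ b) (hM : 0 ≤ M)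
    {x : C(ℝ, Euc n)} (hx : ∀ s t : ℝ, a - r ≤ s → s ≤ t → t ≤ b → ‖x t - x s‖ ≤ M * (t - s)) :
    ∃ K, 0 ≤ K ∧ ∀ s t, a ≤ s → s ≤ t → t ≤ b → |V t (hst r x t) - V s (hst r x s)| ≤ K * (t - s) := by
  obtain ⟨Vc, LV, P, G, mL, mP, mG, G1, hL, hP⟩ := hV
  obtain ⟨R, R0, hbR, hR⟩ := path_bdd (hst_cont (r := r) x) a b
  have Wc : ContinuousOn (fun s => V s (hst r x s)) (Icc a b) :=
    Vc.comp (f := fun s : ℝ => (s, hst r x s)) (by have := hst_cont (r := r) x; fun_prop)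
      (fun s hs => ⟨ha.trans hs.1, mem_univ _⟩)
  obtain ⟨B, hB⟩ := (isCompact_Icc (a := a) (b := b)).exists_bound_of_continuousOn Wc
  have B0 : 0 ≤ B := (norm_nonneg _).trans (hB a ⟨le_rfl, hab⟩)
  set g := G (R + M) with hg
  have g1 : 1 ≤ g := G1 _
  refine ⟨|LV R| * M + |P R| * (1 + M) + 2 * B * g, by positivity, fun s t hs hst' ht => ?_⟩
  have hts : 0 ≤ t - s := by linarith
  have hsm : s ∈ Icc a b := ⟨hs, hst'.trans ht⟩
  have htm : t ∈ Icc a b := ⟨hs.trans hst', ht⟩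
  rcases le_or_gt (t - s) (1 / g) with h | h
  · have e1 : ‖hst r x t - hst r x s‖ ≤ M * (t - s) := by
      rw [ContinuousMap.norm_le _ (by positivity)]
      intro θ
      have := hx (s + θ) (t + θ) (by linarith [θ.2.1]) (by linarith) (by linarith [θ.2.2])
      rwa [add_sub_add_right_eq_sub] at this
    have e2 := hL R R0 t ⟨by linarith, by linarith⟩ (hst r x s) (hst r x t) (hR s hsm) (hR t htm)
    have hl : LipschitzWith (Real.toNNReal M) (fun θ : Icc (-r) (0:ℝ) => hst r x s θ) := by
      refine LipschitzWith.of_dist_le_mul (fun θ θ' => ?_)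
      rw [dist_eq_norm, Real.coe_toNNReal _ hM, Subtype.dist_eq, Real.dist_eq]
      exact hlip_of hab hx hsm θ θ'
    have e3 := hP R R0 M hM (hst r x s) (hR s hsm) hl s ⟨by linarith, by linarith⟩ (t - s) hts h
    rw [add_sub_cancel] at e3
    have e4 : LV R * ‖hst r x t - hst r x s‖ ≤ |LV R| * (M * (t - s)) :=
      mul_le_mul (le_abs_self _) e1 (norm_nonneg _) (abs_nonneg _)
    have e5 : (t - s) * P R * (1 + M) ≤ (t - s) * |P R| * (1 + M) := by gcongr; exact le_abs_self _
    have e6 : 0 ≤ 2 * B * g * (t - s) := by positivity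
    have e7 := abs_sub_le (V t (hst r x t)) (V t (hst r x s)) (V s (hst r x s))
    nlinarith
  · have e1 : |V t (hst r x t) - V s (hst r x s)| ≤ 2 * B := by
      have := hB t htm
      have h3 := hB s hsm
      rw [Real.norm_eq_abs] at this h3
      exact (abs_sub _ _).trans (by linarith)
    have e2 : 1 ≤ g * (t - s) := by
      rw [div_lt_iff₀ (by positivity)] at h; linarith
    have e3 : 0 ≤ (|LV R| * M + |P R| * (1 + M)) * (t - s) := by positivity
    nlinarith

/-- integral inequality along solutions with Lipschitz initial data -/
lemma GoodF.lyap_lip (hF : GoodF r hr D F) {V : ℝ → Hist n r → ℝ} (hV : AlmostLipschitzOn r V)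
    {g : ℝ → ℝ → ℝ}
    (hg : ∀ t, 0 ≤ t → ∀ x : Hist n r, ∀ d ∈ D, diniH V t x (F t d x) ≤ ((g t (V t x) : ℝ) : EReal))
    {a b M : ℝ} (ha : 0 ≤ a) {d} (hd : InMD D d) {x} (hx : Sol F d a b x)
    (hM : HLip (hst r x a) M) (gc : ContinuousOn (fun t => g t (V t (hst r x t))) (Icc a b)) :
    ∀ s t, a ≤ s → s ≤ t → t ≤ b →
      V t (hst r x t) - V s (hst r x s) ≤ ∫ τ in s..t, g τ (V τ (hst r x τ)) := by
  intro s t hs hst' ht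
  have hab : a ≤ b := by linarith
  obtain ⟨K, K0, hK⟩ : ∃ K, 0 ≤ K ∧ HLip (hst r x a) K :=
    ⟨|M|, abs_nonneg _, fun θ θ' => (hM θ θ').trans (by gcongr; exact le_abs_self _)⟩
  obtain ⟨R, R0, hbR, hR⟩ := path_bdd (hst_cont (r := r) x) a b
  obtain ⟨C, C0, hC⟩ := hF.bdd R R0
  have hl := hF.sol_lip hd ha hx C0 K0 (fun s hs =>
        hC s ⟨ha.trans hs.1, hs.2.trans hbR⟩ _ (hd.2 s) _ (hR s hs)) hK
  obtain ⟨Q, Q0, hQ⟩ := VW_lip hV ha hab (by positivity) hl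
  set W : ℝ → ℝ := fun s => V s (hst r x s) with hW
  have hsub : uIcc s t ⊆ Icc a b := by rw [uIcc_of_le hst']; exact Icc_subset_Icc hs ht
  have hac : AbsolutelyContinuousOnInterval W s t := by
    refine LipschitzOnWith.absolutelyContinuousOnInterval (K := Q.toNNReal) ?_
    refine LipschitzOnWith.of_dist_le_mul (fun u hu v hv => ?_)
    have hu := hsub hu
    have hv := hsub hv
    rw [Real.coe_toNNReal _ Q0, Real.dist_eq, Real.dist_eq]
    rcases le_total u v with h | h
    · rw [abs_sub_comm, abs_sub_comm u v, abs_of_nonneg (by linarith : 0 ≤ v - u)]; exact hQ u v hu.1 h hv.2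
    · rw [abs_of_nonneg (by linarith : 0 ≤ u - v)]; exact hQ v u hv.1 h hu.2
  have e1 : V t (hst r x t) - V s (hst r x s) = ∫ τ in s..t, deriv W τ := hac.integral_deriv_eq_sub.symm
  rw [e1]
  refine intervalIntegral.integral_mono_ae_restrict hst' hac.intervalIntegrable_deriv ?_ ?_
  · exact (gc.mono hsub).intervalIntegrable
  have hi := hF.intg hd (hst_cont x) ha hab
  have e2 := hi.ae_hasDerivAt_integral
  have h3 : ∀ᵐ u : ℝ, u ≠ a := by simp [ae_iff, measure_singleton]
  have h4 : ∀ᵐ u : ℝ, u ≠ b := by simp [ae_iff, measure_singleton]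
  refine (ae_restrict_iff' measurableSet_Icc).2 ?_
  filter_upwards [e2, hac.ae_differentiableAt, h3, h4] with u hu1 hu2 hu3 hu4 hu
  have hu' : u ∈ Icc a b := hsub (by rw [uIcc_of_le hst']; exact hu)
  have hd1 := (hu1 (by rw [uIcc_of_le hab]; exact hu') a left_mem_uIcc).const_add (x a)
  have hd2 := (hu2 (by rw [uIcc_of_le hst']; exact hu)).hasDerivAt
  have hd3 : HasDerivAt x (F u (d u) (hst r x u)) u := by
    refine hd1.congr_of_eventuallyEq ?_
    filter_upwards [Icc_mem_nhds (lt_of_le_of_ne hu'.1 hu3.symm) (lt_of_le_of_ne hu'.2 hu4)] with w hw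
    exact hx w hw
  exact dini_deriv hr hd3.hasDerivWithinAt hd2 (hg u (ha.trans hu'.1) _ _ (hd.2 u))

end lyap


def gg (σ : ℝ → ℝ) (t w : ℝ) : ℝ := -σ w + Real.exp (-t) * min 1 (max (w - 1) 0)

structure Lyp {n l : ℕ} {Y : Type*} [NormedAddCommGroup Y] [NormedSpace ℝ Y] (r : ℝ) (D : Set (Euc l))
    (F : ℝ → Euc l → Hist n r → Euc n) (H : ℝ → Hist n r → Y) (V : ℝ → Hist n r → ℝ)
    (a₁ a₂ μ σ : ℝ → ℝ) : Prop where
  al : AlmostLipschitzOn r V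
  nn : ∀ t x, 0 ≤ V t x
  k1 : IsKinf a₁
  k2 : IsKinf a₂
  km : IsKplus μ
  low : ∀ t, 0 ≤ t → ∀ x, a₁ ‖H t x‖ ≤ V t x
  low2 : ∀ t, 0 ≤ t → ∀ x, a₁ (μ t * ‖x‖) ≤ V t x
  up : ∀ t, 0 ≤ t → ∀ x, V t x ≤ a₂ ‖x‖
  ps : IsPosDef σ
  dec : ∀ t, 0 ≤ t → ∀ x : Hist n r, ∀ d ∈ D, diniH V t x (F t d x) ≤ ((gg σ t (V t x) : ℝ) : EReal)

/-- the integral inequality -/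
def IntIneq (σ : ℝ → ℝ) (W : ℝ → ℝ) (a b : ℝ) : Prop :=
  ∀ s t, a ≤ s → s ≤ t → t ≤ b → W t - W s ≤ ∫ τ in s..t, gg σ τ (W τ)

section scal
variable {σ : ℝ → ℝ} {W : ℝ → ℝ} {a b : ℝ}

lemma gg_cont (hσ : IsPosDef σ) (W0 : ∀ t, 0 ≤ W t) {s : Set ℝ} (hW : ContinuousOn W s) :
    ContinuousOn (fun t => gg σ t (W t)) s := by
  unfold gg
  refine ContinuousOn.add (hσ.1.comp hW (fun t _ => W0 t)).neg ?_
  refine ContinuousOn.mul (by fun_prop) ?_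
  exact (by fun_prop : Continuous fun w : ℝ => min 1 (max (w - 1) 0)).comp_continuousOn hW

lemma gg_le {t w : ℝ} : gg σ t w ≤ -σ w + Real.exp (-t) := by
  unfold gg
  have : Real.exp (-t) * min 1 (max (w - 1) 0) ≤ Real.exp (-t) * 1 := by gcongr; exact min_le_left _ _
  linarith

lemma gg_nonpos (hσ : IsPosDef σ) {t w : ℝ} (hw : 0 ≤ w) (h1 : w ≤ 1) : gg σ t w ≤ 0 := by
  unfold gg
  rw [max_eq_right (by linarith), min_eq_right (by norm_num)]
  linarith [hσ.2.2.2 w hw]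

lemma exp_int {s t : ℝ} : ∫ τ in s..t, Real.exp (-τ) = Real.exp (-s) - Real.exp (-t) := by
  simp [intervalIntegral.integral_comp_neg (fun u => Real.exp u)]

lemma IntIneq.le_one (h : IntIneq σ W a b) (hσ : IsPosDef σ) (W0 : ∀ t, 0 ≤ W t) (hW : ContinuousOn W (Icc a b))
    {s t c : ℝ} (h0 : 0 ≤ a) (hs : a ≤ s) (hst : s ≤ t) (ht : t ≤ b) (hc : ∀ u ∈ Icc s t, c ≤ σ (W u)) :
    W t ≤ W s + 1 - c * (t - s) := by
  have h1 := h s t hs hst ht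
  have h2 : ∫ τ in s..t, gg σ τ (W τ) ≤ ∫ τ in s..t, (-c + Real.exp (-τ)) := by
    refine intervalIntegral.integral_mono_on hst ?_ ?_ ?_
    · refine ContinuousOn.intervalIntegrable ?_
      rw [uIcc_of_le hst]
      exact gg_cont hσ W0 (hW.mono (Icc_subset_Icc hs ht))
    · exact Continuous.intervalIntegrable (by fun_prop) _ _
    · intro u hu
      refine gg_le.trans ?_
      linarith [hc u hu]
  rw [intervalIntegral.integral_add (by simp) (Continuous.intervalIntegrable (by fun_prop) _ _), exp_int,
    intervalIntegral.integral_const, smul_eq_mul] at h2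
  have : Real.exp (-s) ≤ 1 := Real.exp_le_one_iff.2 (by linarith)
  have := Real.exp_pos (-t)
  linarith

lemma IntIneq.inv (h : IntIneq σ W a b) (hσ : IsPosDef σ) (W0 : ∀ t, 0 ≤ W t) (hW : ContinuousOn W (Icc a b))
    {c s t : ℝ} (hc : c < 1) (hs : a ≤ s) (hst : s ≤ t) (ht : t ≤ b) (hWs : W s ≤ c) : W t ≤ c := by
  by_contra hcon
  push Not at hcon
  have hWst := hW.mono (Icc_subset_Icc hs ht)
  have hcomp : IsCompact {u ∈ Icc s t | W u ≤ c} := by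
    have : IsClosed {u ∈ Icc s t | W u ≤ c} := by
      have := hWst.preimage_isClosed_of_isClosed isClosed_Icc (isClosed_Iic (a := c))
      exact this
    exact isCompact_Icc.of_isClosed_subset this (fun u hu => hu.1)
  obtain ⟨m, ⟨hm, hmc⟩, hmax⟩ := hcomp.exists_isGreatest ⟨s, ⟨⟨le_rfl, hst⟩, hWs⟩⟩
  have hmt : m < t := lt_of_le_of_ne hm.2 (by rintro rfl; linarith)
  have hev : ∀ᶠ u in 𝓝[Icc s t] m, W u < 1 := (hWst m hm).eventually (gt_mem_nhds (by linarith))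
  rw [eventually_nhdsWithin_iff, Metric.eventually_nhds_iff] at hev
  obtain ⟨δ, δ0, hδ⟩ := hev
  set u := min (m + δ / 2) t with hu
  have hmu : m < u := lt_min (by linarith) hmt
  have hut : u ≤ t := min_le_right _ _
  have h1 := h m u (hs.trans hm.1) hmu.le (hut.trans ht)
  have h2 : ∫ τ in m..u, gg σ τ (W τ) ≤ 0 := by
    have := intervalIntegral.integral_nonneg (μ := volume) (f := fun τ => -gg σ τ (W τ)) hmu.le (fun τ hτ => by
      have hτt : τ ∈ Icc s t := ⟨hm.1.trans hτ.1, hτ.2.trans hut⟩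
      have h5 : τ ≤ m + δ / 2 := hτ.2.trans (min_le_left _ _)
      have := hδ (y := τ) (by rw [Real.dist_eq, abs_of_nonneg (by linarith [hτ.1])]; linarith) hτt
      linarith [gg_nonpos (t := τ) hσ (W0 τ) this.le])
    rw [intervalIntegral.integral_neg] at this
    linarith
  have : u ∈ {u ∈ Icc s t | W u ≤ c} := ⟨⟨by linarith [hm.1], hut⟩, by linarith⟩
  linarith [hmax this]

lemma IsKinf.nonneg {a : ℝ → ℝ} (h : IsKinf a) {s : ℝ} (hs : 0 ≤ s) : 0 ≤ a s := by
  rw [← h.2.2.1]; exact h.2.1.monotoneOn (mem_Ici.2 le_rfl) hs hs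

lemma IsKinf.pos {a : ℝ → ℝ} (h : IsKinf a) {s : ℝ} (hs : 0 < s) : 0 < a s := by
  rw [← h.2.2.1]; exact h.2.1 (mem_Ici.2 le_rfl) (mem_Ici.2 hs.le) hs

lemma IsKinf.bnd {a : ℝ → ℝ} (h : IsKinf a) (B : ℝ) : ∃ M, 0 ≤ M ∧ ∀ s, 0 ≤ s → a s ≤ B → s ≤ M := by
  obtain ⟨M, hM⟩ := ((h.2.2.2.eventually_gt_atTop B).and (eventually_ge_atTop 0)).exists
  refine ⟨M, hM.2, fun s hs hB => ?_⟩
  by_contra hc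
  push Not at hc
  have := h.2.1 (mem_Ici.2 hM.2) (mem_Ici.2 hs) hc
  linarith [hM.1]

lemma IsKinf.small {a : ℝ → ℝ} (h : IsKinf a) {ε : ℝ} (hε : 0 < ε) : ∃ δ, 0 < δ ∧ a δ ≤ ε := by
  have := (h.1 0 (mem_Ici.2 le_rfl)).eventually (gt_mem_nhds (show a 0 < ε by rw [h.2.2.1]; exact hε))
  rw [eventually_nhdsWithin_iff, Metric.eventually_nhds_iff] at this
  obtain ⟨δ, δ0, hδ⟩ := this
  refine ⟨δ / 2, by positivity, (hδ ?_ ?_).le⟩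
  · rw [Real.dist_eq, sub_zero, abs_of_pos (by positivity)]; linarith
  · exact mem_Ici.2 (by positivity)

lemma IsKplus.min {b : ℝ → ℝ} (h : IsKplus b) (T : ℝ) : ∃ m, 0 < m ∧ ∀ t ∈ Icc 0 T, m ≤ b t := by
  rcases lt_or_ge T 0 with hT | hT
  · exact ⟨1, one_pos, fun t ht => by linarith [ht.1, ht.2]⟩
  obtain ⟨m, hm, hmin⟩ := (isCompact_Icc (a := (0:ℝ)) (b := T)).exists_isMinOn ⟨0, le_rfl, hT⟩
    (h.1.mono (fun t ht => ht.1))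
  exact ⟨b m, h.2 m hm.1, fun t ht => hmin ht⟩

end scal


section lyp
variable {n l : ℕ} {r : ℝ} {hr : 0 < r} {D : Set (Euc l)} {F : ℝ → Euc l → Hist n r → Euc n}
  {Y : Type*} [NormedAddCommGroup Y] [NormedSpace ℝ Y] {H : ℝ → Hist n r → Y}
  {V : ℝ → Hist n r → ℝ} {a₁ a₂ μ σ : ℝ → ℝ}

lemma Lyp.Wc (hL : Lyp r D F H V a₁ a₂ μ σ) {a b : ℝ} (ha : 0 ≤ a) (x : C(ℝ, Euc n)) :
    ContinuousOn (fun s => V s (hst r x s)) (Icc a b) :=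
  hL.al.1.comp (f := fun s : ℝ => (s, hst r x s)) (by have := hst_cont (r := r) x; fun_prop)
    (fun _ hs => ⟨ha.trans hs.1, mem_univ _⟩)

lemma Lyp.bndR (hL : Lyp r D F H V a₁ a₂ μ σ) (B T : ℝ) : ∃ R, 0 ≤ R ∧ ∀ t ∈ Icc 0 T, ∀ x, V t x ≤ B → ‖x‖ ≤ R := by
  obtain ⟨M, M0, hM⟩ := hL.k1.bnd B
  obtain ⟨m, m0, hm⟩ := hL.km.min T
  refine ⟨M / m, by positivity, fun t ht x hx => ?_⟩
  have h1 := hM (μ t * ‖x‖) (mul_nonneg (hL.km.2 t ht.1).le (norm_nonneg _)) ((hL.low2 t ht.1 x).trans hx)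
  rw [le_div_iff₀ m0]
  have := mul_le_mul_of_nonneg_right (hm t ht) (norm_nonneg x)
  linarith

lemma Lyp.le1 (hL : Lyp r D F H V a₁ a₂ μ σ) {a b : ℝ} (ha : 0 ≤ a) {x : C(ℝ, Euc n)}
    (h : IntIneq σ (fun t => V t (hst r x t)) a b) {t : ℝ} (ht : t ∈ Icc a b) :
    V t (hst r x t) ≤ V a (hst r x a) + 1 := by
  have := h.le_one hL.ps (fun t => hL.nn _ _) (hL.Wc ha x) ha le_rfl ht.1 ht.2 (c := 0)
    (fun u _ => hL.ps.2.2.2 _ (hL.nn _ _))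
  linarith

lemma Lyp.ii (hL : Lyp r D F H V a₁ a₂ μ σ) (hF : GoodF r hr D F) {a b M : ℝ} (ha : 0 ≤ a) {d} (hd : InMD D d) {x}
    (hx : Sol F d a b x) (hM : HLip (hst r x a) M) : IntIneq σ (fun t => V t (hst r x t)) a b :=
  hF.lyap_lip hL.al hL.dec ha hd hx hM (gg_cont hL.ps (fun _ => hL.nn _ _) (hL.Wc ha x))

lemma Lyp.ex (hL : Lyp r D F H V a₁ a₂ μ σ) (hF : GoodF r hr D F) {a b : ℝ} (ha : 0 ≤ a) (hab : a ≤ b)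
    {d} (hd : InMD D d) (x0 : Hist n r) :
    ∃ x, hst r x a = x0 ∧ Sol F d a b x ∧ IntIneq σ (fun t => V t (hst r x t)) a b := by
  set B := a₂ (‖x0‖ + 1) + 1 with hB
  obtain ⟨R, R0, hR⟩ := hL.bndR B b
  have key : ∀ k : ℕ, ∃ x, ‖hst r x a - x0‖ ≤ 1 / ((k:ℝ) + 1) ∧ Sol F d a b x ∧ IntIneq σ (fun t => V t (hst r x t)) a b ∧
      ∀ t ∈ Icc a b, V t (hst r x t) ≤ B := by
    intro k
    obtain ⟨y, M, M0, hM, hy⟩ := lip_dense hr x0 (ε := 1 / ((k:ℝ) + 1)) (by positivity)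
    have hk1 : 1 / ((k:ℝ) + 1) ≤ 1 := by rw [div_le_one (by positivity)]; linarith [Nat.cast_nonneg (α := ℝ) k]
    have hyn : ‖y‖ ≤ ‖x0‖ + 1 := by
      have := norm_add_le (y - x0) x0
      rw [sub_add_cancel] at this; linarith
    have hVy : V a y ≤ a₂ (‖x0‖ + 1) := (hL.up a ha y).trans
      (hL.k2.2.1.monotoneOn (mem_Ici.2 (norm_nonneg _)) (mem_Ici.2 (by positivity)) hyn)
    obtain ⟨x, hxa, hx⟩ := hF.glob ha hab hM hd (R := R) (fun c hc x hxa hx t ht => by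
      refine hR t ⟨ha.trans ht.1, ht.2.trans hc.2⟩ _ ?_
      have := hL.le1 ha (hL.ii hF ha hd hx (by rw [hxa]; exact hM)) ht
      rw [hxa] at this; linarith)
    have hI := hL.ii hF ha hd hx (by rw [hxa]; exact hM)
    refine ⟨x, by rw [hxa]; exact hy, hx, hI, fun t ht => ?_⟩
    have := hL.le1 ha hI ht
    rw [hxa] at this; linarith
  choose x hxa hx hI hB' using key
  have t0 : Tendsto (fun k => hst r (x k) a) atTop (𝓝 x0) := by
    rw [tendsto_iff_norm_sub_tendsto_zero]
    exact squeeze_zero (fun _ => norm_nonneg _) hxa tendsto_one_div_add_atTop_nhds_zero_nat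
  obtain ⟨y, hy, hys, hyt⟩ := hF.approx ha hab (le_max_right R b) hd (x := x) (ψ := fun k => hst r (x k)) (ε := fun _ => 0)
    (fun k => hst_cont _) (fun k s hs => (hR s ⟨ha.trans hs.1, hs.2⟩ _ (hB' k s hs)).trans (le_max_left _ _))
    hx (fun k s _ => by simp) tendsto_const_nhds t0
  refine ⟨y, hy, hys, fun s t hs hst' ht => ?_⟩
  have hWt : ∀ u ∈ Icc a b, Tendsto (fun k => V u (hst r (x k) u)) atTop (𝓝 (V u (hst r y u))) := by
    intro u hu
    have h1 := hL.al.1 (u, hst r y u) ⟨ha.trans hu.1, mem_univ _⟩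
    have h2 : Tendsto (fun k => (u, hst r (x k) u)) atTop (𝓝[Ici 0 ×ˢ univ] (u, hst r y u)) :=
      tendsto_nhdsWithin_iff.2 ⟨tendsto_const_nhds.prodMk_nhds (hyt u hu), Eventually.of_forall fun k => ⟨ha.trans hu.1, mem_univ _⟩⟩
    exact h1.tendsto.comp h2
  obtain ⟨S, hS⟩ := (isCompact_Icc (a := (0:ℝ)) (b := B)).exists_bound_of_continuousOn (hL.ps.1.mono (fun t ht => ht.1))
  have hsub : ∀ τ ∈ Icc s t, τ ∈ Icc a b := fun τ hτ => ⟨hs.trans hτ.1, hτ.2.trans ht⟩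
  have h3 : Tendsto (fun k => ∫ τ in s..t, gg σ τ (V τ (hst r (x k) τ))) atTop (𝓝 (∫ τ in s..t, gg σ τ (V τ (hst r y τ)))) := by
    refine intervalIntegral.tendsto_integral_filter_of_dominated_convergence (fun _ => S + 1) ?_ ?_ (by simp) ?_
    · refine Eventually.of_forall fun k => ?_
      rw [uIoc_of_le hst']
      exact ((gg_cont hL.ps (fun _ => hL.nn _ _) (hL.Wc (ha.trans hs) (x k))).mono Ioc_subset_Icc_self).aestronglyMeasurable measurableSet_Ioc
    · refine Eventually.of_forall fun k => Eventually.of_forall fun τ hτ => ?_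
      rw [uIoc_of_le hst'] at hτ
      have hτ' := hsub τ ⟨hτ.1.le, hτ.2⟩
      have h4 := hS _ ⟨hL.nn τ (hst r (x k) τ), hB' k τ hτ'⟩
      rw [Real.norm_eq_abs] at h4 ⊢
      unfold gg
      refine (abs_add_le _ _).trans (add_le_add (by rwa [abs_neg]) ?_)
      have h5 : Real.exp (-τ) ≤ 1 := Real.exp_le_one_iff.2 (by linarith [hτ'.1])
      have h6 : 0 ≤ min 1 (max (V τ (hst r (x k) τ) - 1) 0) := le_min (by norm_num) (le_max_right _ _)
      rw [abs_of_nonneg (by positivity)]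
      exact mul_le_one₀ h5 h6 (min_le_left _ _)
    · refine Eventually.of_forall fun τ hτ => ?_
      rw [uIoc_of_le hst'] at hτ
      have hw := hWt τ (hsub τ ⟨hτ.1.le, hτ.2⟩)
      have h7 := (hL.ps.1 (V τ (hst r y τ)) (mem_Ici.2 (hL.nn _ _))).tendsto.comp
        (tendsto_nhdsWithin_iff.2 ⟨hw, Eventually.of_forall fun k => mem_Ici.2 (hL.nn _ _)⟩)
      exact h7.neg.add (tendsto_const_nhds.mul (((by fun_prop : Continuous fun w : ℝ => min 1 (max (w - 1) 0)).tendsto _).comp hw))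
  exact le_of_tendsto_of_tendsto ((hWt t ⟨hs.trans hst', ht⟩).sub (hWt s ⟨hs, hst'.trans ht⟩)) h3
    (Eventually.of_forall fun k => hI k s t hs hst' ht)

/-- a consistent family of solutions gives a global one -/
lemma GoodF.global (hF : GoodF r hr D F) {a : ℝ} (ha : 0 ≤ a) {d} (hd : InMD D d) {x0 : Hist n r}
    (h : ∀ T, a ≤ T → ∃ x, hst r x a = x0 ∧ Sol F d a T x) :
    ∃ x, hst r x a = x0 ∧ ∀ T, Sol F d a T x := by
  choose Z hZ0 hZ using h
  have Zeq : ∀ S T (hS : a ≤ S) (hT : a ≤ T), S ≤ T → ∀ s, a - r ≤ s → s ≤ S → Z S hS s = Z T hT s := by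
    intro S T hS hT hST s h1 h2
    rcases le_total s a with hs | hs
    · have := DFunLike.congr_fun ((hZ0 S hS).trans (hZ0 T hT).symm) ⟨s - a, by linarith, by linarith⟩
      simpa using this
    · have := hF.uniq ha hd (hZ S hS) ((hZ T hT).mono hST) ((hZ0 S hS).trans (hZ0 T hT).symm) s ⟨hs, h2⟩
      rw [← hst_z0 hr (Z S hS) s, ← hst_z0 hr (Z T hT) s, this]
  set w : ℝ → Euc n := fun t => Z (max t a) (le_max_right _ _) (max t (a - r)) with hw
  have weq : ∀ T (hT : a ≤ T), ∀ t ≤ T, w t = Z T hT (max t (a - r)) := fun T hT t ht =>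
    Zeq _ _ _ _ (max_le ht hT) _ (le_max_right _ _) (max_le_max le_rfl (by linarith))
  have wc : Continuous w := by
    rw [continuous_iff_continuousAt]
    intro t
    have hT : a ≤ max (t + 1) a := le_max_right _ _
    have : (fun s => Z _ hT (max s (a - r))) =ᶠ[𝓝 t] w := by
      filter_upwards [gt_mem_nhds (show t < t + 1 by linarith)] with s hs
      exact (weq _ hT s (hs.le.trans (le_max_left _ _))).symm
    exact ContinuousAt.congr (by fun_prop) this
  have hh : ∀ T (hT : a ≤ T), ∀ t ∈ Icc a T, hst r ⟨w, wc⟩ t = hst r (Z T hT) t := by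
    intro T hT t ht
    ext1 θ
    show w (t + θ) = Z T hT (t + θ)
    rw [weq T hT _ (by linarith [θ.2.2, ht.2]), max_eq_left (by linarith [θ.2.1, ht.1])]
  refine ⟨⟨w, wc⟩, (hh a le_rfl a ⟨le_rfl, le_rfl⟩).trans (hZ0 a le_rfl), fun T t ht => ?_⟩
  have hT : a ≤ T := ht.1.trans ht.2
  have h1 := hZ T hT t ht
  have e : ∀ s ∈ Icc a T, (⟨w, wc⟩ : C(ℝ, Euc n)) s = Z T hT s := fun s hs => by
    rw [← hst_z0 hr (Z T hT) s, ← hst_z0 hr (⟨w, wc⟩ : C(ℝ, Euc n)) s, hh T hT s hs]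
  rw [e t ht, e a ⟨le_rfl, hT⟩, h1]
  congr 1
  refine intervalIntegral.integral_congr (fun s hs => ?_)
  rw [uIcc_of_le ht.1] at hs
  simp only [hh T hT s ⟨hs.1, hs.2.trans ht.2⟩]

lemma sol_of_isSol (hr : 0 < r) {d : ℝ → Euc l} {t0 : ℝ} {x0 : Hist n r} {tm : EReal} {y : ℝ → Euc n} {ψ : ℝ → Hist n r}
    (h : IsSolutionRFDE F d t0 x0 tm y ψ) {T : ℝ} (hT : t0 ≤ T) (hTm : (T : EReal) < tm) :
    ∃ x, hst r x t0 = x0 ∧ Sol F d t0 T x ∧ ∀ s ∈ Icc t0 T, hst r x s = ψ s := by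
  obtain ⟨-, h0, hφ, yc, hy⟩ := h
  have hle : t0 - r ≤ T := by linarith
  have lt : ∀ s ≤ T, (s : EReal) < tm := fun s hs => lt_of_le_of_lt (EReal.coe_le_coe_iff.2 hs) hTm
  have wc : Continuous (fun s => y (projIcc (t0 - r) T hle s)) := by
    have := yc.comp_continuous (f := fun s => (projIcc (t0 - r) T hle s : ℝ)) (by fun_prop)
      (fun s => ⟨(projIcc (t0 - r) T hle s).2.1, lt _ (projIcc (t0 - r) T hle s).2.2⟩)
    exact this
  have e1 : ∀ s ∈ Icc (t0 - r) T, (⟨_, wc⟩ : C(ℝ, Euc n)) s = y s := fun s hs => by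
    show y (projIcc (t0 - r) T hle s) = y s
    rw [projIcc_of_mem hle hs]
  have e2 : ∀ s ∈ Icc t0 T, hst r ⟨_, wc⟩ s = ψ s := by
    intro s hs; ext1 θ
    rw [hφ s hs.1 (lt s hs.2) θ, hst_apply, e1 _ ⟨by linarith [θ.2.1, hs.1], by linarith [θ.2.2, hs.2]⟩]
  refine ⟨⟨_, wc⟩, by rw [e2 t0 ⟨le_rfl, hT⟩, h0], fun t ht => ?_, e2⟩
  rw [e1 t ⟨by linarith [ht.1], ht.2⟩, e1 t0 ⟨by linarith, hT⟩, hy t ht.1 (lt t ht.2)]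
  congr 1
  refine intervalIntegral.integral_congr (fun s hs => ?_)
  rw [uIcc_of_le ht.1] at hs
  simp only [e2 s ⟨hs.1, hs.2.trans ht.2⟩]

lemma Lyp.urgaos (hL : Lyp r D F H V a₁ a₂ μ σ) (hF : GoodF r hr D F) : URGAOSrfde r D F H := by
  have key : ∀ t0 : ℝ, ∀ x0 : Hist n r, ∀ d : ℝ → Euc l, ∃ x : C(ℝ, Euc n), 0 ≤ t0 → InMD D d →
      hst r x t0 = x0 ∧ (∀ T, Sol F d t0 T x) ∧ ∀ T, IntIneq σ (fun t => V t (hst r x t)) t0 T := by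
    intro t0 x0 d
    by_cases hc : 0 ≤ t0 ∧ InMD D d
    swap
    · exact ⟨0, fun h1 h2 => absurd ⟨h1, h2⟩ hc⟩
    obtain ⟨h0, hd⟩ := hc
    obtain ⟨x, hx0, hx⟩ := hF.global h0 hd (x0 := x0) (fun T hT => by
      obtain ⟨x, h1, h2, -⟩ := hL.ex hF h0 hT hd x0
      exact ⟨x, h1, h2⟩)
    refine ⟨x, fun _ _ => ⟨hx0, hx, fun T s t hs hst' ht => ?_⟩⟩
    have hT : t0 ≤ T := by linarith
    obtain ⟨y, hy0, hy, hyI⟩ := hL.ex hF h0 hT hd x0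
    have e := hF.uniq h0 hd (hx T) hy (hx0.trans hy0.symm)
    have := hyI s t hs hst' ht
    simp only [e t ⟨hs.trans hst', ht⟩, e s ⟨hs, hst'.trans ht⟩]
    rw [intervalIntegral.integral_congr (g := fun τ => gg σ τ (V τ (hst r y τ))) (fun τ hτ => by
      rw [uIcc_of_le hst'] at hτ
      simp only [e τ ⟨hs.trans hτ.1, hτ.2.trans ht⟩])]
    exact this
  choose X hX using key
  have mono2 : ∀ {x : Hist n r} {s : ℝ} {t : ℝ}, 0 ≤ t → ‖x‖ ≤ s → V t x ≤ a₂ s := fun {x s t} ht hx =>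
    (hL.up t ht x).trans (hL.k2.2.1.monotoneOn (mem_Ici.2 (norm_nonneg _)) (mem_Ici.2 ((norm_nonneg _).trans hx)) hx)
  refine ⟨fun t0 x0 d => X t0 x0 d, fun t0 x0 d => hst r (X t0 x0 d), fun _ _ _ => ⊤, ?_, ?_, ?_, ?_⟩
  · intro t0 h0 x0 d hd
    obtain ⟨hx0, hx, -⟩ := hX t0 x0 d h0 hd
    refine ⟨⟨EReal.coe_lt_top _, hx0, fun t _ _ θ => rfl, (X t0 x0 d).continuous.continuousOn, fun t ht _ => hx t t ⟨ht, le_rfl⟩⟩, ?_⟩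
    intro tm y ψ hy
    refine ⟨le_top, fun t ht htm => ?_⟩
    obtain ⟨z, hz0, hz, hzψ⟩ := sol_of_isSol hr hy ht htm
    rw [← hzψ t ⟨ht, le_rfl⟩]
    exact hF.uniq h0 hd hz (hx t) (hz0.trans hx0.symm) t ⟨ht, le_rfl⟩
  · intro T hT s hs
    obtain ⟨R, R0, hR⟩ := hL.bndR (a₂ s + 1) (T + T)
    refine ⟨R, fun t0 h0 ξ hξ x0 hx0 d hd => ⟨EReal.coe_lt_top _, ?_⟩⟩
    obtain ⟨h1, h2, h3⟩ := hX t0 x0 d h0.1 hd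
    refine hR (t0 + ξ) ⟨by linarith [h0.1, hξ.1], by linarith [h0.2, hξ.2]⟩ _ ?_
    have := hL.le1 h0.1 (h3 (t0 + ξ)) (t := t0 + ξ) ⟨by linarith [hξ.1], le_rfl⟩
    rw [h1] at this
    linarith [mono2 h0.1 hx0]
  · intro ε hε
    constructor
    · obtain ⟨M, M0, hM⟩ := hL.k1.bnd (a₂ ε + 1)
      refine ⟨M, fun t0 h0 x0 hx0 d hd t ht _ => ?_⟩
      obtain ⟨h1, h2, h3⟩ := hX t0 x0 d h0 hd
      refine hM _ (norm_nonneg _) ((hL.low t (h0.trans ht) _).trans ?_)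
      have := hL.le1 h0 (h3 t) (t := t) ⟨ht, le_rfl⟩
      rw [h1] at this
      linarith [mono2 h0 hx0]
    · have hc : 0 < min (a₁ ε) (1 / 2) := lt_min (hL.k1.pos hε) (by norm_num)
      obtain ⟨δ, δ0, hδ⟩ := hL.k2.small hc
      refine ⟨δ, δ0, fun t0 h0 x0 hx0 d hd t ht _ => ?_⟩
      obtain ⟨h1, h2, h3⟩ := hX t0 x0 d h0 hd
      have := (h3 t).inv hL.ps (fun t => hL.nn _ _) (hL.Wc h0 _) (c := min (a₁ ε) (1 / 2))
        (lt_of_le_of_lt (min_le_right _ _) (by norm_num)) le_rfl ht le_rfl (by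
          simp only [h1]; exact (mono2 h0 hx0).trans hδ)
      have h4 := (hL.low t (h0.trans ht) _).trans (this.trans (min_le_left _ _))
      exact (hL.k1.2.1.le_iff_le (mem_Ici.2 (norm_nonneg _)) (mem_Ici.2 hε.le)).1 h4
  · intro ε hε R hR
    set c := min (a₁ ε) (1 / 2) with hc'
    have hc : 0 < c := lt_min (hL.k1.pos hε) (by norm_num)
    set B := a₂ R + 1 with hB
    have hB1 : 1 ≤ B := by linarith [hL.k2.nonneg hR]
    have hcB : c ≤ B := (min_le_right _ _).trans (by linarith)
    obtain ⟨w, hw, hmin⟩ := (isCompact_Icc (a := c) (b := B)).exists_isMinOn ⟨c, le_rfl, hcB⟩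
      (hL.ps.1.mono (fun t ht => hc.le.trans ht.1))
    have hm : 0 < σ w := hL.ps.2.2.1 w (by linarith [hw.1])
    refine ⟨(B + 1) / σ w + 1, by positivity, fun t0 h0 x0 hx0 d hd t ht _ => ?_⟩
    obtain ⟨h1, h2, h3⟩ := hX t0 x0 d h0 hd
    have hτ : 0 ≤ (B + 1) / σ w + 1 := by positivity
    have ht0 : t0 ≤ t := by linarith
    have hWB : ∀ u ∈ Icc t0 t, V u (hst r (X t0 x0 d) u) ≤ B := fun u hu => by
      have := hL.le1 h0 (h3 t) hu
      rw [h1] at this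
      linarith [mono2 h0 hx0]
    have : ∃ u ∈ Icc t0 t, V u (hst r (X t0 x0 d) u) ≤ c := by
      by_contra hcon
      push Not at hcon
      have := (h3 t).le_one hL.ps (fun t => hL.nn _ _) (hL.Wc h0 _) h0 le_rfl ht0 le_rfl (c := σ w)
        (fun u hu => hmin ⟨(hcon u hu).le, hWB u hu⟩)
      have h5 := hL.nn t (hst r (X t0 x0 d) t)
      have h6 := hWB t0 ⟨le_rfl, ht0⟩
      have h7 : σ w * ((B + 1) / σ w + 1) ≤ σ w * (t - t0) := by gcongr; linarith
      rw [mul_add, mul_div_cancel₀ _ hm.ne'] at h7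
      linarith
    obtain ⟨u, hu, huc⟩ := this
    have := (h3 t).inv hL.ps (fun t => hL.nn _ _) (hL.Wc h0 _) (c := c)
      (lt_of_le_of_lt (min_le_right _ _) (by norm_num)) hu.1 hu.2 le_rfl huc
    have h4 := (hL.low t (h0.trans ht0) _).trans (this.trans (min_le_left _ _))
    exact (hL.k1.2.1.le_iff_le (mem_Ici.2 (norm_nonneg _)) (mem_Ici.2 hε.le)).1 h4

end lyp


section ctrl

/-- radial retraction -/
def rad {p : ℕ} (R : ℝ) (φ : Euc p) : Euc p := (R / max R ‖φ‖) • φ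

lemma rad_norm {p : ℕ} {R : ℝ} (hR : 0 < R) (φ : Euc p) : ‖rad R φ‖ ≤ R := by
  have h : 0 < max R ‖φ‖ := lt_max_of_lt_left hR
  rw [rad, norm_smul, Real.norm_of_nonneg (by positivity), div_mul_eq_mul_div, div_le_iff₀ h]
  gcongr; exact le_max_right _ _

lemma rad_eq {p : ℕ} {R : ℝ} (hR : 0 < R) {φ : Euc p} (h : ‖φ‖ ≤ R) : rad R φ = φ := by
  rw [rad, max_eq_left h, div_self hR.ne', one_smul]

lemma rad_lip {p : ℕ} {R : ℝ} (hR : 0 < R) (a b : Euc p) : ‖rad R a - rad R b‖ ≤ 2 * ‖a - b‖ := by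
  have ha : 0 < max R ‖a‖ := lt_max_of_lt_left hR
  have hb : 0 < max R ‖b‖ := lt_max_of_lt_left hR
  have e : rad R a - rad R b = (R / max R ‖a‖) • (a - b) + (R / max R ‖a‖ - R / max R ‖b‖) • b := by
    rw [rad, rad]; module
  have h1 : ‖(R / max R ‖a‖) • (a - b)‖ ≤ ‖a - b‖ := by
    rw [norm_smul, Real.norm_of_nonneg (by positivity)]
    exact mul_le_of_le_one_left (norm_nonneg _) ((div_le_one ha).2 (le_max_left _ _))
  have h2 : ‖(R / max R ‖a‖ - R / max R ‖b‖) • b‖ ≤ ‖a - b‖ := by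
    have e2 : R / max R ‖a‖ - R / max R ‖b‖ = (R / max R ‖a‖) * (max R ‖b‖ - max R ‖a‖) / max R ‖b‖ := by
      field_simp
    rw [norm_smul, e2, norm_div, norm_mul, Real.norm_of_nonneg (show 0 ≤ R / max R ‖a‖ by positivity),
      Real.norm_of_nonneg hb.le, div_mul_eq_mul_div, div_le_iff₀ hb]
    have h3 : ‖max R ‖b‖ - max R ‖a‖‖ ≤ ‖a - b‖ := by
      rw [Real.norm_eq_abs]
      refine (abs_max_sub_max_le_max R ‖b‖ R ‖a‖).trans ?_
      rw [sub_self, abs_zero, norm_sub_rev]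
      exact max_le (norm_nonneg _) (abs_norm_sub_norm_le _ _)
    have h4 : R / max R ‖a‖ ≤ 1 := (div_le_one ha).2 (le_max_left _ _)
    calc _ ≤ (1 * ‖a - b‖) * max R ‖b‖ := by gcongr; exact le_max_right _ _
      _ = _ := by ring
  rw [e]
  exact (norm_add_le _ _).trans (by linarith)

def cut {p : ℕ} (η : ℝ) (φ : Euc p) : ℝ := min 1 (max 0 (‖φ‖ / η - 1))

lemma cut_mem {p : ℕ} (η : ℝ) (φ : Euc p) : cut η φ ∈ Icc (0:ℝ) 1 :=
  ⟨le_min zero_le_one (le_max_left _ _), min_le_left _ _⟩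

lemma cut_lip {p : ℕ} {η m : ℝ} (hm : 0 < m) (hη : m ≤ η) (a b : Euc p) : |cut η a - cut η b| ≤ m⁻¹ * ‖a - b‖ := by
  have h0 : 0 < η := by linarith
  have h1 := abs_min_sub_min_le_max 1 (max 0 (‖a‖ / η - 1)) 1 (max 0 (‖b‖ / η - 1))
  have h2 := abs_max_sub_max_le_max 0 (‖a‖ / η - 1) 0 (‖b‖ / η - 1)
  rw [sub_self, abs_zero, max_eq_right (α := ℝ) (a := 0) (b := |_|) (abs_nonneg _)] at h1 h2
  refine (h1.trans h2).trans ?_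
  rw [sub_sub_sub_cancel_right, ← sub_div, abs_div, abs_of_pos h0, div_eq_inv_mul]
  have := abs_norm_sub_norm_le a b
  have : η⁻¹ ≤ m⁻¹ := by gcongr
  gcongr

variable {m p : ℕ}

lemma comb_id (A B G G' : Euc m) (c c' : ℝ) : A + c • (G - A) - (B + c' • (G' - B)) =
    (A - B) + (c - c') • (G - A) + c' • ((G - G') - (A - B)) := by module

lemma comb_est {A B G G' : Euc m} {c c' x M N L C : ℝ} (hc : c' ∈ Icc (0:ℝ) 1) (h1 : |c - c'| ≤ M * x)
    (h2 : ‖A - B‖ ≤ L * x) (h3 : ‖G - G'‖ ≤ N * x) (h4 : ‖G - A‖ ≤ C) (hM : 0 ≤ M * x) :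
    ‖A + c • (G - A) - (B + c' • (G' - B))‖ ≤ (L + M * C + (N + L)) * x := by
  rw [comb_id]
  have h5 : ‖(c - c') • (G - A)‖ ≤ M * x * C := by
    rw [norm_smul, Real.norm_eq_abs]
    exact mul_le_mul h1 h4 (norm_nonneg _) hM
  have h6 : ‖c' • ((G - G') - (A - B))‖ ≤ N * x + L * x := by
    rw [norm_smul, Real.norm_of_nonneg hc.1]
    exact (mul_le_of_le_one_left (norm_nonneg _) hc.2).trans ((norm_sub_le _ _).trans (add_le_add h3 h2))
  refine (norm_add_le _ _).trans ((add_le_add ((norm_add_le _ _).trans (add_le_add h2 h5)) h6).trans (le_of_eq ?_))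
  ring

lemma k0_build {U : Set (Euc m)} (Uv : Convex ℝ U) {η : ℝ → ℝ} (hη : IsKplus η) {K : ℝ → Euc p → Euc m}
    (KU : ∀ t φv, K t φv ∈ U) (K0 : ∀ t : ℝ, 0 ≤ t → K t 0 = 0)
    (Kc : ContinuousOn (fun pr : ℝ × Euc p => K pr.1 pr.2) {pr : ℝ × Euc p | 0 ≤ pr.1 ∧ ‖pr.2‖ < 4 * η pr.1})
    (Kl : ∀ S : Set (ℝ × Euc p), IsCompact S → S ⊆ {pr : ℝ × Euc p | 0 ≤ pr.1 ∧ ‖pr.2‖ < 4 * η pr.1} →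
      ∃ L, ∀ t φ₁ φ₂, (t, φ₁) ∈ S → (t, φ₂) ∈ S → ‖K t φ₁ - K t φ₂‖ ≤ L * ‖φ₁ - φ₂‖)
    {g : ℝ × Euc p → Euc m} (gU : ∀ z, g z ∈ U) (gs : ContDiff ℝ 1 g) :
    ∃ k : ℝ → Euc p → Euc m, (∀ t φ, k t φ ∈ U) ∧ ContinuousOn (fun z : ℝ × Euc p => k z.1 z.2) (Ici 0 ×ˢ univ) ∧
      (∀ T, 0 ≤ T → ∀ R, 0 ≤ R → ∃ L, ∀ t ∈ Icc (0:ℝ) T, ∀ a b : Euc p, ‖a‖ ≤ R → ‖b‖ ≤ R →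
        ‖k t a - k t b‖ ≤ L * ‖a - b‖) ∧ (∀ t, 0 ≤ t → k t 0 = 0) ∧
      (∀ t, 0 ≤ t → ∀ φ, ‖φ‖ ≤ η t → k t φ = K t φ) ∧
      (∀ t, 0 ≤ t → ∀ φ, ∀ S : Set (Euc m), Convex ℝ S → g (t, φ) ∈ S → (‖φ‖ ≤ 2 * η t → K t φ ∈ S) → k t φ ∈ S) := by
  set κ : ℝ → Euc p → Euc m := fun t φ => K t (rad (2 * η t) φ) with hκ
  have comb : ∀ t φ, (1 - cut (η t) φ) • κ t φ + cut (η t) φ • g (t, φ) = κ t φ + cut (η t) φ • (g (t, φ) - κ t φ) := by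
    intro t φ; module
  have mapA : ∀ z ∈ (Ici 0 ×ˢ univ : Set (ℝ × Euc p)), ‖rad (2 * η z.1) z.2‖ < 4 * η z.1 := by
    intro z hz
    have := hη.2 z.1 hz.1
    exact lt_of_le_of_lt (rad_norm (by linarith) _) (by linarith)
  have ηc : ContinuousOn (fun z : ℝ × Euc p => η z.1) (Ici 0 ×ˢ univ) := hη.1.comp continuousOn_fst (fun z hz => hz.1)
  have κc : ContinuousOn (fun z : ℝ × Euc p => κ z.1 z.2) (Ici 0 ×ˢ univ) := by
    refine Kc.comp (f := fun z : ℝ × Euc p => (z.1, rad (2 * η z.1) z.2)) ?_ (fun z hz => ⟨hz.1, mapA z hz⟩)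
    refine continuousOn_fst.prodMk ?_
    unfold rad
    refine ContinuousOn.smul (ContinuousOn.div (continuousOn_const.mul ηc) ?_ ?_) continuousOn_snd
    · exact ContinuousOn.sup' (continuousOn_const.mul ηc) continuousOn_snd.norm
    · intro z hz
      have := hη.2 z.1 hz.1
      exact (lt_max_of_lt_left (by linarith)).ne'
  refine ⟨fun t φ => (1 - cut (η t) φ) • κ t φ + cut (η t) φ • g (t, φ), ?_, ?_, ?_, ?_, ?_, ?_⟩
  · intro t φ
    have := cut_mem (η t) φ
    exact Uv (KU _ _) (gU _) (by linarith [this.2]) this.1 (by ring)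
  · have cc : ContinuousOn (fun z : ℝ × Euc p => cut (η z.1) z.2) (Ici 0 ×ˢ univ) := by
      unfold cut
      refine (by fun_prop : Continuous fun w : ℝ => min 1 (max 0 (w - 1))).comp_continuousOn ?_
      exact continuousOn_snd.norm.div ηc (fun z hz => (hη.2 z.1 hz.1).ne')
    exact ((continuousOn_const.sub cc).smul κc).add (cc.smul gs.continuous.continuousOn)
  · intro T hT R hR
    obtain ⟨mη, mη0, hmη⟩ := hη.min T
    set S : Set (ℝ × Euc p) := (fun z : ℝ × Euc p => (z.1, (2 * η z.1) • z.2)) '' (Icc 0 T ×ˢ Metric.closedBall 0 1) with hS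
    have Sc : IsCompact S := by
      refine (isCompact_Icc.prod (isCompact_closedBall _ _)).image_of_continuousOn ?_
      refine continuousOn_fst.prodMk ((continuousOn_const.mul (ηc.mono ?_)).smul continuousOn_snd)
      exact fun z hz => ⟨hz.1.1, mem_univ _⟩
    have SA : S ⊆ {pr : ℝ × Euc p | 0 ≤ pr.1 ∧ ‖pr.2‖ < 4 * η pr.1} := by
      rintro _ ⟨z, hz, rfl⟩
      have h0 := hη.2 z.1 hz.1.1
      refine ⟨hz.1.1, ?_⟩
      have h1 : ‖z.2‖ ≤ 1 := by simpa using hz.2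
      simp only [norm_smul, Real.norm_eq_abs]
      rw [abs_of_pos (by linarith)]
      nlinarith [norm_nonneg z.2]
    have memS : ∀ t ∈ Icc 0 T, ∀ φ, (t, rad (2 * η t) φ) ∈ S := by
      intro t ht φ
      have h0 := hη.2 t ht.1
      refine ⟨(t, (2 * η t)⁻¹ • rad (2 * η t) φ), ⟨ht, ?_⟩, ?_⟩
      · rw [mem_closedBall_zero_iff, norm_smul, norm_inv, Real.norm_of_nonneg (by linarith), inv_mul_le_one₀ (by linarith)]
        exact rad_norm (by linarith) _
      · simp only
        rw [smul_inv_smul₀ (by linarith)]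
    obtain ⟨L, hL⟩ := Kl S Sc SA
    obtain ⟨B, hB⟩ := Sc.exists_bound_of_continuousOn (Kc.mono SA)
    have cb : IsCompact (Icc 0 T ×ˢ Metric.closedBall (0 : Euc p) R) := isCompact_Icc.prod (isCompact_closedBall _ _)
    obtain ⟨Lg, hLg⟩ := gs.contDiffOn.exists_lipschitzOnWith (s := Icc 0 T ×ˢ Metric.closedBall (0 : Euc p) R) one_ne_zero
      ((convex_Icc _ _).prod (convex_closedBall _ _)) cb
    obtain ⟨Bg, hBg⟩ := cb.exists_bound_of_continuousOn gs.continuous.continuousOn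
    refine ⟨2 * |L| + mη⁻¹ * (Bg + B) + (Lg + 2 * |L|), fun t ht a b ha hb => ?_⟩
    simp only [comb]
    have hκl : ‖κ t a - κ t b‖ ≤ 2 * |L| * ‖a - b‖ := by
      refine (hL t _ _ (memS t ht a) (memS t ht b)).trans ?_
      have h1 := rad_lip (R := 2 * η t) (by linarith [hη.2 t ht.1]) a b
      calc _ ≤ |L| * (2 * ‖a - b‖) := mul_le_mul (le_abs_self _) h1 (norm_nonneg _) (abs_nonneg _)
        _ = _ := by ring
    have hma : (t, a) ∈ Icc 0 T ×ˢ Metric.closedBall (0 : Euc p) R := ⟨ht, by simpa using ha⟩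
    have hmb : (t, b) ∈ Icc 0 T ×ˢ Metric.closedBall (0 : Euc p) R := ⟨ht, by simpa using hb⟩
    have hgl : ‖g (t, a) - g (t, b)‖ ≤ Lg * ‖a - b‖ := by
      have := hLg.dist_le_mul _ hma _ hmb
      simpa [dist_eq_norm] using this
    have hga : ‖g (t, a) - κ t a‖ ≤ Bg + B := (norm_sub_le _ _).trans (add_le_add (hBg _ hma) (hB (t, _) (memS t ht a)))
    exact comb_est (cut_mem (η t) b) (cut_lip mη0 (hmη t ht) a b) hκl hgl hga (by positivity)
  · intro t ht
    have : cut (η t) (0 : Euc p) = 0 := by simp [cut]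
    simp only [this, hκ, rad, smul_zero, K0 t ht, zero_smul, add_zero]
  · intro t ht φ hφ
    have h0 := hη.2 t ht
    have : cut (η t) φ = 0 := by
      rw [cut, max_eq_left (by rw [sub_nonpos]; exact (div_le_one h0).2 hφ)]; simp
    simp only [this, sub_zero, one_smul, zero_smul, add_zero, hκ]
    rw [rad_eq (by linarith) (by linarith)]
  · intro t ht φ S Sv hg hK
    have h0 := hη.2 t ht
    have hc := cut_mem (η t) φ
    by_cases h : ‖φ‖ ≤ 2 * η t
    · refine Sv ?_ hg (by linarith [hc.2]) hc.1 (by ring)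
      simp only [hκ]; rw [rad_eq (by linarith) h]; exact hK h
    · push Not at h
      have : cut (η t) φ = 1 := by
        rw [cut, min_eq_left]
        refine le_max_of_le_right ?_
        rw [le_sub_iff_add_le, le_div_iff₀ h0]; linarith
      simpa only [this, sub_self, zero_smul, one_smul, zero_add] using hg

lemma sel_exists {U : Set (Euc m)} (hU : U.Nonempty) {Ψ : ℝ → Euc p → Euc m → EReal} {e : ℝ → ℝ} (ec : Continuous e)
    (e0 : ∀ t, 0 < e t)
    (husc : ∀ u ∈ U, UpperSemicontinuousOn (fun pr : ℝ × Euc p => Ψ pr.1 pr.2 u) (Ici 0 ×ˢ univ))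
    (hinf : ∀ t : ℝ, 0 ≤ t → ∀ φv : Euc p, (⨅ u : U, Ψ t φv u.1) ≤ (((0:ℝ) : ℝ) : EReal)) :
    ∃ g : ℝ × Euc p → Euc m, ContDiff ℝ 1 g ∧
      ∀ z, g z ∈ convexHull ℝ {u ∈ U | 0 ≤ z.1 → Ψ z.1 z.2 u < (e z.1 : EReal)} := by
  obtain ⟨g, hg⟩ := exists_contMDiffMap_forall_mem_convex_of_local_const (n := 1) (modelWithCornersSelf ℝ (ℝ × Euc p))
    (t := fun z : ℝ × Euc p => convexHull ℝ {u ∈ U | 0 ≤ z.1 → Ψ z.1 z.2 u < (e z.1 : EReal)})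
    (fun z => convex_convexHull _ _) (by
      intro z
      rcases lt_or_ge z.1 0 with hz | hz
      · obtain ⟨u, hu⟩ := hU
        refine ⟨u, ?_⟩
        filter_upwards [continuous_fst.continuousAt.eventually_lt continuousAt_const hz] with w hw
        exact subset_convexHull _ _ ⟨hu, fun h => absurd h (not_le.2 hw)⟩
      · have h1 : (⨅ u : U, Ψ z.1 z.2 u.1) < ((e z.1 / 2 : ℝ) : EReal) :=
          lt_of_le_of_lt (hinf z.1 hz z.2) (EReal.coe_lt_coe_iff.2 (by linarith [e0 z.1]))
        rw [iInf_lt_iff] at h1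
        obtain ⟨⟨u, hu⟩, h1⟩ := h1
        refine ⟨u, ?_⟩
        have h2 := husc u hu z ⟨hz, mem_univ _⟩ _ h1
        rw [eventually_nhdsWithin_iff] at h2
        have h3 : ∀ᶠ w : ℝ × Euc p in 𝓝 z, e z.1 / 2 < e w.1 :=
          ContinuousAt.eventually_lt continuousAt_const (ec.comp continuous_fst).continuousAt
            (show e z.1 / 2 < e z.1 by have := e0 z.1; linarith)
        filter_upwards [h2, h3] with w hw hw'
        refine subset_convexHull _ _ ⟨hu, fun h => (hw ⟨h, mem_univ _⟩).trans (EReal.coe_lt_coe_iff.2 hw')⟩)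
  exact ⟨g, g.contMDiff.contDiff, hg⟩

end ctrl


section ab
variable {n l m p : ℕ} {r : ℝ}

lemma e_exists {V : ℝ → Hist n r → ℝ} {Φ : ℝ → Hist n r → Euc p} {a₁ μ ρ η : ℝ → ℝ} (k1 : IsKinf a₁) (km : IsKplus μ)
    (kη : IsKplus η) (hρ : IsPosDef ρ) (low : ∀ t, 0 ≤ t → ∀ x, a₁ (μ t * ‖x‖) ≤ V t x)
    (Φl : ∀ T, 0 ≤ T → ∀ R, 0 ≤ R → ∃ L, ∀ t ∈ Icc (0:ℝ) T, ∀ x y : Hist n r,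
      ‖x‖ ≤ R → ‖y‖ ≤ R → ‖Φ t x - Φ t y‖ ≤ L * ‖x - y‖)
    (Φ0 : ∀ t : ℝ, 0 ≤ t → Φ t 0 = 0) :
    ∃ e : ℝ → ℝ, Continuous e ∧ (∀ t, 0 < e t) ∧ ∀ t, 0 ≤ t → e t ≤ Real.exp (-t) ∧
      ∀ x, η t ≤ ‖Φ t x‖ → V t x ≤ 2 → e t ≤ ρ (V t x) / 2 := by
  have key : ∀ N : ℕ, ∃ b, 0 < b ∧ ∀ t ∈ Icc (0:ℝ) (N + 1), b ≤ Real.exp (-t) ∧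
      ∀ x, η t ≤ ‖Φ t x‖ → V t x ≤ 2 → b ≤ ρ (V t x) / 2 := by
    intro N
    obtain ⟨mμ, mμ0, hμ⟩ := km.min (N + 1)
    obtain ⟨mη, mη0, hη⟩ := kη.min (N + 1)
    obtain ⟨M, M0, hM⟩ := k1.bnd 2
    obtain ⟨L, hL⟩ := Φl (N + 1) (by positivity) (M / mμ) (by positivity)
    set δ := mη / (|L| + 1) with hδ
    have δ0 : 0 < δ := by positivity
    set b0 := a₁ (mμ * δ) with hb0
    have b00 : 0 < b0 := k1.pos (by positivity)
    obtain ⟨w, hw, hmin⟩ := (isCompact_Icc (a := b0) (b := max b0 2)).exists_isMinOn ⟨b0, le_rfl, le_max_left _ _⟩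
      (hρ.1.mono (fun t ht => b00.le.trans ht.1))
    have w0 : 0 < ρ w := hρ.2.2.1 w (by linarith [hw.1])
    refine ⟨min (Real.exp (-(N + 1))) (ρ w / 2), lt_min (Real.exp_pos _) (by positivity), fun t ht => ⟨?_, fun x hx hV => ?_⟩⟩
    · exact (min_le_left _ _).trans (Real.exp_le_exp.2 (by linarith [ht.2]))
    · refine (min_le_right _ _).trans ?_
      have h1 := hM (μ t * ‖x‖) (mul_nonneg (km.2 t ht.1).le (norm_nonneg _)) ((low t ht.1 x).trans hV)
      have h2 : mμ * ‖x‖ ≤ μ t * ‖x‖ := mul_le_mul_of_nonneg_right (hμ t ht) (norm_nonneg x)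
      have h3 : ‖x‖ ≤ M / mμ := by rw [le_div_iff₀ mμ0]; linarith
      have h4 := hL t ht x 0 h3 (by rw [norm_zero]; positivity)
      rw [Φ0 t ht.1, sub_zero, sub_zero] at h4
      have h5 : δ ≤ ‖x‖ := by
        rw [hδ, div_le_iff₀ (by positivity)]
        have := hη t ht
        have := mul_le_mul_of_nonneg_right (le_abs_self L) (norm_nonneg x)
        nlinarith [norm_nonneg x]
      have h6 : b0 ≤ V t x := by
        refine le_trans ?_ (low t ht.1 x)
        refine k1.2.1.monotoneOn (mem_Ici.2 (by positivity)) (mem_Ici.2 ?_) ?_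
        · exact mul_nonneg (km.2 t ht.1).le (norm_nonneg _)
        · exact (mul_le_mul_of_nonneg_left h5 mμ0.le).trans h2
      have := hmin (a := V t x) ⟨h6, hV.trans (le_max_right _ _)⟩
      have : ρ w ≤ ρ (V t x) := this
      linarith
  choose b b0 hb using key
  obtain ⟨e, -, ec, e0, he⟩ := minorant b b0
  refine ⟨e, ec, e0, fun t ht => ?_⟩
  have h := hb ⌊t⌋₊ t ⟨ht, (Nat.lt_floor_add_one t).le⟩
  exact ⟨(he t ht).trans h.1, fun x h1 h2 => (he t ht).trans (h.2 x h1 h2)⟩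

theorem a_to_b {Y : Type*} [NormedAddCommGroup Y] [NormedSpace ℝ Y] {D : Set (Euc l)} {U : Set (Euc m)}
    {f : ℝ → Euc l → Hist n r → Euc m → Euc n} {H : ℝ → Hist n r → Y} (hr : 0 < r) (hS : HypS r hr D U f H)
    (h : Thm410a r D U f H) : Thm410b r D U f H := by
  have hS' := hS
  obtain ⟨f0, H0, f1, -, f2, -, f4, -, Dc, Dn, Uc, Uv, U0, H7⟩ := hS'
  obtain ⟨V, a₁, a₂, μ, p, Ψ, Φ, ρ, a, γ, η, K, ⟨al, Vn, k1, k2, -, km, hV, -, hρ, Ψb, Ψ0, husc, Φc, Φl, Φ0, hinf, hdec⟩, -, kη, KU, K0,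
    Kc, Kl, hK⟩ := h
  obtain ⟨e, ec, e0, he⟩ := e_exists k1 km kη hρ (fun t ht x => (le_max_right _ _).trans (hV t ht x).1) Φl Φ0
  obtain ⟨g, gs, hg⟩ := sel_exists ⟨0, U0⟩ ec e0 husc hinf
  have gU : ∀ z, g z ∈ U := fun z => convexHull_min (fun u hu => hu.1) Uv (hg z)
  obtain ⟨k0, k0U, k0c, k0l, k00, k0K, k0S⟩ := k0_build Uv kη KU K0 Kc Kl gU gs
  have hk : GoodFeedback r U (fun t x => k0 t (Φ t x)) := by
    refine ⟨fun t x => k0U _ _, ?_, ?_, fun t ht => by simp only [Φ0 t ht, k00 t ht]⟩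
    · exact k0c.comp (f := fun z : ℝ × Hist n r => (z.1, Φ z.1 z.2)) (continuousOn_fst.prodMk Φc) (fun z hz => ⟨hz.1, mem_univ _⟩)
    · intro T hT R hR
      obtain ⟨L, hL⟩ := Φl T hT R hR
      obtain ⟨L', hL'⟩ := k0l T hT (|L| * R) (by positivity)
      have Φb : ∀ t ∈ Icc (0:ℝ) T, ∀ x : Hist n r, ‖x‖ ≤ R → ‖Φ t x‖ ≤ |L| * R := by
        intro t ht x hx
        have := hL t ht x 0 hx (by rw [norm_zero]; exact hR)
        rw [Φ0 t ht.1, sub_zero, sub_zero] at this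
        exact this.trans (mul_le_mul (le_abs_self _) hx (norm_nonneg _) (abs_nonneg _))
      refine ⟨|L'| * |L|, fun t ht x y hx hy => ?_⟩
      refine (hL' t ht _ _ (Φb t ht x hx) (Φb t ht y hy)).trans ?_
      rw [mul_assoc]
      refine mul_le_mul (le_abs_self _) ?_ (norm_nonneg _) (abs_nonneg _)
      exact (hL t ht x y hx hy).trans (mul_le_mul_of_nonneg_right (le_abs_self _) (norm_nonneg _))
  refine ⟨_, hk, ?_⟩
  have hF := goodF_of hS hk
  have conv : ∀ t, 0 ≤ t → ∀ x : Hist n r, ∀ d ∈ D, ∀ c : ℝ, ∀ u ∈ convexHull ℝ {u ∈ U | Ψ t (Φ t x) u ≤ (c : EReal)},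
      diniH V t x (f t d x u) ≤ ((-ρ (V t x) + c : ℝ) : EReal) := by
    intro t ht x d hd c u hu
    obtain ⟨ι, _, w, z, w0, w1, hz, rfl⟩ := mem_convexHull_iff_exists_fintype.1 hu
    set eq := Fintype.equivFin ι
    have := hdec t ht x (Fintype.card ι) (fun i => z (eq.symm i)) (fun i => (hz _).1) (fun i => w (eq.symm i))
      (fun i => w0 _) (by rw [← w1]; exact eq.symm.sum_comp w) d hd
    rw [eq.symm.sum_comp (fun i => w i • z i)] at this
    refine this.trans ?_
    rw [EReal.coe_add]
    gcongr
    exact iSup_le fun i => (hz _).2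
  refine Lyp.urgaos (V := V) (a₁ := a₁) (a₂ := a₂) (μ := μ) (σ := fun s => ρ s / 2) ?_ hF
  refine ⟨al, Vn, k1, k2, km, fun t ht x => (le_max_left _ _).trans (hV t ht x).1,
    fun t ht x => (le_max_right _ _).trans (hV t ht x).1, fun t ht x => by simpa using (hV t ht x).2, ?_, ?_⟩
  · refine ⟨hρ.1.div_const _, by simp [hρ.2.1], fun s hs => by have := hρ.2.2.1 s hs; positivity,
      fun s hs => by have := hρ.2.2.2 s hs; positivity⟩
  · intro t ht x d hd
    have hm : 0 ≤ Real.exp (-t) * min 1 (max (V t x - 1) 0) :=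
      mul_nonneg (Real.exp_pos _).le (le_min zero_le_one (le_max_right _ _))
    have hρ0 := hρ.2.2.2 _ (Vn t x)
    rcases le_total ‖Φ t x‖ (η t) with hφ | hφ
    · have h0 := kη.2 t ht
      refine (conv t ht x d hd 0 _ (subset_convexHull _ _ ⟨k0U _ _, ?_⟩)).trans ?_
      · rw [k0K t ht _ hφ]; exact hK t ht x (by linarith)
      · rw [EReal.coe_le_coe_iff]; unfold gg; linarith
    · refine (conv t ht x d hd (e t) _ ?_).trans ?_
      · refine k0S t ht _ _ (convex_convexHull _ _) ?_ (fun h2 => ?_)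
        · refine convexHull_mono ?_ (hg (t, Φ t x))
          rintro u ⟨hu, hu'⟩
          exact ⟨hu, (hu' ht).le⟩
        · exact subset_convexHull _ _ ⟨KU _ _, (hK t ht x h2).trans (EReal.coe_nonneg.2 (e0 t).le)⟩
      · rw [EReal.coe_le_coe_iff]; unfold gg
        rcases le_total (V t x) 2 with h2 | h2
        · linarith [(he t ht).2 x hφ h2]
        · have : min 1 (max (V t x - 1) 0) = 1 := min_eq_left (le_max_of_le_left (by linarith))
          rw [this]; linarith [(he t ht).1]

end ab


/-- flow together with a scalar output having uniform stability properties -/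
structure Flw {n l : ℕ} (r : ℝ) (D : Set (Euc l)) (F : ℝ → Euc l → Hist n r → Euc n)
    (z : ℝ → Hist n r → (ℝ → Euc l) → C(ℝ, Euc n)) (h : ℝ → Hist n r → ℝ) : Prop where
  init : ∀ t, 0 ≤ t → ∀ x d, InMD D d → hst r (z t x d) t = x
  sol : ∀ t, 0 ≤ t → ∀ x d, InMD D d → ∀ T, Sol F d t T (z t x d)
  rfc : ∀ T, 0 ≤ T → ∃ M, 0 ≤ M ∧ ∀ t s, 0 ≤ t → t ≤ s → s ≤ T → ∀ x, ‖x‖ ≤ T → ∀ d, InMD D d → ‖hst r (z t x d) s‖ ≤ M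
  nn : ∀ t x, 0 ≤ h t x
  h1 : ∀ R, 0 ≤ R → ∃ B, 0 ≤ B ∧ ∀ t s, 0 ≤ t → t ≤ s → ∀ x, ‖x‖ ≤ R → ∀ d, InMD D d → h s (hst r (z t x d) s) ≤ B
  h2 : ∀ ε, 0 < ε → ∃ δ, 0 < δ ∧ ∀ t s, 0 ≤ t → t ≤ s → ∀ x, ‖x‖ ≤ δ → ∀ d, InMD D d → h s (hst r (z t x d) s) ≤ ε
  h3 : ∀ ε, 0 < ε → ∀ R, 0 ≤ R → ∃ T, 0 ≤ T ∧ ∀ t s, 0 ≤ t → t + T ≤ s → ∀ x, ‖x‖ ≤ R → ∀ d, InMD D d →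
    h s (hst r (z t x d) s) ≤ ε
  h4 : ∀ T, 0 ≤ T → ∀ R, 0 ≤ R → ∃ L, 0 ≤ L ∧ ∀ t ∈ Icc 0 T, ∀ s ∈ Icc 0 T, ∀ x y, ‖x‖ ≤ R → ‖y‖ ≤ R →
    h t x ≤ h s y + L * (|t - s| + ‖x - y‖)

section flow
variable {n l : ℕ} {r : ℝ} {hr : 0 < r} {D : Set (Euc l)} {F : ℝ → Euc l → Hist n r → Euc n}
  {Y : Type*} [NormedAddCommGroup Y] [NormedSpace ℝ Y] {H : ℝ → Hist n r → Y}

lemma flow_exists (hF : GoodF r hr D F) (h : URGAOSrfde r D F H)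
    (H7 : ∀ T, 0 ≤ T → ∀ R, 0 ≤ R → ∃ LH, 0 ≤ LH ∧ ∀ t ∈ Icc (0:ℝ) T, ∀ τ ∈ Icc (0:ℝ) T,
      ∀ x y : Hist n r, ‖x‖ ≤ R → ‖y‖ ≤ R → ‖H t x - H τ y‖ ≤ LH * (|t - τ| + ‖x - y‖)) :
    ∃ z μ, IsKplus μ ∧ Flw r D F z (fun t x => max ‖H t x‖ (μ t * ‖x‖)) := by
  obtain ⟨X, φ, tm, hsol, hrfc, hp1, hp2⟩ := h
  have lt_tm : ∀ t0 : ℝ, 0 ≤ t0 → ∀ t : ℝ, t0 ≤ t → ∀ x0 d, InMD D d → (t : EReal) < tm t0 x0 d := by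
    intro t0 h0 t ht x0 d hd
    obtain ⟨M, hM⟩ := hrfc t (by linarith) ‖x0‖ (norm_nonneg _)
    have := (hM t0 ⟨h0, ht⟩ (t - t0) ⟨by linarith, by linarith⟩ x0 le_rfl d hd).1
    rwa [add_sub_cancel] at this
  have key : ∀ t0 : ℝ, ∀ x0 : Hist n r, ∀ d : ℝ → Euc l, ∃ x : C(ℝ, Euc n), 0 ≤ t0 → InMD D d →
      hst r x t0 = x0 ∧ (∀ T, Sol F d t0 T x) ∧ ∀ s, t0 ≤ s → hst r x s = φ t0 x0 d s := by
    intro t0 x0 d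
    by_cases hc : 0 ≤ t0 ∧ InMD D d
    swap
    · exact ⟨0, fun h1 h2 => absurd ⟨h1, h2⟩ hc⟩
    obtain ⟨h0, hd⟩ := hc
    have hs := (hsol t0 h0 x0 d hd).1
    obtain ⟨x, hx0, hx⟩ := hF.global h0 hd (x0 := x0) (fun T hT => by
      obtain ⟨x, h1, h2, -⟩ := sol_of_isSol hr hs hT (lt_tm t0 h0 T hT x0 d hd)
      exact ⟨x, h1, h2⟩)
    refine ⟨x, fun _ _ => ⟨hx0, hx, fun s hs' => ?_⟩⟩
    obtain ⟨y, h1, h2, h3⟩ := sol_of_isSol hr hs hs' (lt_tm t0 h0 s hs' x0 d hd)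
    rw [← h3 s ⟨hs', le_rfl⟩]
    exact hF.uniq h0 hd (hx s) h2 (hx0.trans h1.symm) s ⟨hs', le_rfl⟩
  choose z hz using key
  have rfc : ∀ T, 0 ≤ T → ∃ M, 0 ≤ M ∧ ∀ t s, 0 ≤ t → t ≤ s → s ≤ T → ∀ x, ‖x‖ ≤ T → ∀ d, InMD D d →
      ‖hst r (z t x d) s‖ ≤ M := by
    intro T hT
    obtain ⟨M, hM⟩ := hrfc T hT T hT
    refine ⟨max M 0, le_max_right _ _, fun t s h0 hts hsT x hx d hd => le_max_of_le_left ?_⟩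
    rw [(hz t x d h0 hd).2.2 s hts]
    have := (hM t ⟨h0, by linarith⟩ (s - t) ⟨by linarith, by linarith⟩ x hx d hd).2
    rwa [add_sub_cancel] at this
  have rfc' : ∀ N : ℕ, _ := fun N => rfc (N + 1) (by positivity)
  choose M M0 hM using rfc'
  obtain ⟨μ, μl, μc, μ0, hμ⟩ := minorant (fun N => Real.exp (-(N + 1)) / (1 + M N)) (fun N => by have := M0 N; positivity)
  have μz : ∀ t s, 0 ≤ t → t ≤ s → ∀ x, ‖x‖ ≤ s → ∀ d, InMD D d → μ s * ‖hst r (z t x d) s‖ ≤ Real.exp (-s) := by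
    intro t s h0 hts x hx d hd
    have hs1 := (Nat.lt_floor_add_one s).le
    have h1 := hM ⌊s⌋₊ t s h0 hts hs1 x (hx.trans hs1) d hd
    have h2 := hμ s (h0.trans hts)
    have h3 := M0 ⌊s⌋₊
    calc _ ≤ Real.exp (-(⌊s⌋₊ + 1)) / (1 + M ⌊s⌋₊) * (1 + M ⌊s⌋₊) :=
          mul_le_mul h2 (by linarith) (norm_nonneg _) (by positivity)
      _ = Real.exp (-(⌊s⌋₊ + 1)) := div_mul_cancel₀ _ (by positivity)
      _ ≤ _ := Real.exp_le_exp.2 (by linarith)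
  have μ1 : ∀ t, 0 ≤ t → μ t ≤ 1 := by
    intro t ht
    refine (hμ t ht).trans ?_
    have := M0 ⌊t⌋₊
    rw [div_le_one (by positivity)]
    have : Real.exp (-(⌊t⌋₊ + 1)) ≤ 1 := Real.exp_le_one_iff.2 (by have : (0:ℝ) ≤ ⌊t⌋₊ := by positivity
                                                                   linarith)
    linarith
  have exps : ∀ ε : ℝ, 0 < ε → ∀ s, 1 / ε ≤ s → Real.exp (-s) ≤ ε := by
    intro ε hε s hs
    rw [Real.exp_neg, inv_le_comm₀ (Real.exp_pos _) hε, inv_eq_one_div]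
    exact hs.trans (by linarith [Real.add_one_le_exp s])
  refine ⟨z, μ, ⟨μc.continuousOn, fun t _ => μ0 t⟩, fun t ht x d hd => (hz t x d ht hd).1, fun t ht x d hd => (hz t x d ht hd).2.1, rfc,
    fun t x => le_max_of_le_left (norm_nonneg _), ?_, ?_, ?_, ?_⟩
  · intro R hR
    obtain ⟨B, hB⟩ := (hp1 (R + 1) (by linarith)).1
    obtain ⟨M, M0, hM⟩ := rfc R hR
    refine ⟨max B (max M 1), by positivity, fun t s h0 hts x hx d hd => max_le (le_max_of_le_left ?_) (le_max_of_le_right ?_)⟩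
    · rw [(hz t x d h0 hd).2.2 s hts]
      exact hB t h0 x (by linarith) d hd s hts (lt_tm t h0 s hts x d hd)
    · rcases le_total R s with h | h
      · exact ((μz t s h0 hts x (hx.trans h) d hd).trans (Real.exp_le_one_iff.2 (by linarith))).trans (le_max_right _ _)
      · refine le_trans ?_ (le_max_left _ _)
        exact (mul_le_of_le_one_left (norm_nonneg _) (μ1 s (h0.trans hts))).trans (hM t s h0 hts h x hx d hd)
  · intro ε hε
    obtain ⟨δ, δ0, hδ⟩ := (hp1 ε hε).2
    set T := max (1 / ε) 1 with hT
    have T1 : 1 ≤ T := le_max_right _ _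
    obtain ⟨M, M0, hM⟩ := rfc T (by linarith)
    obtain ⟨K, K0, hK⟩ := hF.dep (max M T) (le_max_of_le_left M0)
    refine ⟨min δ (min 1 (ε / (K + 1))), lt_min δ0 (lt_min one_pos (by positivity)), fun t s h0 hts x hx d hd => max_le ?_ ?_⟩
    · rw [(hz t x d h0 hd).2.2 s hts]
      exact hδ t h0 x (hx.trans (min_le_left _ _)) d hd s hts (lt_tm t h0 s hts x d hd)
    · have hx1 : ‖x‖ ≤ 1 := hx.trans ((min_le_right _ _).trans (min_le_left _ _))
      have hx2 : ‖x‖ ≤ ε / (K + 1) := hx.trans ((min_le_right _ _).trans (min_le_right _ _))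
      rcases le_total T s with h | h
      · exact (μz t s h0 hts x (hx1.trans (T1.trans h)) d hd).trans (exps ε hε s ((le_max_left _ _).trans h))
      · have zs : Sol F d t s (0 : C(ℝ, Euc n)) := by
          intro u hu
          have : ∀ v, hst r (0 : C(ℝ, Euc n)) v = 0 := fun v => rfl
          simp only [this]
          rw [intervalIntegral.integral_congr (g := fun _ => 0) (fun v hv => by
            rw [uIcc_of_le hu.1] at hv
            simp only [hF.zero v (h0.trans hv.1) _ (hd.2 v)])]
          simp
        have := hK t s h0 hts (h.trans (le_max_right _ _)) d hd _ _ ((hz t x d h0 hd).2.1 s) zs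
          (fun u hu => (hM t u h0 hu.1 (hu.2.trans h) x (hx1.trans T1) d hd).trans (le_max_left _ _))
          (fun u hu => by
            have : hst r (0 : C(ℝ, Euc n)) u = 0 := rfl
            rw [this, norm_zero]; exact le_max_of_le_left M0) s ⟨hts, le_rfl⟩
        rw [(hz t x d h0 hd).1] at this
        have e : ∀ v, hst r (0 : C(ℝ, Euc n)) v = 0 := fun v => rfl
        rw [e, e, sub_zero, sub_zero] at this
        refine (mul_le_of_le_one_left (norm_nonneg _) (μ1 s (h0.trans hts))).trans (this.trans ?_)
        rw [le_div_iff₀ (by positivity)] at hx2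
        nlinarith [norm_nonneg x]
  · intro ε hε R hR
    obtain ⟨τ, τ0, hτ⟩ := hp2 ε hε R hR
    refine ⟨max τ (max (1 / ε) R), le_max_of_le_left τ0, fun t s h0 hts x hx d hd => ?_⟩
    have h5 := le_max_left τ (max (1 / ε) R)
    have h6 := (le_max_left (1 / ε) R).trans (le_max_right τ _)
    have h7 := (le_max_right (1 / ε) R).trans (le_max_right τ _)
    have hts' : t ≤ s := by linarith
    refine max_le ?_ ?_
    · rw [(hz t x d h0 hd).2.2 s hts']
      exact hτ t h0 x hx d hd s (by linarith) (lt_tm t h0 s hts' x d hd)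
    · exact (μz t s h0 hts' x (by linarith) d hd).trans (exps ε hε s (by linarith))
  · intro T hT R hR
    obtain ⟨L, L0, hL⟩ := H7 T hT R hR
    refine ⟨L + R + 1, by positivity, fun t ht s hs x y hx hy => max_le ?_ ?_⟩
    · have h1 := norm_le_norm_add_norm_sub' (H t x) (H s y)
      have h2 := hL t ht s hs x y hx hy
      have h3 : L * (|t - s| + ‖x - y‖) ≤ (L + R + 1) * (|t - s| + ‖x - y‖) := by gcongr; linarith
      have := le_max_left ‖H s y‖ (μ s * ‖y‖)
      linarith
    · have h1 := norm_le_norm_add_norm_sub' x y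
      have h2 := (abs_le.1 (μl t s)).2
      have h3 := le_max_right ‖H s y‖ (μ s * ‖y‖)
      have h4 := μ1 t ht.1
      have h5 := μ0 t
      have h6 : μ t * ‖x‖ ≤ μ t * ‖y‖ + ‖x - y‖ := by nlinarith [norm_nonneg (x - y)]
      have h7 : μ t * ‖y‖ ≤ μ s * ‖y‖ + |t - s| * R := by
        have : (μ t - μ s) * ‖y‖ ≤ |t - s| * R := mul_le_mul h2 hy (norm_nonneg _) (abs_nonneg _)
        linarith
      nlinarith [mul_nonneg L0 (abs_nonneg (t - s)), mul_nonneg L0 (norm_nonneg (x - y)), mul_nonneg hR (norm_nonneg (x - y)), abs_nonneg (t - s)]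

end flow


def trm {n l : ℕ} {r : ℝ} (z : ℝ → Hist n r → (ℝ → Euc l) → C(ℝ, Euc n)) (h : ℝ → Hist n r → ℝ)
    (q : ℕ) (t : ℝ) (x : Hist n r) (τ : ℝ) (d : ℝ → Euc l) : ℝ :=
  max 0 (h (t + τ) (hst r (z t x d) (t + τ)) - 1 / (q + 1)) * Real.exp τ

lemma max_step {a b c p : ℝ} (h : a ≤ b + c) (hc : 0 ≤ c) : max 0 (a - p) ≤ max 0 (b - p) + c :=
  max_le (by positivity) (by linarith [le_max_right 0 (b - p)])

section lvl
variable {n l : ℕ} {r : ℝ} {hr : 0 < r} {D : Set (Euc l)} {F : ℝ → Euc l → Hist n r → Euc n}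
  {z : ℝ → Hist n r → (ℝ → Euc l) → C(ℝ, Euc n)} {h : ℝ → Hist n r → ℝ}

lemma trm_nn (q : ℕ) (t : ℝ) (x : Hist n r) (τ : ℝ) (d : ℝ → Euc l) : 0 ≤ trm z h q t x τ d :=
  mul_nonneg (le_max_left _ _) (Real.exp_pos _).le

lemma trm_zero {q : ℕ} {t : ℝ} {x : Hist n r} {τ : ℝ} {d : ℝ → Euc l}
    (hh : h (t + τ) (hst r (z t x d) (t + τ)) ≤ 1 / (q + 1)) : trm z h q t x τ d = 0 := by
  rw [trm, max_eq_left (by linarith), zero_mul]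

lemma lvl (hF : GoodF r hr D F) (hz : Flw r D F z h) (q N : ℕ) : ∃ A, 0 ≤ A ∧ ∀ d, InMD D d → ∀ τ, 0 ≤ τ →
    (∀ t, 0 ≤ t → ∀ x, ‖x‖ ≤ N → trm z h q t x τ d ≤ A) ∧
    (∀ t : ℝ, 0 ≤ t → t ≤ N → ∀ x y, ‖x‖ ≤ N → ‖y‖ ≤ N → trm z h q t x τ d ≤ trm z h q t y τ d + A * ‖x - y‖) ∧
    (∀ t : ℝ, 0 ≤ t → t ≤ N → ∀ s, 0 ≤ s → s ≤ 1 → ∀ x M, ‖x‖ ≤ N → 0 ≤ M → HLip x M →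
      trm z h q (t + s) x τ d ≤ trm z h q t x (τ + s) d + A * (s * (1 + M)) ∧
      ∃ τ', 0 ≤ τ' ∧ trm z h q t x τ d ≤ trm z h q (t + s) x τ' d + A * (s * (1 + M))) := by
  have q0 : (0:ℝ) < 1 / (q + 1) := by positivity
  obtain ⟨T, T0, hT⟩ := hz.h3 _ q0 N (Nat.cast_nonneg N)
  have N0 : (0:ℝ) ≤ N := Nat.cast_nonneg N
  set T' : ℝ := N + 1 + T with hTd
  have hT' : 0 ≤ T' := by positivity
  obtain ⟨R, R0, hR⟩ := hz.rfc T' hT'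
  obtain ⟨K, K0, hK⟩ := hF.dep (max R T') (le_max_of_le_left R0)
  obtain ⟨Lh, Lh0, hLh⟩ := hz.h4 T' hT' R R0
  obtain ⟨C, C0, hC⟩ := hF.bdd (max R T') (le_max_of_le_left R0)
  obtain ⟨B, B0, hB⟩ := hz.h1 N N0
  set E := Real.exp T with hE
  have E0 : 0 < E := Real.exp_pos _
  have dif : ∀ d, InMD D d → ∀ t t', 0 ≤ t → t ≤ t' → ∀ x y, ‖x‖ ≤ N → ‖y‖ ≤ N → ∀ u, t' ≤ u → u ≤ T' →
      ‖hst r (z t x d) u - hst r (z t' y d) u‖ ≤ K * ‖hst r (z t x d) t' - y‖ := by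
    intro d hd t t' ht htt x y hx hy u hu huT
    have ht' := ht.trans htt
    have := hK t' T' ht' (hu.trans huT) (le_max_right _ _) d hd _ _ (hF.sol_right hd ht htt (hz.sol t ht x d hd T'))
      (hz.sol t' ht' y d hd T')
      (fun s hs => (hR t s ht (htt.trans hs.1) hs.2 x (by linarith) d hd).trans (le_max_left _ _))
      (fun s hs => (hR t' s ht' hs.1 hs.2 y (by linarith) d hd).trans (le_max_left _ _)) u ⟨hu, huT⟩
    rwa [hz.init t' ht' y d hd] at this
  have shf : ∀ d, InMD D d → ∀ t, 0 ≤ t → ∀ x M, ‖x‖ ≤ N → 0 ≤ M → HLip x M → ∀ u v, t ≤ u → u ≤ v → v ≤ T' →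
      ‖hst r (z t x d) v - hst r (z t x d) u‖ ≤ (M + C) * (v - u) := by
    intro d hd t ht x M hx hM hxM u v hu huv hv
    rw [ContinuousMap.norm_le _ (mul_nonneg (by positivity) (by linarith))]
    intro θ
    have := hF.sol_lip hd ht (hz.sol t ht x d hd T') C0 hM (fun s hs => hC s ⟨ht.trans hs.1, hs.2.trans (le_max_right _ _)⟩
      _ (hd.2 s) _ ((hR t s ht hs.1 hs.2 x (by linarith) d hd).trans (le_max_left _ _)))
      (by rwa [hz.init t ht x d hd]) (u + θ) (v + θ) (by linarith [θ.2.1]) (by linarith) (by linarith [θ.2.2])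
    simpa using this
  have E1 : ∀ d, InMD D d → ∀ τ, 0 ≤ τ → ∀ t, 0 ≤ t → ∀ x, ‖x‖ ≤ N → trm z h q t x τ d ≤ B * E := by
    intro d hd τ hτ t ht x hx
    rcases le_total T τ with hc | hc
    · rw [trm_zero (hT t (t + τ) ht (by linarith) x hx d hd)]; positivity
    · exact mul_le_mul (max_le B0 (by linarith [hB t (t + τ) ht (by linarith) x hx d hd])) (Real.exp_le_exp.2 hc)
        (Real.exp_pos _).le B0
  set A2 := Lh * (1 + (1 + K) * (1 + C)) * E with hA2
  have A20 : 0 ≤ A2 := by positivity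
  refine ⟨A2 + 2 * (B * E), by positivity, fun d hd τ hτ => ⟨fun t ht x hx => ?_, fun t ht htN x y hx hy => ?_,
    fun t ht htN s hs hs1 x M hx hM hxM => ⟨?_, ?_⟩⟩⟩
  · have := E1 d hd τ hτ t ht x hx
    have : 0 ≤ B * E := by positivity
    linarith
  · rcases le_total T τ with hc | hc
    · rw [trm_zero (hT t (t + τ) ht (by linarith) x hx d hd)]
      have := trm_nn (z := z) (h := h) q t y τ d
      positivity
    · have hu : t + τ ≤ T' := by linarith
      have d1 := dif d hd t t ht le_rfl x y hx hy (t + τ) (by linarith) hu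
      rw [hz.init t ht x d hd] at d1
      have d2 := hLh (t + τ) ⟨by linarith, hu⟩ (t + τ) ⟨by linarith, hu⟩ _ _
        (hR t (t + τ) ht (by linarith) hu x (by linarith) d hd) (hR t (t + τ) ht (by linarith) hu y (by linarith) d hd)
      rw [sub_self, abs_zero, zero_add] at d2
      have d3 := max_step (p := 1 / ((q:ℝ) + 1)) (d2.trans (add_le_add_right (mul_le_mul_of_nonneg_left d1 Lh0) _)) (by positivity)
      have d4 : Real.exp τ ≤ E := Real.exp_le_exp.2 hc
      have d5 := mul_le_mul_of_nonneg_right d3 (Real.exp_pos τ).le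
      have d6 : Lh * (K * ‖x - y‖) * Real.exp τ ≤ Lh * (K * ‖x - y‖) * E := mul_le_mul_of_nonneg_left d4 (by positivity)
      have d7 : Lh * (K * ‖x - y‖) * E ≤ (A2 + 2 * (B * E)) * ‖x - y‖ := by
        have : A2 + 2 * (B * E) = Lh * K * E + (Lh * (1 + 1 + (1 + K) * C) * E + 2 * (B * E)) := by rw [hA2]; ring
        rw [this, add_mul]
        have : 0 ≤ (Lh * (1 + 1 + (1 + K) * C) * E + 2 * (B * E)) * ‖x - y‖ := by positivity
        linarith
      rw [trm, trm]
      linarith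
  · rcases le_total T τ with hc | hc
    · rw [trm_zero (hT (t + s) (t + s + τ) (by linarith) (by linarith) x hx d hd)]
      have := trm_nn (z := z) (h := h) q t x (τ + s) d
      positivity
    · have hu : t + s + τ ≤ T' := by linarith
      have d0 := shf d hd t ht x M hx hM hxM t (t + s) le_rfl (by linarith) (by linarith)
      rw [hz.init t ht x d hd, add_sub_cancel_left] at d0
      have d1 := dif d hd t (t + s) ht (by linarith) x x hx hx (t + s + τ) (by linarith) hu
      rw [norm_sub_rev] at d1
      have d2 := hLh (t + s + τ) ⟨by linarith, hu⟩ (t + s + τ) ⟨by linarith, hu⟩ _ _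
        (hR (t + s) (t + s + τ) (by linarith) (by linarith) hu x (by linarith) d hd) (hR t (t + s + τ) ht (by linarith) hu x (by linarith) d hd)
      rw [sub_self, abs_zero, zero_add] at d2
      have d3 := max_step (p := 1 / ((q:ℝ) + 1)) (d2.trans (add_le_add_right (mul_le_mul_of_nonneg_left
        (d1.trans (mul_le_mul_of_nonneg_left d0 K0)) Lh0) _)) (by positivity)
      have d4 : Real.exp τ ≤ E := Real.exp_le_exp.2 hc
      have d4' : Real.exp τ ≤ Real.exp (τ + s) := Real.exp_le_exp.2 (by linarith)
      have d5 := mul_le_mul_of_nonneg_right d3 (Real.exp_pos τ).le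
      have d6 : Lh * (K * ((M + C) * s)) * Real.exp τ ≤ Lh * (K * ((M + C) * s)) * E := mul_le_mul_of_nonneg_left d4 (by positivity)
      have d7 : Lh * (K * ((M + C) * s)) * E ≤ (A2 + 2 * (B * E)) * (s * (1 + M)) := by
        have : 0 ≤ (A2 + 2 * (B * E)) * (s * (1 + M)) - Lh * (K * ((M + C) * s)) * E := by
          have : (A2 + 2 * (B * E)) * (s * (1 + M)) - Lh * (K * ((M + C) * s)) * E =
           (Lh * (K * (1 + C * M) + (1 + (1 + C)) * (1 + M)) * E + 2 * (B * E) * (1 + M)) * s := by rw [hA2]; ring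
          rw [this]; positivity
        linarith
      have d8 := mul_le_mul_of_nonneg_left d4' (le_max_left 0 (h (t + s + τ) (hst r (z t x d) (t + s + τ)) - 1 / ((q:ℝ) + 1)))
      rw [trm, trm, show t + (τ + s) = t + s + τ by ring]
      linarith
  · rcases le_total T τ with hc | hc
    · refine ⟨0, le_rfl, ?_⟩
      rw [trm_zero (hT t (t + τ) ht (by linarith) x hx d hd)]
      have := trm_nn (z := z) (h := h) q (t + s) x 0 d
      positivity
    · set u := t + τ with hu
      set u' := max u (t + s) with hu'
      have u1 : u ≤ u' := le_max_left _ _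
      have u2 : u' ≤ u + s := max_le (by linarith) (by linarith)
      have u3 : t + s ≤ u' := le_max_right _ _
      have u4 : u' ≤ T' := by linarith
      refine ⟨u' - (t + s), by linarith, ?_⟩
      have d0 := shf d hd t ht x M hx hM hxM t (t + s) le_rfl (by linarith) (by linarith)
      rw [hz.init t ht x d hd, add_sub_cancel_left] at d0
      have d1 := dif d hd t (t + s) ht (by linarith) x x hx hx u' u3 u4
      have d1' := shf d hd t ht x M hx hM hxM u u' (by linarith) u1 u4
      rw [norm_sub_rev] at d1'
      have d2 := hLh u ⟨by linarith, by linarith⟩ u' ⟨by linarith, u4⟩ _ _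
        (hR t u ht (by linarith) (by linarith) x (by linarith) d hd) (hR (t + s) u' (by linarith) u3 u4 x (by linarith) d hd)
      have n1 := norm_sub_le_norm_sub_add_norm_sub (hst r (z t x d) u) (hst r (z t x d) u') (hst r (z (t + s) x d) u')
      have m1 : (M + C) * (u' - u) ≤ (M + C) * s := mul_le_mul_of_nonneg_left (by linarith) (by positivity)
      have m2 := mul_le_mul_of_nonneg_left d0 K0
      have a1 : |u - u'| ≤ s := abs_le.2 ⟨by linarith, by linarith⟩
      have d3 := max_step (p := 1 / ((q:ℝ) + 1)) (c := Lh * (s + ((M + C) * s + K * ((M + C) * s))))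
        (d2.trans (add_le_add_right (mul_le_mul_of_nonneg_left (by linarith) Lh0) _)) (by positivity)
      have d4 : Real.exp τ ≤ E := Real.exp_le_exp.2 hc
      have d5 := mul_le_mul_of_nonneg_right d3 (Real.exp_pos τ).le
      have d6 : Lh * (s + ((M + C) * s + K * ((M + C) * s))) * Real.exp τ ≤ Lh * (s + ((M + C) * s + K * ((M + C) * s))) * E :=
        mul_le_mul_of_nonneg_left d4 (by positivity)
      have d7 : Lh * (s + ((M + C) * s + K * ((M + C) * s))) * E ≤ A2 * (s * (1 + M)) := by
        have : A2 * (s * (1 + M)) - Lh * (s + ((M + C) * s + K * ((M + C) * s))) * E =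
           Lh * (M + (1 + K) * (1 + C * M)) * E * s := by rw [hA2]; ring
        have : 0 ≤ Lh * (M + (1 + K) * (1 + C * M)) * E * s := by positivity
        linarith
      have e1 : Real.exp τ ≤ Real.exp (u' - (t + s)) * (1 + 2 * s) := by
        have := abs_le.1 (Real.abs_exp_sub_one_sub_id_le (x := s) (by rwa [abs_of_nonneg hs]))
        calc Real.exp τ ≤ Real.exp (u' - (t + s) + s) := Real.exp_le_exp.2 (by linarith)
          _ = Real.exp (u' - (t + s)) * Real.exp s := Real.exp_add _ _
          _ ≤ _ := mul_le_mul_of_nonneg_left (by nlinarith) (Real.exp_pos _).le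
      have d8 := mul_le_mul_of_nonneg_left e1 (le_max_left 0 (h u' (hst r (z (t + s) x d) u') - 1 / ((q:ℝ) + 1)))
      have d9 := E1 d hd (u' - (t + s)) (by linarith) (t + s) (by linarith) x hx
      rw [trm, show t + s + (u' - (t + s)) = u' by ring] at d9
      rw [trm, trm, ← hu, show t + s + (u' - (t + s)) = u' by ring]
      rw [mul_add, mul_one, mul_add, ← mul_assoc] at d8
      have d10 := mul_le_mul_of_nonneg_right d9 (by positivity : 0 ≤ 2 * s)
      have : 0 ≤ 2 * (B * E) * (s * M) := by positivity
      linarith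

end lvl


lemma wstep {a b c A w S : ℝ} (h : a ≤ b + A * w) (hc : 0 ≤ c) (hS : c * A ≤ S) (hw : 0 ≤ w) : c * a ≤ c * b + S * w := by
  have h1 := mul_le_mul_of_nonneg_left h hc
  have h2 := mul_le_mul_of_nonneg_right hS hw
  linarith

section wgt
variable {n l : ℕ} {r : ℝ} {hr : 0 < r} {D : Set (Euc l)} {F : ℝ → Euc l → Hist n r → Euc n}
  {z : ℝ → Hist n r → (ℝ → Euc l) → C(ℝ, Euc n)} {h : ℝ → Hist n r → ℝ}

structure Wgt (D : Set (Euc l)) (z : ℝ → Hist n r → (ℝ → Euc l) → C(ℝ, Euc n)) (h : ℝ → Hist n r → ℝ)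
    (c C : ℕ → ℝ) : Prop where
  c0 : ∀ q, 0 < c q
  C0 : ∀ N, 0 ≤ C N
  mono : Monotone C
  e0 : ∀ q N : ℕ, N ≤ q → ∀ d, InMD D d → ∀ τ, 0 ≤ τ → ∀ t, 0 ≤ t → ∀ x, ‖x‖ ≤ N → c q * trm z h q t x τ d ≤ 1 / (q + 1)
  e1 : ∀ q N : ℕ, ∀ d, InMD D d → ∀ τ, 0 ≤ τ → ∀ t, 0 ≤ t → ∀ x, ‖x‖ ≤ N → c q * trm z h q t x τ d ≤ C N
  e2 : ∀ q N : ℕ, ∀ d, InMD D d → ∀ τ, 0 ≤ τ → ∀ t : ℝ, 0 ≤ t → t ≤ N → ∀ x y, ‖x‖ ≤ N → ‖y‖ ≤ N →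
    c q * trm z h q t x τ d ≤ c q * trm z h q t y τ d + C N * ‖x - y‖
  e3 : ∀ q N : ℕ, ∀ d, InMD D d → ∀ τ, 0 ≤ τ → ∀ t : ℝ, 0 ≤ t → t ≤ N → ∀ s, 0 ≤ s → s ≤ 1 → ∀ x M, ‖x‖ ≤ N → 0 ≤ M → HLip x M →
      c q * trm z h q (t + s) x τ d ≤ c q * trm z h q t x (τ + s) d + C N * (s * (1 + M)) ∧
      ∃ τ', 0 ≤ τ' ∧ c q * trm z h q t x τ d ≤ c q * trm z h q (t + s) x τ' d + C N * (s * (1 + M))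

lemma wgt_exists (hF : GoodF r hr D F) (hz : Flw r D F z h) : ∃ c C, Wgt D z h c C := by
  choose A A0 hA using lvl hF hz
  have cA : ∀ q : ℕ, 1 / ((q + 1) * (1 + A q q)) * A q q ≤ 1 / (q + 1 : ℝ) := by
    intro q
    have := A0 q q
    rw [one_div_mul_eq_div, div_le_div_iff₀ (by positivity) (by positivity)]
    nlinarith
  have c0 : ∀ q : ℕ, 0 < 1 / ((q + 1) * (1 + A q q)) := fun q => by have := A0 q q; positivity
  have c1 : ∀ q : ℕ, 1 / ((q + 1) * (1 + A q q)) ≤ 1 := fun q => by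
    have := A0 q q
    rw [div_le_one (by positivity)]
    nlinarith [(Nat.cast_nonneg q : (0:ℝ) ≤ q)]
  have S0 : ∀ N : ℕ, 0 ≤ ∑ p ∈ Finset.range (N + 1) ×ˢ Finset.range (N + 1), A p.1 p.2 :=
    fun N => Finset.sum_nonneg fun p _ => A0 _ _
  have key : ∀ q N : ℕ, ∃ N', N ≤ N' ∧ 1 / ((q + 1) * (1 + A q q)) * A q N' ≤
      1 + ∑ p ∈ Finset.range (N + 1) ×ˢ Finset.range (N + 1), A p.1 p.2 := by
    intro q N
    rcases le_total N q with hc | hc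
    · refine ⟨q, hc, (cA q).trans ?_⟩
      have : 1 / (q + 1 : ℝ) ≤ 1 := by
        rw [div_le_one (by positivity)]; linarith [(Nat.cast_nonneg q : (0:ℝ) ≤ q)]
      linarith [S0 N]
    · refine ⟨N, le_rfl, (mul_le_of_le_one_left (A0 _ _) (c1 q)).trans ?_⟩
      have := Finset.single_le_sum (f := fun p : ℕ × ℕ => A p.1 p.2) (s := Finset.range (N + 1) ×ˢ Finset.range (N + 1))
        (fun p _ => A0 _ _) (a := (q, N)) (by simp; omega)
      simp only at this
      linarith
  refine ⟨fun q => 1 / ((q + 1) * (1 + A q q)), fun N => 1 + ∑ p ∈ Finset.range (N + 1) ×ˢ Finset.range (N + 1), A p.1 p.2,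
    c0, fun N => by linarith [S0 N], ?_, ?_, ?_, ?_, ?_⟩
  · intro N N' hN
    refine add_le_add_right (Finset.sum_le_sum_of_subset_of_nonneg (Finset.product_subset_product ?_ ?_) fun p _ _ => A0 _ _) _
    all_goals exact Finset.range_mono (by omega)
  · intro q N hN d hd τ hτ t ht x hx
    exact (mul_le_mul_of_nonneg_left ((hA q q d hd τ hτ).1 t ht x (hx.trans (Nat.cast_le.2 hN))) (c0 q).le).trans (cA q)
  · intro q N d hd τ hτ t ht x hx
    obtain ⟨N', hN, hk⟩ := key q N
    exact (mul_le_mul_of_nonneg_left ((hA q N' d hd τ hτ).1 t ht x (hx.trans (Nat.cast_le.2 hN))) (c0 q).le).trans hk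
  · intro q N d hd τ hτ t ht htN x y hx hy
    obtain ⟨N', hN, hk⟩ := key q N
    have hN' : (N:ℝ) ≤ N' := Nat.cast_le.2 hN
    exact wstep ((hA q N' d hd τ hτ).2.1 t ht (htN.trans hN') x y (hx.trans hN') (hy.trans hN')) (c0 q).le hk (norm_nonneg _)
  · intro q N d hd τ hτ t ht htN s hs hs1 x M hx hM hxM
    obtain ⟨N', hN, hk⟩ := key q N
    have hN' : (N:ℝ) ≤ N' := Nat.cast_le.2 hN
    obtain ⟨h1, τ', hτ', h2⟩ := (hA q N' d hd τ hτ).2.2 t ht (htN.trans hN') s hs hs1 x M (hx.trans hN') hM hxM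
    exact ⟨wstep h1 (c0 q).le hk (by positivity), τ', hτ', wstep h2 (c0 q).le hk (by positivity)⟩

def VV (D : Set (Euc l)) (z : ℝ → Hist n r → (ℝ → Euc l) → C(ℝ, Euc n)) (h : ℝ → Hist n r → ℝ)
    (c : ℕ → ℝ) (t : ℝ) (x : Hist n r) : ℝ :=
  sSup {v | ∃ q τ d, 0 ≤ τ ∧ InMD D d ∧ v = c q * trm z h q t x τ d}

variable {c C : ℕ → ℝ}

lemma Wgt.nn (hw : Wgt D z h c C) (t : ℝ) (x : Hist n r) : 0 ≤ VV D z h c t x := by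
  refine Real.sSup_nonneg ?_
  rintro v ⟨q, τ, d, -, -, rfl⟩
  exact mul_nonneg (hw.c0 q).le (trm_nn _ _ _ _ _)

lemma VV_le {t b : ℝ} {x : Hist n r} (hb : 0 ≤ b) (H : ∀ q τ d, 0 ≤ τ → InMD D d → c q * trm z h q t x τ d ≤ b) :
    VV D z h c t x ≤ b := by
  refine Real.sSup_le ?_ hb
  rintro v ⟨q, τ, d, h1, h2, rfl⟩
  exact H q τ d h1 h2

lemma Wgt.le_VV (hw : Wgt D z h c C) {t : ℝ} (ht : 0 ≤ t) (x : Hist n r) {q τ d} (hτ : 0 ≤ τ) (hd : InMD D d) :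
    c q * trm z h q t x τ d ≤ VV D z h c t x := by
  refine le_csSup ⟨C ⌈‖x‖⌉₊, ?_⟩ ⟨q, τ, d, hτ, hd, rfl⟩
  rintro v ⟨q, τ, d, h1, h2, rfl⟩
  exact hw.e1 q _ d h2 τ h1 t ht x (Nat.le_ceil _)

lemma Wgt.v1 (hw : Wgt D z h c C) {N : ℕ} {t : ℝ} (ht : 0 ≤ t) (htN : t ≤ N) {x y : Hist n r} (hx : ‖x‖ ≤ N) (hy : ‖y‖ ≤ N) :
    |VV D z h c t x - VV D z h c t y| ≤ C N * ‖x - y‖ := by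
  have : ∀ x y : Hist n r, ‖x‖ ≤ N → ‖y‖ ≤ N → VV D z h c t x ≤ VV D z h c t y + C N * ‖x - y‖ := by
    intro x y hx hy
    refine VV_le (add_nonneg (hw.nn _ _) (mul_nonneg (hw.C0 _) (norm_nonneg _))) fun q τ d hτ hd => ?_
    exact (hw.e2 q N d hd τ hτ t ht htN x y hx hy).trans (add_le_add_left (hw.le_VV ht y hτ hd) _)
  have h1 := this x y hx hy
  have h2 := this y x hy hx
  rw [norm_sub_rev] at h2
  exact abs_sub_le_iff.2 ⟨by linarith, by linarith⟩

lemma Wgt.v2 (hw : Wgt D z h c C) {N : ℕ} {t : ℝ} (ht : 0 ≤ t) (htN : t ≤ N) {s : ℝ} (hs : 0 ≤ s) (hs1 : s ≤ 1)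
    {x : Hist n r} {M : ℝ} (hx : ‖x‖ ≤ N) (hM : 0 ≤ M) (hxM : HLip x M) :
    |VV D z h c (t + s) x - VV D z h c t x| ≤ C N * (s * (1 + M)) := by
  have p : 0 ≤ C N * (s * (1 + M)) := mul_nonneg (hw.C0 _) (by positivity)
  have h1 : VV D z h c (t + s) x ≤ VV D z h c t x + C N * (s * (1 + M)) := by
    refine VV_le (add_nonneg (hw.nn _ _) p) fun q τ d hτ hd => ?_
    exact (hw.e3 q N d hd τ hτ t ht htN s hs hs1 x M hx hM hxM).1.trans (add_le_add_left (hw.le_VV ht x (by linarith) hd) _)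
  have h2 : VV D z h c t x ≤ VV D z h c (t + s) x + C N * (s * (1 + M)) := by
    refine VV_le (add_nonneg (hw.nn _ _) p) fun q τ d hτ hd => ?_
    obtain ⟨τ', hτ', h3⟩ := (hw.e3 q N d hd τ hτ t ht htN s hs hs1 x M hx hM hxM).2
    exact h3.trans (add_le_add_left (hw.le_VV (by linarith) x hτ' hd) _)
  exact abs_sub_le_iff.2 ⟨by linarith, by linarith⟩

lemma Wgt.v3 (hw : Wgt D z h c C) (hz : Flw r D F z h) (hD : D.Nonempty) {t : ℝ} (ht : 0 ≤ t) (x : Hist n r) (q : ℕ) :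
    c q * max 0 (h t x - 1 / (q + 1)) ≤ VV D z h c t x := by
  obtain ⟨d, hd⟩ := hD
  have hd' : InMD D (fun _ : ℝ => d) := ⟨measurable_const, fun _ => hd⟩
  have := hw.le_VV ht x (q := q) le_rfl hd'
  rwa [trm, add_zero, hz.init t ht x _ hd', Real.exp_zero, mul_one] at this

lemma Wgt.v4 (hw : Wgt D z h c C) (hz : Flw r D F z h) : ∃ a, IsKinf a ∧ ∀ t, 0 ≤ t → ∀ x, VV D z h c t x ≤ a ‖x‖ := by
  let S : ℝ → Set ℝ := fun ρ => {v | ∃ t x, 0 ≤ t ∧ ‖x‖ ≤ ρ ∧ v = VV D z h c t x}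
  have S0 : ∀ ρ, ∀ v ∈ S ρ, 0 ≤ v := by
    rintro ρ v ⟨t, x, -, -, rfl⟩; exact hw.nn t x
  have Sb : ∀ ρ, BddAbove (S ρ) := by
    intro ρ
    refine ⟨C ⌈ρ⌉₊, ?_⟩
    rintro v ⟨t, x, ht, hx, rfl⟩
    exact VV_le (hw.C0 _) fun q τ d hτ hd => hw.e1 q _ d hd τ hτ t ht x (hx.trans (Nat.le_ceil _))
  obtain ⟨a, ha, h1⟩ := kinf_major (fun ρ => sSup (S ρ)) (fun ρ h0 ρ' _ hρ => by
      refine csSup_le_csSup (Sb _) ⟨_, 0, 0, le_rfl, by simpa using h0, rfl⟩ ?_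
      rintro v ⟨t, x, ht, hx, rfl⟩
      exact ⟨t, x, ht, hx.trans hρ, rfl⟩) (fun ρ _ => Real.sSup_nonneg (S0 ρ)) (by
    intro ε hε
    obtain ⟨Q, hQ⟩ := exists_nat_one_div_lt hε
    obtain ⟨δ, δ0, hδ⟩ := hz.h2 (1 / (((Q + 1 : ℕ):ℝ) + 1)) (by positivity)
    refine ⟨min δ 1, lt_min δ0 one_pos, Real.sSup_le ?_ hε.le⟩
    rintro v ⟨t, x, ht, hx, rfl⟩
    refine VV_le hε.le fun q τ d hτ hd => ?_
    rcases le_total (Q + 1) q with hc | hc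
    · refine (hw.e0 q 1 (by omega) d hd τ hτ t ht x (hx.trans (by simp))).trans (le_trans ?_ hQ.le)
      have : ((Q + 1 : ℕ):ℝ) ≤ q := Nat.cast_le.2 hc
      push_cast at this
      exact one_div_le_one_div_of_le (by positivity) (by linarith)
    · rw [trm_zero, mul_zero]
      · exact hε.le
      · refine (hδ t (t + τ) ht (by linarith) x (hx.trans (min_le_left _ _)) d hd).trans ?_
        have : (q:ℝ) ≤ ((Q + 1 : ℕ):ℝ) := Nat.cast_le.2 hc
        exact one_div_le_one_div_of_le (by positivity) (by linarith))
  exact ⟨a, ha, fun t ht x => (le_csSup (Sb _) ⟨t, x, ht, le_rfl, rfl⟩).trans (h1 _ (norm_nonneg x))⟩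

lemma Wgt.v5 (hw : Wgt D z h c C) (hF : GoodF r hr D F) (hz : Flw r D F z h) {t s : ℝ} (ht : 0 ≤ t) (hs : 0 ≤ s) (x : Hist n r)
    {d} (hd : InMD D d) : VV D z h c (t + s) (hst r (z t x d) (t + s)) ≤ Real.exp (-s) * VV D z h c t x := by
  classical
  refine VV_le (mul_nonneg (Real.exp_pos _).le (hw.nn _ _)) fun q τ d' hτ hd' => ?_
  let dd : ℝ → Euc l := fun u => if u < t + s then d u else d' u
  have hdd : InMD D dd := ⟨Measurable.ite measurableSet_Iio hd.1 hd'.1, fun u => by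
    simp only [dd]; split_ifs; exacts [hd.2 u, hd'.2 u]⟩
  have hts : 0 ≤ t + s := by linarith
  have e1 : hst r (z t x dd) (t + s) = hst r (z t x d) (t + s) :=
    hF.uniq ht hdd (hz.sol t ht x dd hdd (t + s))
      ((hz.sol t ht x d hd (t + s)).congr_d fun u hu => by simp only [dd]; rw [if_pos hu.2])
      (by rw [hz.init t ht x dd hdd, hz.init t ht x d hd]) (t + s) ⟨by linarith, le_rfl⟩
  have e2 : hst r (z t x dd) (t + s + τ) = hst r (z (t + s) (hst r (z t x d) (t + s)) d') (t + s + τ) :=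
    hF.uniq hts hd' ((hF.sol_right hdd ht (by linarith) (hz.sol t ht x dd hdd (t + s + τ))).congr_d
        fun u hu => by simp only [dd]; rw [if_neg (not_lt.2 hu.1)])
      (hz.sol _ hts _ d' hd' _) (by rw [e1, hz.init _ hts _ d' hd']) _ ⟨by linarith, le_rfl⟩
  have := mul_le_mul_of_nonneg_left (hw.le_VV ht x (q := q) (τ := s + τ) (by linarith) hdd) (Real.exp_pos (-s)).le
  refine le_trans (le_of_eq ?_) this
  rw [trm, trm, ← e2, ← add_assoc t s τ, Real.exp_add, Real.exp_neg]
  field_simp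

lemma Wgt.almost (hw : Wgt D z h c C) (hr : 0 < r) : AlmostLipschitzOn r (VV D z h c) := by
  refine ⟨?_, fun R => C ⌈R⌉₊, fun R => C ⌈R⌉₊, fun _ => 1, fun a b hab => hw.mono (Nat.ceil_mono hab),
    fun a b hab => hw.mono (Nat.ceil_mono hab), fun _ _ _ => le_rfl, fun _ => le_rfl, ?_, ?_⟩
  · rintro ⟨t, x⟩ ⟨ht, -⟩
    have ht : 0 ≤ t := ht
    rw [Metric.continuousWithinAt_iff]
    intro ε hε
    set N := ⌈t + ‖x‖ + 2⌉₊
    have hN : t + ‖x‖ + 2 ≤ N := Nat.le_ceil _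
    have C0 := hw.C0 N
    set e := min 1 (ε / (8 * (C N + 1))) with he
    have e0 : 0 < e := lt_min one_pos (by positivity)
    have e1 : e ≤ 1 := min_le_left _ _
    have e2 : C N * e ≤ ε / 8 := by
      have : e ≤ ε / (8 * (C N + 1)) := min_le_right _ _
      rw [le_div_iff₀ (by positivity)] at this
      nlinarith
    obtain ⟨y, M, M0, hyM, hyx⟩ := lip_dense hr x e0
    refine ⟨e / (1 + M), by positivity, ?_⟩
    rintro ⟨s, w⟩ ⟨hs, -⟩ hsw
    have hs : 0 ≤ s := hs
    have h1 : |s - t| < e / (1 + M) := (le_max_left _ _).trans_lt hsw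
    have h2 : ‖w - x‖ < e / (1 + M) := by rw [← dist_eq_norm]; exact (le_max_right _ _).trans_lt hsw
    have h3 : e / (1 + M) ≤ e := div_le_self e0.le (by linarith)
    have nx := norm_nonneg x
    have nw : ‖w‖ ≤ ‖x‖ + ‖w - x‖ := norm_le_norm_add_norm_sub' w x
    have ny : ‖y‖ ≤ ‖x‖ + ‖y - x‖ := norm_le_norm_add_norm_sub' y x
    have hst' := abs_lt.1 h1
    have a1 := abs_le.1 (hw.v1 hs (by linarith) (x := w) (y := y) (N := N) (by linarith) (by linarith))
    have a2 := abs_le.1 (hw.v1 ht (by linarith) (x := y) (y := x) (N := N) (by linarith) (by linarith))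
    have a3 : |VV D z h c s y - VV D z h c t y| ≤ C N * e := by
      have f : |s - t| * (1 + M) ≤ e := by rw [← le_div_iff₀ (by positivity)]; exact h1.le
      refine le_trans ?_ (mul_le_mul_of_nonneg_left f C0)
      rcases le_total t s with hc | hc
      · have := hw.v2 ht (N := N) (s := s - t) (by linarith) (by linarith) (by linarith) (x := y) (by linarith) M0 hyM
        rwa [add_sub_cancel, ← abs_of_nonneg (sub_nonneg.2 hc)] at this
      · have := hw.v2 hs (N := N) (s := t - s) (by linarith) (by linarith) (by linarith) (x := y) (by linarith) M0 hyM
        rwa [add_sub_cancel, ← abs_of_nonneg (sub_nonneg.2 hc), abs_sub_comm, abs_sub_comm t s] at this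
    have a3 := abs_le.1 a3
    have n1 : ‖w - y‖ ≤ 2 * e := by
      have := norm_sub_le_norm_sub_add_norm_sub w x y
      rw [norm_sub_rev x y] at this
      linarith
    have b1 := mul_le_mul_of_nonneg_left n1 C0
    have b2 := mul_le_mul_of_nonneg_left hyx C0
    rw [Real.dist_eq, abs_lt]
    exact ⟨by linarith [a1.1, a2.1, a3.1], by linarith [a1.2, a2.2, a3.2]⟩
  · intro R hR t ht x y hx hy
    have := Nat.le_ceil R
    exact hw.v1 ht.1 (ht.2.trans this) (hy.trans this) (hx.trans this)
  · intro R hR M hM x hx hxM t ht s hs hs1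
    have := Nat.le_ceil R
    have := hw.v2 ht.1 (ht.2.trans this) hs (by simpa using hs1) (hx.trans this) hM (fun θ θ' => by
      have := hxM.dist_le_mul θ θ'
      rwa [dist_eq_norm, Real.coe_toNNReal M hM] at this)
    linarith

end wgt


lemma low (c : ℕ → ℝ) (hc : ∀ q, 0 < c q) : ∃ a, IsKinf a ∧ ∀ s v : ℝ, 0 ≤ s →
    (∀ q : ℕ, c q * max 0 (s - 1 / (q + 1)) ≤ v) → a s ≤ v := by
  set w : ℕ → ℝ → ℝ := fun q s => min (c q) 1 * max 0 (s - 1 / (q + 1)) with hw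
  have m0 : ∀ q, 0 < min (c q) 1 := fun q => lt_min (hc q) one_pos
  have m1 : ∀ q, min (c q) 1 ≤ 1 := fun q => min_le_right _ _
  have q0 : ∀ q : ℕ, (0:ℝ) < 1 / (q + 1) := fun q => by positivity
  have w0 : ∀ q s, 0 ≤ w q s := fun q s => mul_nonneg (m0 q).le (le_max_left _ _)
  have wm : ∀ q s t, s ≤ t → w q s ≤ w q t := fun q s t h =>
    mul_le_mul_of_nonneg_left (max_le_max le_rfl (by linarith)) (m0 q).le
  have wl : ∀ q s t, s ≤ t → w q t ≤ w q s + (t - s) := fun q s t h => by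
    have h1 : max 0 (t - 1 / ((q:ℝ) + 1)) ≤ max 0 (s - 1 / (q + 1)) + (t - s) := max_step (by linarith) (by linarith)
    have := mul_le_mul_of_nonneg_left h1 (m0 q).le
    rw [mul_add] at this
    exact this.trans (add_le_add_right (mul_le_of_le_one_left (by linarith) (m1 q)) _)
  have wz : ∀ q, w q 0 = 0 := fun q => by simp only [hw]; rw [max_eq_left (by linarith [q0 q]), mul_zero]
  have wb : ∀ s, BddAbove (range fun q => w q s) := fun s => ⟨max s 0, by
    rintro _ ⟨q, rfl⟩
    have h1 := wl q 0 (max s 0) (le_max_right _ _)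
    have h2 := wm q s _ (le_max_left s 0)
    rw [wz] at h1
    show w q s ≤ _
    linarith⟩
  set W : ℝ → ℝ := fun s => ⨆ q, w q s with hW
  have Wm : Monotone W := fun s t h => ciSup_mono (wb t) fun q => wm q s t h
  have Wl : ∀ s t, s ≤ t → W t ≤ W s + (t - s) := fun s t h => ciSup_le fun q =>
    (wl q s t h).trans (add_le_add_left (le_ciSup (wb s) q) _)
  have Wge : ∀ q s, w q s ≤ W s := fun q s => le_ciSup (wb s) q
  have Wp : ∀ s, 0 < s → 0 < W s := fun s hs => by
    obtain ⟨q, hq⟩ := exists_nat_one_div_lt hs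
    exact lt_of_lt_of_le (mul_pos (m0 q) (lt_max_of_lt_right (by linarith))) (Wge q s)
  have W0 : ∀ s, 0 ≤ W s := fun s => (w0 0 s).trans (Wge 0 s)
  have Wc : Continuous W := by
    refine (LipschitzWith.of_dist_le_mul (K := 1) fun s t => ?_).continuous
    rw [Real.dist_eq, Real.dist_eq, NNReal.coe_one, one_mul]
    rcases le_total s t with h | h
    · rw [abs_sub_comm, abs_sub_comm s t, abs_of_nonneg (sub_nonneg.2 (Wm h)), abs_of_nonneg (sub_nonneg.2 h)]
      linarith [Wl s t h]
    · rw [abs_of_nonneg (sub_nonneg.2 (Wm h)), abs_of_nonneg (sub_nonneg.2 h)]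
      linarith [Wl t s h]
  refine ⟨fun s => W s * (s / (1 + s)), ⟨?_, ?_, by simp, ?_⟩, ?_⟩
  · refine Wc.continuousOn.mul (ContinuousOn.div continuousOn_id (by fun_prop) fun s hs => ?_)
    have : (0:ℝ) ≤ s := hs
    positivity
  · intro s hs t ht hst'
    have hs : 0 ≤ s := hs
    have ht : 0 < t := by linarith
    have h1 : s / (1 + s) < t / (1 + t) := by rw [div_lt_div_iff₀ (by positivity) (by positivity)]; linarith
    exact (mul_le_mul_of_nonneg_right (Wm hst'.le) (by positivity)).trans_lt (mul_lt_mul_of_pos_left h1 (Wp t ht))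
  · have : Tendsto (fun s : ℝ => min (c 0) 1 / 2 * (s - 1)) atTop atTop :=
      Tendsto.const_mul_atTop (half_pos (m0 0)) (tendsto_atTop_add_const_right _ _ tendsto_id)
    refine tendsto_atTop_mono' _ ?_ this
    filter_upwards [eventually_ge_atTop 1] with s hs
    have h1 : min (c 0) 1 * (s - 1) ≤ W s := by
      refine le_trans (mul_le_mul_of_nonneg_left ?_ (m0 0).le) (Wge 0 s)
      simp
    have h2 : 1 / 2 ≤ s / (1 + s) := by rw [div_le_div_iff₀ (by positivity) (by positivity)]; linarith
    have := mul_le_mul h1 h2 (by positivity) (W0 s)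
    linarith
  · intro s v hs hv
    have h1 : s / (1 + s) ≤ 1 := by rw [div_le_one (by positivity)]; linarith
    refine (mul_le_of_le_one_right (W0 s) h1).trans (ciSup_le fun q => le_trans ?_ (hv q))
    exact mul_le_mul_of_nonneg_right (min_le_left _ _) (le_max_left _ _)

section rc
variable {n l : ℕ} {r : ℝ} {hr : 0 < r} {D : Set (Euc l)} {F : ℝ → Euc l → Hist n r → Euc n}

lemma GoodF.rc1 (hF : GoodF r hr D F) {t : ℝ} (ht : 0 ≤ t) {d} (hd : d ∈ D) {y : ℝ → Hist n r} (hy : Continuous y)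
    (e : Euc n) {δ : ℝ} (hδ : 0 < δ) : ∀ᶠ s in 𝓝[>] t, ⟪e, F t d (y t)⟫ - δ ≤ ⟪e, F s d (y s)⟫ := by
  set x := y t with hx
  set R := t + 1 + ‖x‖ + ‖e‖ + 1 with hR
  have nx := norm_nonneg x
  have ne := norm_nonneg e
  have R0 : 0 ≤ R := by positivity
  obtain ⟨L, L0, hL⟩ := hF.lip R R0
  obtain ⟨C, C0, hC⟩ := hF.bdd R R0
  set G := L * (‖e‖ + 1) ^ 2 + 2 * C with hG
  have G0 : 0 ≤ G := by positivity
  let ce : Hist n r := ContinuousMap.const _ e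
  have c1 : Tendsto (fun κ : ℝ => ⟪e, F t d (x + κ • ce)⟫) (𝓝[>] 0) (𝓝 ⟪e, F t d x⟫) := by
    have : Continuous (fun κ : ℝ => ⟪e, F t d (x + κ • ce)⟫) :=
      continuous_const.inner ((hF.cont t ht d hd).comp (by fun_prop))
    have : Tendsto (fun κ : ℝ => ⟪e, F t d (x + κ • ce)⟫) (𝓝 0) (𝓝 ⟪e, F t d (x + (0:ℝ) • ce)⟫) := this.tendsto 0
    rw [show x + (0:ℝ) • ce = x by ext θ : 1; simp] at this
    exact this.mono_left nhdsWithin_le_nhds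
  obtain ⟨κ, hκ1, hκ⟩ := ((c1.eventually (lt_mem_nhds (sub_lt_self ⟪e, F t d x⟫ (show 0 < δ / 4 by positivity)))).and
    (Ioo_mem_nhdsGT (show (0:ℝ) < min 1 (δ / (4 * (G + 1))) from lt_min one_pos (by positivity)))).exists
  have κ0 := hκ.1
  have κ1 : κ < 1 := hκ.2.trans_le (min_le_left _ _)
  have κG : κ * G ≤ δ / 4 := by
    have := hκ.2.trans_le (min_le_right _ _)
    rw [lt_div_iff₀ (by positivity)] at this
    nlinarith
  set w := x + κ • ce with hw
  have c2 : Tendsto (fun s => ⟪e, F s d w⟫) (𝓝[>] t) (𝓝 ⟪e, F t d w⟫) :=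
    tendsto_const_nhds.inner (hF.rcont t ht d hd w)
  have c3 : Tendsto (fun s => ‖y s - x‖) (𝓝[>] t) (𝓝 0) := by
    have : Continuous (fun s => ‖y s - x‖) := (hy.sub continuous_const).norm
    have : Tendsto (fun s => ‖y s - x‖) (𝓝 t) (𝓝 ‖x - x‖) := this.tendsto t
    rw [sub_self, norm_zero] at this
    exact this.mono_left nhdsWithin_le_nhds
  have nce : ‖ce‖ ≤ ‖e‖ := by
    rw [ContinuousMap.norm_le _ ne]; intro θ; exact le_rfl
  have nw : ‖w - x‖ ≤ κ * ‖e‖ := by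
    rw [hw, add_sub_cancel_left, norm_smul, Real.norm_of_nonneg κ0.le]
    exact mul_le_mul_of_nonneg_left nce κ0.le
  filter_upwards [c2.eventually (lt_mem_nhds (sub_lt_self _ (show 0 < δ / 4 by positivity))),
    c3.eventually (gt_mem_nhds (show 0 < κ ^ 2 by positivity)), Ioo_mem_nhdsGT (show t < t + 1 by linarith)] with s h1 h2 h3
  have hs : s ∈ Icc (0:ℝ) R := ⟨by linarith [h3.1], by linarith [h3.2]⟩
  have n1 : ‖w‖ ≤ R := by
    have := norm_le_norm_add_norm_sub' w x
    nlinarith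
  have n2 : ‖y s‖ ≤ R := by
    have := norm_le_norm_add_norm_sub' (y s) x
    nlinarith
  have n3 : ‖w - y s‖ ≤ κ * (‖e‖ + 1) := by
    have := norm_sub_le_norm_sub_add_norm_sub w x (y s)
    rw [norm_sub_rev x] at this
    nlinarith
  have l1 := hL s hs d hd w (y s) n1 n2
  have e1 : w (z0 hr) - y s (z0 hr) = κ • e - (y s - x) (z0 hr) := by
    simp only [hw, ContinuousMap.add_apply, ContinuousMap.sub_apply, ContinuousMap.smul_apply]
    rw [show ce (z0 hr) = e from rfl]; abel
  have e2 : |⟪(y s - x) (z0 hr), F s d w - F s d (y s)⟫| ≤ κ ^ 2 * (2 * C) := by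
    refine (abs_real_inner_le_norm _ _).trans (mul_le_mul ((norm_z0_le hr _).trans h2.le) ?_ (norm_nonneg _) (by positivity))
    refine (norm_sub_le _ _).trans ?_
    linarith [hC s hs d hd w n1, hC s hs d hd (y s) n2]
  rw [e1, inner_sub_left, real_inner_smul_left] at l1
  have l2 : L * ‖w - y s‖ ^ 2 ≤ L * (κ * (‖e‖ + 1)) ^ 2 :=
    mul_le_mul_of_nonneg_left (pow_le_pow_left₀ (norm_nonneg _) n3 2) L0
  have l3 : κ * ⟪e, F s d w - F s d (y s)⟫ ≤ κ * (κ * G) := by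
    rw [hG]; nlinarith [(abs_le.1 e2).2]
  have l4 := le_of_mul_le_mul_left l3 κ0
  rw [inner_sub_right] at l4
  linarith

lemma GoodF.rc (hF : GoodF r hr D F) {t : ℝ} (ht : 0 ≤ t) {d} (hd : d ∈ D) {y : ℝ → Hist n r} (hy : Continuous y) :
    Tendsto (fun s => F s d (y s)) (𝓝[>] t) (𝓝 (F t d (y t))) := by
  have h1 : ∀ e : Euc n, Tendsto (fun s => ⟪e, F s d (y s)⟫) (𝓝[>] t) (𝓝 ⟪e, F t d (y t)⟫) := by
    intro e
    rw [Metric.tendsto_nhds]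
    intro ε hε
    filter_upwards [hF.rc1 ht hd hy e (half_pos hε), hF.rc1 ht hd hy (-e) (half_pos hε)] with s h1 h2
    rw [inner_neg_left, inner_neg_left] at h2
    rw [Real.dist_eq, abs_lt]
    exact ⟨by linarith, by linarith⟩
  have h2 : Tendsto (fun s => (F s d (y s)).ofLp) (𝓝[>] t) (𝓝 (F t d (y t)).ofLp) := by
    rw [tendsto_pi_nhds]
    intro i
    have := h1 (EuclideanSpace.single i 1)
    simpa [EuclideanSpace.inner_single_left] using this
  exact ((PiLp.continuous_toLp 2 _).tendsto _).comp h2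

lemma GoodF.deriv (hF : GoodF r hr D F) {t : ℝ} (ht : 0 ≤ t) {d} (hd : d ∈ D) {x : C(ℝ, Euc n)}
    (hx : ∀ T, Sol F (fun _ => d) t T x) : HasDerivWithinAt x (F t d (hst r x t)) (Ici t) t := by
  have hd' : InMD D (fun _ : ℝ => d) := ⟨measurable_const, fun _ => hd⟩
  have := intervalIntegral.integral_hasDerivWithinAt_right (f := fun s => F s d (hst r x s)) (a := t) (b := t)
    (s := Ici t) (t := Ioi t) (by simp) ⟨Ioc t (t + 1), Ioc_mem_nhdsGT (by linarith), hF.meas _ hd' _ (hst_cont x) t (t + 1) ht⟩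
    (hF.rc ht hd (hst_cont x))
  exact (this.const_add (x t)).congr (fun s hs => hx s s ⟨hs, le_rfl⟩) (by simp)

lemma ehist_diff (hr : 0 < r) (x : Hist n r) (v v' : Euc n) {h : ℝ} (hh : 0 ≤ h) :
    ‖Ehist h x v' - Ehist h x v‖ ≤ h * ‖v' - v‖ := by
  have hr' : -r ≤ 0 := by linarith
  rw [ContinuousMap.norm_le _ (by positivity)]
  intro θ
  rw [ContinuousMap.sub_apply, Ehist, dif_pos hr', Ehist, dif_pos hr']
  change ‖(if (θ:ℝ) ≤ -h then x (projIcc (-r) 0 hr' (θ + h)) else x (projIcc (-r) 0 hr' 0) + ((θ:ℝ) + h) • v')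
    - (if (θ:ℝ) ≤ -h then x (projIcc (-r) 0 hr' (θ + h)) else x (projIcc (-r) 0 hr' 0) + ((θ:ℝ) + h) • v)‖ ≤ _
  split_ifs with hθ
  · rw [sub_self, norm_zero]; positivity
  · push Not at hθ
    rw [add_sub_add_left_eq_sub, ← smul_sub, norm_smul, Real.norm_of_nonneg (by linarith)]
    exact mul_le_mul_of_nonneg_right (by linarith [θ.2.2]) (norm_nonneg _)

variable {z : ℝ → Hist n r → (ℝ → Euc l) → C(ℝ, Euc n)} {h : ℝ → Hist n r → ℝ} {c C : ℕ → ℝ}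

lemma Wgt.dini (hw : Wgt D z h c C) (hF : GoodF r hr D F) (hz : Flw r D F z h) {t : ℝ} (ht : 0 ≤ t) (x : Hist n r)
    {d} (hd : d ∈ D) (v' : Euc n) {N : ℕ} (hN : t + ‖x‖ + 2 ≤ N) :
    diniH (VV D z h c) t x v' ≤ ((-VV D z h c t x + C N * ‖v' - F t d x‖ : ℝ) : EReal) := by
  have hd' : InMD D (fun _ : ℝ => d) := ⟨measurable_const, fun _ => hd⟩
  set y := z t x (fun _ => d) with hy
  set v := F t d x with hv
  have yi : hst r y t = x := hz.init t ht x _ hd'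
  have dy := hF.deriv ht hd (hz.sol t ht x _ hd')
  rw [← hy, yi, ← hv] at dy
  have ω := ehist_expand hr dy
  rw [yi] at ω
  set om : ℝ → Hist n r := fun h => h⁻¹ • (hst r y (t + h) - Ehist h x v) with hom
  have f1 : Tendsto (fun p : ℝ × Hist n r => p.1) (𝓝[>] (0:ℝ) ×ˢ 𝓝 0) (𝓝[>] 0) := tendsto_fst
  have f1' := f1.mono_right nhdsWithin_le_nhds
  have f2 : Tendsto (fun p : ℝ × Hist n r => ‖p.2‖) (𝓝[>] (0:ℝ) ×ˢ 𝓝 0) (𝓝 0) := by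
    simpa using (tendsto_snd (f := 𝓝[>] (0:ℝ)) (g := 𝓝 (0 : Hist n r))).norm
  have f3 : Tendsto (fun p : ℝ × Hist n r => ‖om p.1‖) (𝓝[>] (0:ℝ) ×ˢ 𝓝 0) (𝓝 0) := by
    simpa using (ω.comp f1).norm
  have f4 : Tendsto (fun p : ℝ × Hist n r => hst r y (t + p.1)) (𝓝[>] (0:ℝ) ×ˢ 𝓝 0) (𝓝 x) := by
    have : Tendsto (fun p : ℝ × Hist n r => t + p.1) (𝓝[>] (0:ℝ) ×ˢ 𝓝 0) (𝓝 t) := by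
      simpa using f1'.const_add t
    have := ((hst_cont (r := r) y).tendsto t).comp this
    rwa [yi] at this
  have f5 : Tendsto (fun p : ℝ × Hist n r => p.1 * (‖v' - v‖ + ‖p.2‖ + ‖om p.1‖)) (𝓝[>] (0:ℝ) ×ˢ 𝓝 0) (𝓝 0) := by
    simpa using f1'.mul ((f2.const_add ‖v' - v‖).add f3)
  have g : Tendsto (fun p : ℝ × Hist n r => (-1 + p.1) * VV D z h c t x + C N * (‖v' - v‖ + ‖p.2‖ + ‖om p.1‖))
      (𝓝[>] (0:ℝ) ×ˢ 𝓝 0) (𝓝 (-VV D z h c t x + C N * ‖v' - v‖)) := by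
    simpa using ((f1'.const_add (-1)).mul_const (VV D z h c t x)).add (((f2.const_add ‖v' - v‖).add f3).const_mul (C N))
  have g' := (continuous_coe_real_ereal.tendsto _).comp g
  rw [← g'.limsup_eq]
  refine limsup_le_limsup ?_
  filter_upwards [f1.eventually (Ioo_mem_nhdsGT (show (0:ℝ) < 1 from one_pos)), f4.eventually (Metric.ball_mem_nhds x one_pos),
    f5.eventually (gt_mem_nhds one_pos)] with p h1 h2 h3
  obtain ⟨s, w⟩ := p
  simp only at h1 h2 h3
  simp only [Function.comp]
  rw [EReal.coe_le_coe_iff, div_le_iff₀ h1.1]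
  have s0 := h1.1
  have nx := norm_nonneg x
  have h2 : ‖hst r y (t + s) - x‖ < 1 := by rwa [dist_eq_norm] at h2
  have n1 := norm_le_norm_add_norm_sub' (hst r y (t + s)) x
  have e1 : Ehist s x v' + s • w - hst r y (t + s) = (Ehist s x v' - Ehist s x v) + s • w - s • om s := by
    simp only [hom]; rw [smul_inv_smul₀ s0.ne']; abel
  have n2 : ‖Ehist s x v' + s • w - hst r y (t + s)‖ ≤ s * (‖v' - v‖ + ‖w‖ + ‖om s‖) := by
    rw [e1]
    refine (norm_sub_le _ _).trans ?_
    refine (add_le_add_left (norm_add_le _ _) _).trans ?_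
    rw [norm_smul, norm_smul, Real.norm_of_nonneg s0.le]
    linarith [ehist_diff hr x v v' s0.le]
  have n3 := norm_le_norm_add_norm_sub' (Ehist s x v' + s • w) (hst r y (t + s))
  have a1 := (abs_le.1 (hw.v1 (N := N) (t := t + s) (by linarith) (by linarith [h1.2]) (x := Ehist s x v' + s • w)
    (y := hst r y (t + s)) (by linarith) (by linarith))).2
  have a2 := mul_le_mul_of_nonneg_left n2 (hw.C0 N)
  have a3 := hw.v5 hF hz ht s0.le x hd'
  rw [← hy] at a3
  have a4 : Real.exp (-s) ≤ 1 - s + s ^ 2 := by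
    have := abs_le.1 (Real.abs_exp_sub_one_sub_id_le (x := -s) (by rw [abs_neg, abs_of_pos s0]; exact h1.2.le))
    linarith [this.2]
  have a5 := mul_le_mul_of_nonneg_right a4 (hw.nn t x)
  linarith

end rc


lemma proj_exists {m : ℕ} {U : Set (Euc m)} (hc : IsClosed U) (hv : Convex ℝ U) (h0 : (0 : Euc m) ∈ U) :
    ∃ P : Euc m → Euc m, (∀ v, P v ∈ U) ∧ (∀ u ∈ U, P u = u) ∧ ∀ u v, ‖P u - P v‖ ≤ ‖u - v‖ := by
  have ex : ∀ u : Euc m, ∃ v ∈ U, ∀ w ∈ U, ⟪u - v, w - v⟫ ≤ 0 := fun u => by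
    obtain ⟨v, hvU, h⟩ := exists_norm_eq_iInf_of_complete_convex ⟨0, h0⟩ hc.isComplete hv u
    exact ⟨v, hvU, (norm_eq_iInf_iff_real_inner_le_zero hv hvU).1 h⟩
  choose P PU hP using ex
  refine ⟨P, PU, fun u hu => ?_, fun u v => ?_⟩
  · have := hP u u hu
    rw [real_inner_self_eq_norm_sq] at this
    have : ‖u - P u‖ = 0 := by nlinarith [norm_nonneg (u - P u)]
    exact (sub_eq_zero.1 (norm_eq_zero.1 this)).symm
  · have h1 := hP u (P v) (PU v)
    have h2 := hP v (P u) (PU u)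
    have h3 : ⟪P u - P v, P u - P v⟫ = ⟪u - v, P u - P v⟫ + ⟪u - P u, P v - P u⟫ + ⟪v - P v, P u - P v⟫ := by
      rw [show P v - P u = -(P u - P v) by abel, inner_neg_right, ← sub_eq_add_neg, ← inner_sub_left, ← inner_add_left]
      congr 1; abel
    have h4 := real_inner_le_norm (u - v) (P u - P v)
    rw [real_inner_self_eq_norm_sq] at h3
    by_contra h
    push Not at h
    nlinarith [norm_nonneg (u - v), norm_nonneg (P u - P v)]

section ba
variable {n l m : ℕ} {Y : Type*} [NormedAddCommGroup Y] [NormedSpace ℝ Y]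
  {r : ℝ} {D : Set (Euc l)} {U : Set (Euc m)}
  {f : ℝ → Euc l → Hist n r → Euc m → Euc n} {H : ℝ → Hist n r → Y}

/-- The function Ψ. -/
def psi (la LU : ℝ → ℝ) (t s : ℝ) (w u : Euc m) : ℝ :=
  la (|t| + |s|) * LU (max 0 (|t| + |s| + 2 * ‖w‖ + ‖u - w‖)) * ‖u - w‖

lemma comb {N : ℕ} {u : Fin N → Euc m} {lam : Fin N → ℝ} (h0 : ∀ i, 0 ≤ lam i) (h1 : (∑ i, lam i) = 1) (k : Euc m) :
    ∃ i, ‖(∑ i, lam i • u i) - k‖ ≤ ‖u i - k‖ := by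
  by_contra h
  push Not at h
  have := (convex_ball k ‖(∑ i, lam i • u i) - k‖).sum_mem (t := Finset.univ) (fun i _ => h0 i) h1
    (fun i _ => mem_ball_iff_norm.2 (h i))
  rw [mem_ball_iff_norm] at this
  exact lt_irrefl _ this

lemma b_to_a (hr : 0 < r) (hS : HypS r hr D U f H) (h : Thm410b r D U f H) : Thm410a r D U f H := by
  obtain ⟨k, hk, hu⟩ := h
  have hF := goodF_of hS hk
  obtain ⟨-, -, -, -, -, -, -, ⟨LU, LUc, LUm, LU0, hLU⟩, -, hD, Uc, Uv, U0, H7⟩ := hS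
  obtain ⟨z, μ, hμ, hz⟩ := flow_exists hF hu H7
  obtain ⟨c, C, hw⟩ := wgt_exists hF hz
  obtain ⟨a₁, ha₁, hlow⟩ := low c hw.c0
  obtain ⟨a₂, ha₂, hup⟩ := hw.v4 hz
  obtain ⟨P, PU, Pu, Pl⟩ := proj_exists Uc Uv U0
  obtain ⟨ν, -, νc, ν0, hν⟩ := minorant (fun j => 1 / (1 + C (j + 3)))
    (fun j => by have := hw.C0 (j + 3); positivity)
  obtain ⟨kU, kc, kl, k0⟩ := hk
  set h : ℝ → Hist n r → ℝ := fun t x => max ‖H t x‖ (μ t * ‖x‖) with hh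
  set la : ℝ → ℝ := fun s => 1 / ν s with hla
  have lac : Continuous la := continuous_const.div νc fun s => (ν0 s).ne'
  have la0 : ∀ s, 0 ≤ la s := fun s => (one_div_pos.2 (ν0 s)).le
  have laC : ∀ s, 0 ≤ s → C (⌊s⌋₊ + 3) ≤ la s := fun s hs => by
    have h1 := hw.C0 (⌊s⌋₊ + 3)
    have h2 := one_div_le_one_div_of_le (ν0 s) (hν s hs)
    rw [one_div_one_div] at h2
    simp only [hla]; linarith
  have LU'c : Continuous fun s => LU (max 0 s) :=
    LUc.comp_continuous (by fun_prop) fun s => mem_Ici.2 (le_max_left 0 s)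
  have P0 : P 0 = 0 := Pu 0 U0
  have Pn : ∀ v, ‖P v‖ ≤ ‖v‖ := fun v => by simpa [P0] using Pl v 0
  have Pc : Continuous P := (LipschitzWith.of_dist_le_mul (K := 1) fun u v => by
    rw [dist_eq_norm, dist_eq_norm, NNReal.coe_one, one_mul]; exact Pl u v).continuous
  have fin : Module.finrank ℝ (Euc m × ℝ) = Module.finrank ℝ (Euc (m + 1)) := by simp
  let e : (Euc m × ℝ) ≃L[ℝ] Euc (m + 1) := ContinuousLinearEquiv.ofFinrankEq fin
  set B := ‖(e.symm : Euc (m + 1) →L[ℝ] Euc m × ℝ)‖ with hB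
  have eb : ∀ φ, ‖(e.symm φ).1‖ ≤ B * ‖φ‖ := fun φ =>
    (norm_fst_le _).trans ((e.symm : Euc (m + 1) →L[ℝ] Euc m × ℝ).le_opNorm φ)
  set B' := ‖(e : (Euc m × ℝ) →L[ℝ] Euc (m + 1))‖ with hB'
  have eb' : ∀ v, ‖e v‖ ≤ B' * ‖v‖ := fun v => (e : (Euc m × ℝ) →L[ℝ] Euc (m + 1)).le_opNorm v
  have B0 : 0 ≤ B := norm_nonneg _
  let Ψr : ℝ → Euc (m + 1) → Euc m → ℝ := fun t φ u => psi la LU t (e.symm φ).2 (P (e.symm φ).1) u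
  have Ψz : ∀ t φ, Ψr t φ (P (e.symm φ).1) = 0 := fun t φ => by simp [Ψr, psi]
  have Ψc : ∀ u, Continuous fun pr : ℝ × Euc (m + 1) => Ψr pr.1 pr.2 u := fun u => by
    have c1 : Continuous fun pr : ℝ × Euc (m + 1) => e.symm pr.2 := e.symm.continuous.comp continuous_snd
    have c2 : Continuous fun pr : ℝ × Euc (m + 1) => P (e.symm pr.2).1 := Pc.comp (continuous_fst.comp c1)
    have c3 : Continuous fun pr : ℝ × Euc (m + 1) => (e.symm pr.2).2 := continuous_snd.comp c1
    have c4 : Continuous fun pr : ℝ × Euc (m + 1) => |pr.1| + |(e.symm pr.2).2| := continuous_fst.abs.add c3.abs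
    have c5 : Continuous fun pr : ℝ × Euc (m + 1) => ‖u - P (e.symm pr.2).1‖ := (continuous_const.sub c2).norm
    exact ((lac.comp c4).mul (LU'c.comp ((c4.add (c2.norm.const_mul 2)).add c5))).mul c5
  let Φ : ℝ → Hist n r → Euc (m + 1) := fun t x => e (k t x, ‖x‖)
  have ΨΦ : ∀ t x u, Ψr t (Φ t x) u = psi la LU t ‖x‖ (k t x) u := fun t x u => by
    simp [Ψr, Φ, Pu _ (kU t x)]
  have K0 : P (e.symm 0).1 = 0 := by simp [P0]
  have dini : ∀ t : ℝ, 0 ≤ t → ∀ x : Hist n r, ∀ v ∈ U, ∀ u, ‖v - k t x‖ ≤ ‖u - k t x‖ → ∀ d ∈ D,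
      diniH (VV D z h c) t x (f t d x v) ≤ ((-VV D z h c t x + Ψr t (Φ t x) u : ℝ) : EReal) := by
    intro t ht x v hv u hvu d hd
    have nx := norm_nonneg x
    have nk := norm_nonneg (k t x)
    have nf := Nat.lt_floor_add_one (t + ‖x‖)
    refine (hw.dini hF hz ht x hd (f t d x v) (N := ⌊t + ‖x‖⌋₊ + 3) (by push_cast; linarith)).trans ?_
    rw [EReal.coe_le_coe_iff, ΨΦ, psi, abs_of_nonneg ht, abs_of_nonneg nx]
    have h1 := hLU t ht x d hd v hv (k t x) (kU t x)
    have h2 := norm_le_norm_add_norm_sub' v (k t x)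
    have h3 : LU (t + ‖x‖ + ‖v‖ + ‖k t x‖) ≤ LU (max 0 (t + ‖x‖ + 2 * ‖k t x‖ + ‖u - k t x‖)) :=
      LUm (mem_Ici.2 (by positivity)) (mem_Ici.2 (le_max_left _ _)) (le_max_of_le_right (by linarith))
    have h4 := mul_le_mul h3 hvu (norm_nonneg _) (LU0 _ (le_max_left _ _))
    have h5 := mul_le_mul (laC (t + ‖x‖) (by positivity)) (h1.trans h4) (norm_nonneg _) (la0 _)
    linarith
  refine ⟨VV D z h c, a₁, a₂, μ, m + 1, fun t φ u => (Ψr t φ u : EReal), Φ, fun s => s, fun s => s, fun _ => B + 1,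
    fun _ => 1, fun _ φ => P (e.symm φ).1, ⟨hw.almost hr, hw.nn, ha₁, ha₂, ⟨continuousOn_const, fun _ _ => one_pos⟩, hμ, ?_,
    ⟨continuousOn_const, fun _ _ => le_rfl, integrableOn_zero, tendsto_const_nhds⟩,
    ⟨continuousOn_id, rfl, fun _ h => h, fun _ h => h⟩, fun _ _ _ => EReal.coe_ne_bot _, ?_, ?_, ?_, ?_, ?_, ?_, ?_⟩,
    ⟨⟨continuousOn_id, strictMono_id.strictMonoOn _, rfl, tendsto_id⟩, ⟨continuousOn_const, fun _ _ => by positivity⟩, ?_⟩,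
    ⟨continuousOn_const, fun _ _ => one_pos⟩, fun _ _ => PU _, fun _ _ => K0, ?_, ?_, ?_⟩
  · intro t ht x
    have mx : 0 ≤ μ t * ‖x‖ := mul_nonneg (hμ.2 t ht).le (norm_nonneg _)
    have h0 : 0 ≤ h t x := le_max_of_le_right mx
    have h1 : a₁ (h t x) ≤ VV D z h c t x := hlow _ _ h0 (hw.v3 hz hD ht x)
    refine ⟨max_le ((ha₁.2.1.monotoneOn (norm_nonneg (H t x)) h0 (le_max_left _ _)).trans h1)
      ((ha₁.2.1.monotoneOn mx h0 (le_max_right _ _)).trans h1), ?_⟩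
    rw [one_mul]; exact hup t ht x
  · intro t ht
    have := Ψz t 0
    rw [K0] at this
    simp only [this, EReal.coe_zero]
  · intro u _
    exact (continuous_coe_real_ereal.comp (Ψc u)).upperSemicontinuous.upperSemicontinuousOn _
  · exact e.continuous.comp_continuousOn (kc.prodMk continuous_snd.norm.continuousOn)
  · intro T hT R hR
    obtain ⟨L, hL⟩ := kl T hT R hR
    refine ⟨B' * max L 1, fun t ht x y hx hy => ?_⟩
    have e1 : Φ t x - Φ t y = e (k t x - k t y, ‖x‖ - ‖y‖) := by
      simp only [Φ]; rw [← map_sub]; rfl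
    rw [e1, mul_assoc]
    refine (eb' _).trans (mul_le_mul_of_nonneg_left ?_ (norm_nonneg _))
    refine max_le ((hL t ht x y hx hy).trans (mul_le_mul_of_nonneg_right (le_max_left _ _) (norm_nonneg _))) ?_
    refine (abs_norm_sub_norm_le x y).trans (le_mul_of_one_le_left (norm_nonneg _) (le_max_right _ _))
  · intro t ht
    simp only [Φ, k0 t ht, norm_zero]
    exact map_zero e
  · intro t ht φ
    refine (iInf_le _ ⟨P (e.symm φ).1, PU _⟩).trans ?_
    simp only [Ψz]; exact le_rfl
  · intro t ht x N u hu lam l0 l1 d hd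
    obtain ⟨i, hi⟩ := comb (u := u) l0 l1 (k t x)
    refine (dini t ht x _ (Uv.sum_mem (fun i _ => l0 i) l1 fun i _ => hu i) (u i) hi d hd).trans ?_
    rw [EReal.coe_add]
    exact add_le_add_right (le_iSup (fun i => (Ψr t (Φ t x) (u i) : EReal)) i) _
  · intro t ht φ
    refine ⟨P (e.symm φ).1, PU _, (Pn _).trans ((eb φ).trans ?_), ?_⟩
    · exact mul_le_mul_of_nonneg_right (by linarith) (norm_nonneg _)
    · simp only [Ψz]; exact le_rfl
  · exact (Pc.comp (continuous_fst.comp (e.symm.continuous.comp continuous_snd))).continuousOn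
  · intro S _ _
    refine ⟨B, fun t φ₁ φ₂ _ _ => (Pl _ _).trans ?_⟩
    have := eb (φ₁ - φ₂)
    rwa [map_sub] at this
  · intro t ht x _
    simp only [Ψz]; exact le_rfl

end ba

section Thm410

variable {n l m : ℕ} {Y : Type*} [NormedAddCommGroup Y] [NormedSpace ℝ Y]
  (r : ℝ) (D : Set (Euc l)) (U : Set (Euc m))
  (f : ℝ → Euc l → Hist n r → Euc m → Euc n) (H : ℝ → Hist n r → Y)

/-- Theorem 4.10: under hypotheses (S1)-(S7), statements (a) and (b) are equivalent. -/
theorem stmt14 (hr : 0 < r) (hS : HypS r hr D U f H) :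
    Thm410a r D U f H ↔ Thm410b r D U f H := by
  exact ⟨a_to_b hr hS, b_to_a hr hS⟩

end Thm410
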